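/- arXiv:2212.07234 — 3 statements merged into one kernel-verified Lean document; each statement's English description precedes it below -/
import Mathlib

section
/- For every ε > 0 there exist δ > 0 and a positive integer N such that for every n ≥ N the following holds: if G is a simple graph on n vertices whose independence number is at most δn, and the edge set of G can be partitioned into two sets E₁ and E₂ such that the graph (V(G), E₁) contains no clique on 3 vertices and the graph (V(G), E₂) contains no clique on 7 vertices, then the number of edges of G is at most (7/16 + ε)·n². -/
set_option linter.unusedSectionVars false
set_option linter.all false

namespace RT37

/-- blue clique: no red edges inside `C`. -/
def BC {ι : Type*} (R : SimpleGraph ι) (C : Finset ι) : Prop :=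
  ∀ i ∈ C, ∀ j ∈ C, i ≠ j → ¬ R.Adj i j

/-- no red triangle -/
def TF {ι : Type*} (R : SimpleGraph ι) : Prop :=
  ∀ a b c, R.Adj a b → R.Adj b c → R.Adj a c → False

section ramsey
variable {ι : Type*} [DecidableEq ι] {R : SimpleGraph ι} [DecidableRel R.Adj]

lemma BC.mono {C D : Finset ι} (h : BC R C) (hD : D ⊆ C) : BC R D :=
  fun i hi j hj => h i (hD hi) j (hD hj)

lemma BC.insert {C : Finset ι} (h : BC R C) {v : ι} (hv : ∀ i ∈ C, ¬ R.Adj v i) :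
    BC R (insert v C) := by
  intro i hi j hj hij
  rw [Finset.mem_insert] at hi hj
  rcases hi with rfl | hi <;> rcases hj with rfl | hj
  · exact absurd rfl hij
  · exact hv j hj
  · exact fun hh => hv i hi hh.symm
  · exact h i hi j hj hij

lemma BC_nbr (hT : TF R) (v : ι) (X : Finset ι) : BC R (X.filter (R.Adj v)) := by
  intro i hi j hj _ hadj
  rw [Finset.mem_filter] at hi hj
  exact hT v i j hi.2 hadj hj.2

lemma ramsey3 (hT : TF R) : ∀ (k : ℕ) (X : Finset ι), (k + 1).choose 2 ≤ X.card →
    ∃ C ⊆ X, C.card = k ∧ BC R C := by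
  intro k
  induction k with
  | zero => intro X _; exact ⟨∅, by simp, by simp, by intro i hi; simp at hi⟩
  | succ k ih =>
    intro X hX
    have e1 : (k + 1 + 1).choose 2 = (k+1).choose 2 + (k + 1) := by
      rw [Nat.choose_succ_succ' (k+1) 1]; simp; ring
    rw [e1] at hX
    have hne : X.Nonempty := by
      rw [← Finset.card_pos]; omega
    obtain ⟨v, hv⟩ := hne
    by_cases hr : k + 1 ≤ (X.filter (R.Adj v)).card
    · obtain ⟨C, hC, hc⟩ := Finset.exists_subset_card_eq hr
      exact ⟨C, hC.trans (Finset.filter_subset _ _), hc, (BC_nbr hT v X).mono hC⟩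
    · have h1 := Finset.card_filter_add_card_filter_not (s := X) (R.Adj v)
      have h2 : ((X.filter (fun w => ¬ R.Adj v w)).erase v).card + 1
          = (X.filter (fun w => ¬ R.Adj v w)).card :=
        Finset.card_erase_add_one (by simp [hv])
      obtain ⟨C, hC, hc, hb⟩ := ih ((X.filter (fun w => ¬ R.Adj v w)).erase v) (by omega)
      have hmem : ∀ i ∈ C, i ≠ v ∧ i ∈ X ∧ ¬ R.Adj v i := by
        intro i hi
        have := hC hi
        simpa using this
      refine ⟨insert v C, ?_, ?_, hb.insert fun i hi => (hmem i hi).2.2⟩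
      · intro i hi
        rw [Finset.mem_insert] at hi
        rcases hi with rfl | hi
        · exact hv
        · exact (hmem i hi).2.1
      · rw [Finset.card_insert_of_notMem (fun h => (hmem v h).1 rfl), hc]

lemma ramsey33 (hT : TF R) (X : Finset ι) (hX : 6 ≤ X.card) :
    ∃ C ⊆ X, C.card = 3 ∧ BC R C := ramsey3 hT 3 X (by simpa [Nat.choose] using hX)

/-- blue neighbours -/
lemma blue_nbr_count (v : ι) (X : Finset ι) (hv : v ∈ X) :
    (X.filter (R.Adj v)).card + ((X.erase v).filter (fun w => ¬ R.Adj v w)).card + 1 = X.card := by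
  have h1 := Finset.card_filter_add_card_filter_not (s := X.erase v) (fun w => R.Adj v w)
  have h2 := Finset.card_erase_add_one hv
  have h3 : (X.erase v).filter (R.Adj v) = X.filter (R.Adj v) := by
    ext w; simp only [Finset.mem_filter, Finset.mem_erase]
    constructor
    · rintro ⟨⟨_, h⟩, h'⟩; exact ⟨h, h'⟩
    · rintro ⟨h, h'⟩; exact ⟨⟨h'.ne', h⟩, h'⟩
  rw [h3] at h1
  omega

/-- a vertex with six blue neighbours gives a blue `K₄` through it. -/
lemma blue_six (hT : TF R) (v : ι) (X : Finset ι) (hv : v ∈ X)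
    (h : 6 ≤ ((X.erase v).filter (fun w => ¬ R.Adj v w)).card) :
    ∃ C ⊆ X, C.card = 4 ∧ BC R C ∧ v ∈ C := by
  obtain ⟨C, hC, hc, hb⟩ := ramsey33 hT _ h
  have hmem : ∀ i ∈ C, i ≠ v ∧ i ∈ X ∧ ¬ R.Adj v i := by
    intro i hi
    have := hC hi
    simpa [and_assoc] using this
  refine ⟨insert v C, ?_, ?_, hb.insert fun i hi => (hmem i hi).2.2, by simp⟩
  · intro i hi
    rw [Finset.mem_insert] at hi
    rcases hi with rfl | hi
    · exact hv
    · exact (hmem i hi).2.1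
  · rw [Finset.card_insert_of_notMem (fun h => (hmem v h).1 rfl), hc]

lemma ramsey34 (hT : TF R) (X : Finset ι) (hX : X.card = 9) :
    ∃ C ⊆ X, C.card = 4 ∧ BC R C := by
  by_contra hcon
  push Not at hcon
  have hdeg : ∀ v ∈ X, (X.filter (R.Adj v)).card = 3 := by
    intro v hv
    have h1 := blue_nbr_count (R := R) v X hv
    have h2 : ¬ 6 ≤ ((X.erase v).filter (fun w => ¬ R.Adj v w)).card := by
      intro h
      obtain ⟨C, hC, hc, hb, _⟩ := blue_six hT v X hv h
      exact hcon C hC hc hb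
    have h3 : ¬ 4 ≤ (X.filter (R.Adj v)).card := by
      intro h
      obtain ⟨C, hC, hc⟩ := Finset.exists_subset_card_eq h
      exact hcon C (hC.trans (Finset.filter_subset _ _)) hc ((BC_nbr hT v X).mono hC)
    omega
  -- parity
  let G' : SimpleGraph X := R.induce (X : Set ι)
  have hd : ∀ v : X, G'.degree v = 3 := by
    intro v
    rw [← hdeg v v.2, ← SimpleGraph.card_neighborFinset_eq_degree]
    refine Finset.card_bij (fun a _ => a.1) ?_ ?_ ?_
    · intro a ha
      rw [SimpleGraph.mem_neighborFinset] at ha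
      simp only [Finset.mem_filter]
      exact ⟨a.2, ha⟩
    · intro a _ b _ h; exact Subtype.ext h
    · intro b hb
      rw [Finset.mem_filter] at hb
      refine ⟨⟨b, hb.1⟩, ?_, rfl⟩
      rw [SimpleGraph.mem_neighborFinset]
      exact hb.2
  have hs := G'.sum_degrees_eq_twice_card_edges
  simp only [hd] at hs
  rw [Finset.sum_const, Finset.card_univ, Fintype.card_coe, hX] at hs
  simp only [smul_eq_mul] at hs
  omega

/-- The five-cycle. -/
lemma five_cycle (hT : TF R) (Q : Finset ι) (hQ : Q.card = 5)
    (hb : ∀ C ⊆ Q, C.card = 3 → ¬ BC R C) :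
    ∃ c0 c1 c2 c3 c4, Q = {c0, c1, c2, c3, c4} ∧ R.Adj c0 c1 ∧ R.Adj c1 c2 ∧ R.Adj c2 c3 ∧
      R.Adj c3 c4 ∧ R.Adj c4 c0 ∧ [c0,c1,c2,c3,c4].Nodup := by
  have hdeg : ∀ v ∈ Q, (Q.filter (R.Adj v)).card = 2 := by
    intro v hv
    have h1 := blue_nbr_count (R := R) v Q hv
    have h3 : ¬ 3 ≤ (Q.filter (R.Adj v)).card := by
      intro h
      obtain ⟨C, hC, hc⟩ := Finset.exists_subset_card_eq h
      exact hb C (hC.trans (Finset.filter_subset _ _)) hc ((BC_nbr hT v Q).mono hC)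
    have h2 : ¬ 3 ≤ ((Q.erase v).filter (fun w => ¬ R.Adj v w)).card := by
      intro h
      obtain ⟨C, hC, hc⟩ := Finset.exists_subset_card_eq h
      obtain ⟨a, b, c, hab, hac, hbc, rfl⟩ := Finset.card_eq_three.1 hc
      have ha := hC (show a ∈ _ by simp)
      have hb' := hC (show b ∈ _ by simp)
      have hc' := hC (show c ∈ _ by simp)
      simp only [Finset.mem_filter, Finset.mem_erase] at ha hb' hc'
      have key : ∀ x y, x ∈ Q → y ∈ Q → x ≠ v → y ≠ v → x ≠ y → ¬ R.Adj v x → ¬ R.Adj v y →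
          R.Adj x y := by
        intro x y hx hy hxv hyv hxy h1 h2
        by_contra h3
        refine hb {v, x, y} ?_ ?_ ?_
        · intro i; simp; grind
        · rw [Finset.card_eq_three]; exact ⟨v, x, y, hxv.symm, hyv.symm, hxy, rfl⟩
        · intro i hi j hj hij
          have := R.adj_comm x y
          have := R.adj_comm v y
          have := R.adj_comm v x
          simp at hi hj; grind
      exact hT a b c (key a b (by tauto) (by tauto) (by tauto) (by tauto) hab (by tauto) (by tauto))
        (key b c (by tauto) (by tauto) (by tauto) (by tauto) hbc (by tauto) (by tauto))
        (key a c (by tauto) (by tauto) (by tauto) (by tauto) hac (by tauto) (by tauto))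
    omega
  have other : ∀ v ∈ Q, ∀ w ∈ Q, R.Adj v w → ∃ z ∈ Q, R.Adj v z ∧ z ≠ w := by
    intro v hv w hw hvw
    have h2 := hdeg v hv
    obtain ⟨a, b, hab, he⟩ := Finset.card_eq_two.1 h2
    have ha : a ∈ Q.filter (R.Adj v) := by rw [he]; simp
    have hb : b ∈ Q.filter (R.Adj v) := by rw [he]; simp
    rw [Finset.mem_filter] at ha hb
    by_cases h : a = w
    · exact ⟨b, hb.1, hb.2, fun h' => hab (h.trans h'.symm)⟩
    · exact ⟨a, ha.1, ha.2, h⟩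
  have hne : Q.Nonempty := by rw [← Finset.card_pos]; omega
  obtain ⟨c0, h0⟩ := hne
  obtain ⟨c1, c4, h14, he⟩ := Finset.card_eq_two.1 (hdeg c0 h0)
  have m1 : c1 ∈ Q.filter (R.Adj c0) := by rw [he]; simp
  have m4 : c4 ∈ Q.filter (R.Adj c0) := by rw [he]; simp
  rw [Finset.mem_filter] at m1 m4
  obtain ⟨c2, m2, a12, n20⟩ := other c1 m1.1 c0 h0 m1.2.symm
  obtain ⟨c3, m3, a43, n30⟩ := other c4 m4.1 c0 h0 m4.2.symm
  have hdeg0 : ∀ x ∈ Q, R.Adj c0 x → x = c1 ∨ x = c4 := by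
    intro x hx hax
    have : x ∈ Q.filter (R.Adj c0) := by rw [Finset.mem_filter]; exact ⟨hx, hax⟩
    rw [he] at this; simpa using this
  have n14 : ¬ R.Adj c1 c4 := fun h => hT c0 c1 c4 m1.2 h m4.2
  have a01 := m1.2
  have a04 := m4.2
  have e01 := a01.ne
  have e04 := a04.ne
  have e12 := a12.ne
  have e43 := a43.ne
  have e24 : c2 ≠ c4 := fun h => n14 (h ▸ a12)
  have e31 : c3 ≠ c1 := fun h => n14 (h ▸ a43).symm
  have hn : c2 ≠ c3 := by
    intro h
    subst h
    -- 4-cycle: the fifth vertex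
    obtain ⟨x, hx, hxn⟩ : ∃ x ∈ Q, x ∉ ({c0, c1, c2, c4} : Finset ι) := by
      apply Finset.exists_mem_notMem_of_card_lt_card
      rw [hQ]
      exact lt_of_le_of_lt (Finset.card_le_four) (by norm_num)
    simp only [Finset.mem_insert, Finset.mem_singleton, not_or] at hxn
    have nofull : ∀ v ∈ Q, ∀ a ∈ Q, ∀ b ∈ Q, a ≠ b → R.Adj v a → R.Adj v b → ∀ y ∈ Q, R.Adj v y →
        y = a ∨ y = b := by
      intro v hv a ha b hb' hab hva hvb y hy hvy
      by_contra hcon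
      push Not at hcon
      have := hdeg v hv
      have h3 : ({y, a, b} : Finset ι) ⊆ Q.filter (R.Adj v) := by
        intro i; simp only [Finset.mem_insert, Finset.mem_singleton, Finset.mem_filter]; grind
      have h4 := Finset.card_le_card h3
      rw [Finset.card_eq_three.2 ⟨y, a, b, hcon.1, hcon.2, hab, rfl⟩] at h4
      omega
    obtain ⟨a, b, hab, hx2⟩ := Finset.card_eq_two.1 (hdeg x hx)
    have ha : a ∈ Q.filter (R.Adj x) := by rw [hx2]; simp
    have hb : b ∈ Q.filter (R.Adj x) := by rw [hx2]; simp
    rw [Finset.mem_filter] at ha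
    have p0 : ¬ R.Adj c0 x := fun h => by
      rcases hdeg0 x hx h with h | h <;> tauto
    have p1 : ¬ R.Adj c1 x := fun h => by
      rcases nofull c1 m1.1 c0 h0 c2 m2 n20.symm a01.symm a12 x hx h with h | h <;> tauto
    have p4 : ¬ R.Adj c4 x := fun h => by
      rcases nofull c4 m4.1 c0 h0 c2 m2 n20.symm a04.symm a43 x hx h with h | h <;> tauto
    have p2 : ¬ R.Adj c2 x := fun h => by
      rcases nofull c2 m2 c1 m1.1 c4 m4.1 h14 a12.symm a43.symm x hx h with h | h <;> tauto
    have hax : a ≠ x := ha.2.ne'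
    have hcard : ({a, x, c0, c1, c2, c4} : Finset ι).card ≤ 5 := by
      rw [← hQ]; apply Finset.card_le_card
      intro i; simp only [Finset.mem_insert, Finset.mem_singleton]; grind
    have := R.adj_comm a x
    have : a ≠ c0 ∧ a ≠ c1 ∧ a ≠ c2 ∧ a ≠ c4 := by
      refine ⟨?_, ?_, ?_, ?_⟩ <;> rintro rfl <;> tauto
    rw [Finset.card_insert_of_notMem (by simp; tauto), Finset.card_insert_of_notMem (by simp; tauto),
      Finset.card_insert_of_notMem (by simp; grind), Finset.card_insert_of_notMem (by simp; grind),
      Finset.card_insert_of_notMem (by simp; grind), Finset.card_singleton] at hcard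
    omega
  have hQe : Q = {c0, c1, c2, c3, c4} := by
    symm
    apply Finset.eq_of_subset_of_card_le
    · intro i; simp only [Finset.mem_insert, Finset.mem_singleton]; grind
    · rw [hQ, Finset.card_insert_of_notMem (by simp; grind),
        Finset.card_insert_of_notMem (by simp; grind),
        Finset.card_insert_of_notMem (by simp; grind), Finset.card_insert_of_notMem (by simp; grind),
        Finset.card_singleton]
  have a23 : R.Adj c2 c3 := by
    by_contra hnn
    refine hb {c0, c2, c3} ?_ ?_ ?_
    · intro i; simp only [Finset.mem_insert, Finset.mem_singleton]; grind
    · rw [Finset.card_eq_three]; exact ⟨c0, c2, c3, n20.symm, n30.symm, hn, rfl⟩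
    · have q2 : ¬ R.Adj c0 c2 := fun h => by rcases hdeg0 c2 m2 h with h | h <;> grind
      have q3 : ¬ R.Adj c0 c3 := fun h => by rcases hdeg0 c3 m3 h with h | h <;> grind
      have := R.adj_comm c0 c2
      have := R.adj_comm c0 c3
      have := R.adj_comm c2 c3
      intro i hi j hj hij
      simp only [Finset.mem_insert, Finset.mem_singleton] at hi hj; grind
  refine ⟨c0, c1, c2, c3, c4, hQe, a01, a12, a23, a43.symm, a04.symm, ?_⟩
  simp; grind

end ramsey
end RT37

set_option linter.unusedSectionVars false
set_option linter.all false

namespace RT37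
section comb
variable {ι : Type*} [DecidableEq ι] {R : SimpleGraph ι} [DecidableRel R.Adj]

lemma BC3 {a b c : ι} (h1 : ¬ R.Adj a b) (h2 : ¬ R.Adj a c) (h3 : ¬ R.Adj b c) :
    BC R {a, b, c} := by
  have := R.adj_comm a b
  have := R.adj_comm a c
  have := R.adj_comm b c
  intro i hi j hj hij
  simp only [Finset.mem_insert, Finset.mem_singleton] at hi hj; grind

/-- Structure without weighted blue `K₇`, all clusters of blue type. -/
structure Str (R : SimpleGraph ι) (K U : Finset ι) : Prop where
  tf : TF R
  disj : Disjoint K U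
  e1 : ∀ C ⊆ K ∪ U, BC R C → C.card + (C ∩ K).card ≤ 6
  e2 : ∀ C ⊆ K ∪ U, BC R C → C.card ≤ 5

variable {K U : Finset ι}

lemma Str.nbr (h : Str R K U) (a : ι) :
    2 * (K.filter (R.Adj a)).card + (U.filter (R.Adj a)).card ≤ 6 ∧
    (K.filter (R.Adj a)).card + (U.filter (R.Adj a)).card ≤ 5 := by
  have hb := BC_nbr h.tf a (K ∪ U)
  have h1 := h.e1 _ (Finset.filter_subset _ _) hb
  have h2 := h.e2 _ (Finset.filter_subset _ _) hb
  have e : ((K ∪ U).filter (R.Adj a)).card =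
      (K.filter (R.Adj a)).card + (U.filter (R.Adj a)).card := by
    rw [Finset.filter_union, Finset.card_union_of_disjoint]
    exact Finset.disjoint_filter_filter h.disj
  have e' : ((K ∪ U).filter (R.Adj a)) ∩ K = K.filter (R.Adj a) := by
    ext x; simp only [Finset.mem_inter, Finset.mem_filter, Finset.mem_union]; tauto
  rw [e'] at h1
  omega

/-- no blue `K₄` with three vertices in `K`, finset version. -/
lemma Str.no4 (h : Str R K U) (C : Finset ι) (hC : C ⊆ K) (hc : C.card = 3) (hb : BC R C)
    (u : ι) (hu : u ∈ K ∪ U) (hn : u ∉ C) (hv : ∀ i ∈ C, ¬ R.Adj u i) : False := by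
  have h1 := h.e1 (insert u C) (by
    intro i hi
    rw [Finset.mem_insert] at hi
    rcases hi with rfl | hi
    · exact hu
    · exact Finset.mem_union_left _ (hC hi)) (hb.insert hv)
  rw [Finset.card_insert_of_notMem hn, hc] at h1
  have h2 : C.card ≤ (insert u C ∩ K).card := Finset.card_le_card (by
    intro i hi; simp [hi, hC hi])
  omega

lemma Str.tri (h : Str R K U) {a b c u : ι} (ha : a ∈ K) (hb : b ∈ K) (hc : c ∈ K)
    (hu : u ∈ K ∪ U) (hab : a ≠ b) (hac : a ≠ c) (hbc : b ≠ c) (hua : u ≠ a) (hub : u ≠ b)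
    (huc : u ≠ c) (h1 : ¬ R.Adj a b) (h2 : ¬ R.Adj a c) (h3 : ¬ R.Adj b c) :
    R.Adj u a ∨ R.Adj u b ∨ R.Adj u c := by
  by_contra hcon
  push Not at hcon
  refine h.no4 {a, b, c} ?_ (Finset.card_eq_three.2 ⟨a, b, c, hab, hac, hbc, rfl⟩)
    (BC3 h1 h2 h3) u hu (by simp; tauto) ?_
  · intro i; simp only [Finset.mem_insert, Finset.mem_singleton]; grind
  · intro i; simp only [Finset.mem_insert, Finset.mem_singleton]; grind

lemma Str.triU (h : Str R K U) {a b c u : ι} (ha : a ∈ K) (hb : b ∈ K) (hc : c ∈ K)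
    (hu : u ∈ U) (hab : a ≠ b) (hac : a ≠ c) (hbc : b ≠ c)
    (h1 : ¬ R.Adj a b) (h2 : ¬ R.Adj a c) (h3 : ¬ R.Adj b c) :
    R.Adj u a ∨ R.Adj u b ∨ R.Adj u c := by
  have hd := Finset.disjoint_left.1 h.disj
  refine h.tri ha hb hc (Finset.mem_union_right _ hu) hab hac hbc ?_ ?_ ?_ h1 h2 h3 <;>
    (rintro rfl; exact hd ‹_› hu)

lemma c5_aux (hT : TF R) {U : Finset ι} {p c0 c1 c2 c3 c4 : ι}
    (a01 : R.Adj c0 c1) (a12 : R.Adj c1 c2) (a23 : R.Adj c2 c3) (a34 : R.Adj c3 c4)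
    (a40 : R.Adj c4 c0) (hnd : [c0, c1, c2, c3, c4].Nodup)
    (hcov : ∀ x ∈ ({c0, c1, c2, c3, c4} : Finset ι), ∀ y ∈ ({c0, c1, c2, c3, c4} : Finset ι),
      x ≠ y → ¬ R.Adj x y → ¬ R.Adj p x → ¬ R.Adj p y →
      ∀ u ∈ U, ¬ R.Adj u p → R.Adj u x ∨ R.Adj u y)
    (hp : R.Adj p c0) :
    ∃ c ∈ ({c0, c1, c2, c3, c4} : Finset ι), ∃ b ∈ ({c0, c1, c2, c3, c4} : Finset ι),
      ∃ b' ∈ ({c0, c1, c2, c3, c4} : Finset ι), b ≠ b' ∧ R.Adj c b ∧ R.Adj c b' ∧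
      ∀ u ∈ U, ¬ R.Adj u p → R.Adj u c := by
  simp only [List.nodup_cons, List.mem_cons, not_or, List.not_mem_nil] at hnd
  have n1 : ¬ R.Adj p c1 := fun h => hT p c0 c1 hp a01 h
  have n4 : ¬ R.Adj p c4 := fun h => hT p c0 c4 hp a40.symm h
  have n13 : ¬ R.Adj c1 c3 := fun h => hT c1 c2 c3 a12 a23 h
  have n14 : ¬ R.Adj c1 c4 := fun h => hT c1 c0 c4 a01.symm a40.symm h
  have n24 : ¬ R.Adj c2 c4 := fun h => hT c2 c3 c4 a23 a34 h
  have k13 := hcov c1 (by simp) c3 (by simp) (by tauto) n13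
  have k14 := hcov c1 (by simp) c4 (by simp) (by tauto) n14 n1 n4
  have k24 := hcov c2 (by simp) c4 (by simp) (by tauto) n24
  by_cases h3 : R.Adj p c3
  · have n2 : ¬ R.Adj p c2 := fun h => hT p c2 c3 h a23 h3
    refine ⟨c4, by simp, c3, by simp, c0, by simp, by grind, a34.symm, a40, ?_⟩
    intro u hu hup
    have := k14 u hu hup
    have := k24 n2 n4 u hu hup
    by_contra hc
    exact hT u c1 c2 (by tauto) a12 (by tauto)
  · refine ⟨c1, by simp, c0, by simp, c2, by simp, by grind, a01.symm, a12, ?_⟩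
    intro u hu hup
    have := k13 n1 h3 u hu hup
    have := k14 u hu hup
    by_contra hc
    exact hT u c3 c4 (by tauto) a34 (by tauto)

lemma prop5 {p0 p1 p2 p3 p4 : Prop} (k13 : p1 ∨ p3) (k14 : p1 ∨ p4) (k24 : p2 ∨ p4)
    (k02 : p0 ∨ p2) (k03 : p0 ∨ p3) (t01 : ¬ (p0 ∧ p1)) (t12 : ¬ (p1 ∧ p2))
    (t23 : ¬ (p2 ∧ p3)) (t34 : ¬ (p3 ∧ p4)) (t40 : ¬ (p4 ∧ p0)) : False := by
  grind

lemma prop_both {z z' q q' : Prop} (k1 : z ∨ z') (k2 : z ∨ q') (k3 : z' ∨ q)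
    (t1 : ¬ (q ∧ z)) (t2 : ¬ (q' ∧ z')) : z ∧ z' := by
  grind

lemma prop_fin {z a q' z' b : Prop} (hz : ¬ z) (k1 : z ∨ a ∨ q') (k2 : z ∨ a ∨ z')
    (k3 : z ∨ b ∨ q') (k4 : z ∨ b ∨ z') (t1 : ¬ (a ∧ b)) (t2 : ¬ (q' ∧ z')) : False := by
  grind

/-- `p` outside a five-cycle `Q`. -/
lemma c5_cover (hT : TF R) {U Q : Finset ι} {p : ι} (hQ : Q.card = 5)
    (hb : ∀ C ⊆ Q, C.card = 3 → ¬ BC R C)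
    (hcov : ∀ x ∈ Q, ∀ y ∈ Q,
      x ≠ y → ¬ R.Adj x y → ¬ R.Adj p x → ¬ R.Adj p y →
      ∀ u ∈ U, ¬ R.Adj u p → R.Adj u x ∨ R.Adj u y) :
    ((∀ c ∈ Q, ¬ R.Adj p c) ∧ ∀ u ∈ U, R.Adj u p) ∨ ((∃ c ∈ Q, R.Adj p c) ∧
    ∃ c ∈ Q, ∃ b ∈ Q, ∃ b' ∈ Q, b ≠ b' ∧ R.Adj c b ∧ R.Adj c b' ∧
      ∀ u ∈ U, ¬ R.Adj u p → R.Adj u c) := by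
  obtain ⟨c0, c1, c2, c3, c4, hQe, a01, a12, a23, a34, a40, hnd⟩ := five_cycle hT Q hQ hb
  have hnd' := hnd
  simp only [List.nodup_cons, List.mem_cons, not_or, List.not_mem_nil] at hnd'
  by_cases hn : ∀ c ∈ Q, ¬ R.Adj p c
  · left
    refine ⟨hn, ?_⟩
    intro u hu
    by_contra hup
    have n13 : ¬ R.Adj c1 c3 := fun h => hT c1 c2 c3 a12 a23 h
    have n14 : ¬ R.Adj c1 c4 := fun h => hT c1 c0 c4 a01.symm a40.symm h
    have n24 : ¬ R.Adj c2 c4 := fun h => hT c2 c3 c4 a23 a34 h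
    have n02 : ¬ R.Adj c0 c2 := fun h => hT c0 c1 c2 a01 a12 h
    have n03 : ¬ R.Adj c0 c3 := fun h => hT c0 c4 c3 a40.symm a34.symm h
    have m0 : c0 ∈ Q := by rw [hQe]; simp
    have m1 : c1 ∈ Q := by rw [hQe]; simp
    have m2 : c2 ∈ Q := by rw [hQe]; simp
    have m3 : c3 ∈ Q := by rw [hQe]; simp
    have m4 : c4 ∈ Q := by rw [hQe]; simp
    have k13 := hcov c1 m1 c3 m3 (by tauto) n13 (hn _ m1) (hn _ m3) u hu hup
    have k14 := hcov c1 m1 c4 m4 (by tauto) n14 (hn _ m1) (hn _ m4) u hu hup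
    have k24 := hcov c2 m2 c4 m4 (by tauto) n24 (hn _ m2) (hn _ m4) u hu hup
    have k02 := hcov c0 m0 c2 m2 (by tauto) n02 (hn _ m0) (hn _ m2) u hu hup
    have k03 := hcov c0 m0 c3 m3 (by tauto) n03 (hn _ m0) (hn _ m3) u hu hup
    have t01 : ¬ (R.Adj u c0 ∧ R.Adj u c1) := fun h => hT u c0 c1 h.1 a01 h.2
    have t12 : ¬ (R.Adj u c1 ∧ R.Adj u c2) := fun h => hT u c1 c2 h.1 a12 h.2
    have t23 : ¬ (R.Adj u c2 ∧ R.Adj u c3) := fun h => hT u c2 c3 h.1 a23 h.2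
    have t34 : ¬ (R.Adj u c3 ∧ R.Adj u c4) := fun h => hT u c3 c4 h.1 a34 h.2
    have t40 : ¬ (R.Adj u c4 ∧ R.Adj u c0) := fun h => hT u c4 c0 h.1 a40 h.2
    exact prop5 k13 k14 k24 k02 k03 t01 t12 t23 t34 t40
  · right
    push Not at hn
    refine ⟨hn, ?_⟩
    obtain ⟨c, hc, hpc⟩ := hn
    have r1 : Q = {c1, c2, c3, c4, c0} := by rw [hQe]; ext x; simp; tauto
    have r2 : Q = {c2, c3, c4, c0, c1} := by rw [hQe]; ext x; simp; tauto
    have r3 : Q = {c3, c4, c0, c1, c2} := by rw [hQe]; ext x; simp; tauto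
    have r4 : Q = {c4, c0, c1, c2, c3} := by rw [hQe]; ext x; simp; tauto
    rw [hQe] at hc
    simp only [Finset.mem_insert, Finset.mem_singleton] at hc
    rcases hc with rfl | rfl | rfl | rfl | rfl
    · rw [hQe] at hcov ⊢
      exact c5_aux hT a01 a12 a23 a34 a40 hnd hcov hpc
    · rw [r1] at hcov ⊢
      exact c5_aux hT a12 a23 a34 a40 a01 (by simp; grind) hcov hpc
    · rw [r2] at hcov ⊢
      exact c5_aux hT a23 a34 a40 a01 a12 (by simp; grind) hcov hpc
    · rw [r3] at hcov ⊢
      exact c5_aux hT a34 a40 a01 a12 a23 (by simp; grind) hcov hpc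
    · rw [r4] at hcov ⊢
      exact c5_aux hT a40 a01 a12 a23 a34 (by simp; grind) hcov hpc

lemma two_le_of {X : Finset ι} {a b b' : ι} (hb : b ∈ X) (hb' : b' ∈ X) (hne : b ≠ b')
    (h1 : R.Adj a b) (h2 : R.Adj a b') : 2 ≤ (X.filter (R.Adj a)).card := by
  rw [← Finset.card_pair hne]
  apply Finset.card_le_card
  intro i; simp only [Finset.mem_insert, Finset.mem_singleton, Finset.mem_filter]; grind

lemma one_le_of {X : Finset ι} {a b : ι} (hb : b ∈ X) (h1 : R.Adj a b) :
    1 ≤ (X.filter (R.Adj a)).card := by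
  rw [Nat.one_le_iff_ne_zero, ← Nat.pos_iff_ne_zero, Finset.card_pos]
  exact ⟨b, by simp [hb, h1]⟩

lemma filter_split (X : Finset ι) (p : ι) :
    (X.filter (R.Adj p)).card + (X.filter (fun u => ¬ R.Adj u p)).card = X.card := by
  rw [← Finset.card_filter_add_card_filter_not (s := X) (R.Adj p)]
  congr 2; ext x; simp [R.adj_comm]

/-- Step A of the (6,13) case. -/
lemma stepA (h : Str R K U) (hK : K.card = 6) (hU : U.card = 7) (p : ι) (hp : p ∈ K)
    (hb : ∀ C ⊆ K.erase p, C.card = 3 → ¬ BC R C) : False := by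
  have hQ : (K.erase p).card = 5 := by rw [Finset.card_erase_of_mem hp, hK]
  have hsp := filter_split (R := R) U p
  rcases c5_cover (U := U) (p := p) h.tf hQ hb (by
    intro x hx y hy hxy h1 h2 h3 u hu hup
    have hx' := Finset.mem_erase.1 hx
    have hy' := Finset.mem_erase.1 hy
    have := h.triU hp hx'.2 hy'.2 hu hx'.1.symm hy'.1.symm hxy h2 h3 h1
    tauto) with ⟨_, hall⟩ | ⟨⟨c', hc', hpc⟩, c, hc, b, hb', b', hb'', hne, h1, h2, hall⟩
  · have := h.nbr p
    have e : U.filter (R.Adj p) = U := Finset.filter_true_of_mem fun u hu => (hall u hu).symm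
    rw [e] at this
    omega
  · have e1 := one_le_of (Finset.mem_of_mem_erase hc') hpc
    have e2 := two_le_of (Finset.mem_of_mem_erase hb') (Finset.mem_of_mem_erase hb'') hne h1 h2
    have n1 := h.nbr p
    have n2 := h.nbr c
    have e3 : (U.filter (fun u => ¬ R.Adj u p)).card ≤ (U.filter (R.Adj c)).card := by
      apply Finset.card_le_card
      intro u hu
      rw [Finset.mem_filter] at hu ⊢
      exact ⟨hu.1, (hall u hu.1 hu.2).symm⟩
    omega

set_option maxHeartbeats 1000000 in
/-- Step B of the (6,13) case: a vertex with exactly one red neighbour in `K`. -/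
lemma stepB (h : Str R K U) (hK : K.card = 6) (hU : U.card = 7) (a b : ι) (ha : a ∈ K)
    (hb : b ∈ K) (hab : R.Adj a b) (huniq : ∀ x ∈ K, R.Adj a x → x = b) : False := by
  have hT := h.tf
  -- for a vertex in K with a red neighbour in K, at least three U's avoid it
  have avoid : ∀ x ∈ K, ∀ y ∈ K, R.Adj x y → 3 ≤ (U.filter (fun u => ¬ R.Adj u x)).card := by
    intro x hx y hy hxy
    have := one_le_of hy hxy
    have := h.nbr x
    have := filter_split (R := R) U x
    omega
  have h3 := avoid a ha b hb hab
  -- the four others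
  have hQ : ((K.erase a).erase b).card = 4 := by
    rw [Finset.card_erase_of_mem (by simp [hb, hab.ne']), Finset.card_erase_of_mem ha, hK]
  set Q := (K.erase a).erase b with hQdef
  have hQm : ∀ x, x ∈ Q ↔ x ≠ b ∧ x ≠ a ∧ x ∈ K := by intro x; simp [hQdef]
  have blueQ : ∀ x ∈ Q, ¬ R.Adj a x := by
    intro x hx hax
    rw [hQm] at hx
    exact hx.1 (huniq x hx.2.2 hax)
  have noQ : ∀ C ⊆ Q, C.card = 3 → ¬ BC R C := by
    intro C hC hc hbc
    refine h.no4 C (fun i hi => ((hQm i).1 (hC hi)).2.2) hc hbc a (Finset.mem_union_left _ ha) ?_ ?_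
    · intro hh; exact ((hQm a).1 (hC hh)).2.1 rfl
    · intro i hi; exact blueQ i (hC hi)
  have hpos : (U.filter (fun u => ¬ R.Adj u a)).Nonempty := by
    rw [← Finset.card_pos]; omega
  obtain ⟨w, hw⟩ := hpos
  rw [Finset.mem_filter] at hw
  have cov : ∀ u ∈ U, ¬ R.Adj u a → ∀ x ∈ Q, ∀ y ∈ Q, x ≠ y → ¬ R.Adj x y →
      R.Adj u x ∨ R.Adj u y := by
    intro u hu hua x hx y hy hxy hn
    have hx' := (hQm x).1 hx
    have hy' := (hQm y).1 hy
    have := h.triU ha hx'.2.2 hy'.2.2 hu hx'.2.1.symm hy'.2.1.symm hxy (blueQ x hx) (blueQ y hy) hn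
    tauto
  -- structure of R_w in Q
  have hZ2 : (Q.filter (R.Adj w)).card = 2 := by
    have s1 := Finset.card_filter_add_card_filter_not (s := Q) (R.Adj w)
    have u1 : ¬ 3 ≤ (Q.filter (R.Adj w)).card := by
      intro hh
      obtain ⟨C, hC, hc⟩ := Finset.exists_subset_card_eq hh
      exact noQ C (hC.trans (Finset.filter_subset _ _)) hc ((BC_nbr hT w Q).mono hC)
    have u2 : ¬ 3 ≤ (Q.filter (fun x => ¬ R.Adj w x)).card := by
      intro hh
      obtain ⟨C, hC, hc⟩ := Finset.exists_subset_card_eq hh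
      obtain ⟨x, y, z, hxy, hxz, hyz, rfl⟩ := Finset.card_eq_three.1 hc
      have hx := hC (show x ∈ _ by simp)
      have hy := hC (show y ∈ _ by simp)
      have hz := hC (show z ∈ _ by simp)
      rw [Finset.mem_filter] at hx hy hz
      have k1 := cov w hw.1 hw.2 x hx.1 y hy.1 hxy
      have k2 := cov w hw.1 hw.2 x hx.1 z hz.1 hxz
      have k3 := cov w hw.1 hw.2 y hy.1 z hz.1 hyz
      exact hT x y z (by tauto) (by tauto) (by tauto)
    omega
  have hZ2' : (Q.filter (fun x => ¬ R.Adj w x)).card = 2 := by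
    have s1 := Finset.card_filter_add_card_filter_not (s := Q) (R.Adj w)
    omega
  obtain ⟨z, z', hzz, hZe⟩ := Finset.card_eq_two.1 hZ2
  obtain ⟨q, q', hqq, hQe⟩ := Finset.card_eq_two.1 hZ2'
  have mz : z ∈ Q.filter (R.Adj w) := by rw [hZe]; simp
  have mz' : z' ∈ Q.filter (R.Adj w) := by rw [hZe]; simp
  have mq : q ∈ Q.filter (fun x => ¬ R.Adj w x) := by rw [hQe]; simp
  have mq' : q' ∈ Q.filter (fun x => ¬ R.Adj w x) := by rw [hQe]; simp
  rw [Finset.mem_filter] at mz mz' mq mq'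
  have nzz : ¬ R.Adj z z' := fun hh => hT w z z' mz.2 hh mz'.2
  have aqq : R.Adj q q' := by
    by_contra hn
    rcases cov w hw.1 hw.2 q mq.1 q' mq'.1 hqq hn with hh | hh <;> tauto
  have hqz : q ≠ z := by rintro rfl; tauto
  have hqz' : q ≠ z' := by rintro rfl; tauto
  have hqpz : q' ≠ z := by rintro rfl; tauto
  have hqpzp : q' ≠ z' := by rintro rfl; tauto
  have c1 : R.Adj q z ∨ R.Adj q z' := by
    by_contra hn
    push Not at hn
    refine noQ {z, z', q} ?_ (Finset.card_eq_three.2 ⟨z, z', q, hzz, hqz.symm, hqz'.symm, rfl⟩)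
      (BC3 nzz (fun hh => hn.1 hh.symm) (fun hh => hn.2 hh.symm))
    intro i; simp only [Finset.mem_insert, Finset.mem_singleton]; grind
  have c2 : R.Adj q' z ∨ R.Adj q' z' := by
    by_contra hn
    push Not at hn
    refine noQ {z, z', q'} ?_ (Finset.card_eq_three.2 ⟨z, z', q', hzz, hqpz.symm, hqpzp.symm, rfl⟩)
      (BC3 nzz (fun hh => hn.1 hh.symm) (fun hh => hn.2 hh.symm))
    intro i; simp only [Finset.mem_insert, Finset.mem_singleton]; grind
  -- wlog q ~ z
  have main : ∀ z z' q q' : ι, z ∈ Q → z' ∈ Q → q ∈ Q → q' ∈ Q → z ≠ z' → q ≠ q' → q ≠ z →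
      q ≠ z' → q' ≠ z → q' ≠ z' → ¬ R.Adj z z' → R.Adj q q' → R.Adj q z → R.Adj q' z' →
      False := by
    intro z z' q q' mz mz' mq mq' hzz hqq hqz hqz' hqpz hqpzp nzz aqq aqz aqz'
    have nzq' : ¬ R.Adj z q' := fun hh => hT q z q' aqz hh aqq
    have nz'q : ¬ R.Adj z' q := fun hh => hT q' z' q aqz' hh aqq.symm
    have both : ∀ u ∈ U, ¬ R.Adj u a → R.Adj u z ∧ R.Adj u z' := by
      intro u hu hua
      have k1 := cov u hu hua z mz z' mz' hzz nzz
      have k2 := cov u hu hua z mz q' mq' hqpz.symm nzq'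
      have k3 := cov u hu hua z' mz' q mq hqz'.symm nz'q
      have t1 : ¬ (R.Adj u q ∧ R.Adj u z) := fun hh => hT u q z hh.1 aqz hh.2
      have t2 : ¬ (R.Adj u q' ∧ R.Adj u z') := fun hh => hT u q' z' hh.1 aqz' hh.2
      exact prop_both k1 k2 k3 t1 t2
    have one : ∀ z ∈ K, ∀ q ∈ K, R.Adj z q → (∀ u ∈ U, ¬ R.Adj u a → R.Adj u z) →
        ∀ x ∈ K, R.Adj z x → x = q := by
      intro z hz q hq hzq hu x hx hzx
      by_contra hne
      have e2 := two_le_of hx hq hne hzx hzq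
      have n2 := h.nbr z
      have e3 : (U.filter (fun u => ¬ R.Adj u a)).card ≤ (U.filter (R.Adj z)).card := by
        apply Finset.card_le_card
        intro u hu'
        rw [Finset.mem_filter] at hu' ⊢
        exact ⟨hu'.1, (hu u hu'.1 hu'.2).symm⟩
      omega
    have kz := ((hQm z).1 mz)
    have kz' := ((hQm z').1 mz')
    have kq := ((hQm q).1 mq)
    have kq' := ((hQm q').1 mq')
    have oz := one z kz.2.2 q kq.2.2 aqz.symm (fun u hu hh => (both u hu hh).1)
    have oz' := one z' kz'.2.2 q' kq'.2.2 aqz'.symm (fun u hu hh => (both u hu hh).2)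
    -- b ~ q'
    have fin : ∀ z z' q q' : ι, z ∈ Q → z' ∈ Q → q ∈ Q → q' ∈ Q → z ≠ z' → q ≠ q' → q ≠ z →
      q ≠ z' → q' ≠ z → q' ≠ z' → R.Adj q z → R.Adj q' z' → (∀ x ∈ K, R.Adj z x → x = q) →
      (∀ x ∈ K, R.Adj z' x → x = q') → R.Adj b q' := by
      intro z z' q q' mz mz' mq mq' hzz hqq hqz hqz' hqpz hqpzp aqz aqz' oz oz'
      have kz := ((hQm z).1 mz)
      have kz' := ((hQm z').1 mz')
      have kq := ((hQm q).1 mq)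
      have kq' := ((hQm q').1 mq')
      by_contra hbq
      have hp2 : (U.filter (fun u => ¬ R.Adj u z)).Nonempty := by
        rw [← Finset.card_pos]
        have := avoid z kz.2.2 q kq.2.2 aqz.symm
        omega
      obtain ⟨u, hu⟩ := hp2
      rw [Finset.mem_filter] at hu
      have nz : ∀ x ∈ K, x ≠ q → ¬ R.Adj z x := fun x hx hxq hh => hxq (oz x hx hh)
      have nz' : ∀ x ∈ K, x ≠ q' → ¬ R.Adj x z' := fun x hx hxq hh => hxq (oz' x hx hh.symm)
      have na : ∀ x ∈ K, x ≠ b → ¬ R.Adj a x := fun x hx hxq hh => hxq (huniq x hx hh)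
      have k1 := h.triU kz.2.2 ha kq'.2.2 hu.1 kz.2.1 hqpz.symm kq'.2.1.symm
        (nz a ha kq.2.1.symm) (nz q' kq'.2.2 hqq.symm) (na q' kq'.2.2 kq'.1)
      have k2 := h.triU kz.2.2 ha kz'.2.2 hu.1 kz.2.1 hzz kz'.2.1.symm
        (nz a ha kq.2.1.symm) (nz z' kz'.2.2 hqz'.symm) (na z' kz'.2.2 kz'.1)
      have k3 := h.triU kz.2.2 hb kq'.2.2 hu.1 kz.1 hqpz.symm kq'.1.symm
        (nz b hb kq.1.symm) (nz q' kq'.2.2 hqq.symm) hbq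
      have k4 := h.triU kz.2.2 hb kz'.2.2 hu.1 kz.1 hzz kz'.1.symm
        (nz b hb kq.1.symm) (nz z' kz'.2.2 hqz'.symm) (nz' b hb kq'.1.symm)
      have t1 : ¬ (R.Adj u a ∧ R.Adj u b) := fun hh => hT u a b hh.1 hab hh.2
      have t2 : ¬ (R.Adj u q' ∧ R.Adj u z') := fun hh => hT u q' z' hh.1 aqz' hh.2
      exact prop_fin hu.2 k1 k2 k3 k4 t1 t2
    have b1 := fin z z' q q' mz mz' mq mq' hzz hqq hqz hqz' hqpz hqpzp aqz aqz' oz oz'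
    have b2 := fin z' z q' q mz' mz mq' mq hzz.symm hqq.symm hqpzp hqpz hqz' hqz aqz' aqz oz' oz
    exact hT b q q' b2 aqq b1
  rcases c1 with c1 | c1
  · have c2' : R.Adj q' z' := by
      rcases c2 with c2 | c2
      · exact (hT q q' z aqq c2 c1).elim
      · exact c2
    exact main z z' q q' mz.1 mz'.1 mq.1 mq'.1 hzz hqq hqz hqz' hqpz hqpzp nzz aqq c1 c2'
  · have c2' : R.Adj q' z := by
      rcases c2 with c2 | c2
      · exact c2
      · exact (hT q q' z' aqq c2 c1).elim
    exact main z' z q q' mz'.1 mz.1 mq.1 mq'.1 hzz.symm hqq hqz' hqz hqpzp hqpz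
      (fun hh => nzz hh.symm) aqq c1 c2'

lemma no613 (h : Str R K U) (hK : K.card = 6) (hU : U.card = 7) : False := by
  have hT := h.tf
  by_cases hA : ∃ u ∈ U, (K.filter (R.Adj u)).card ≤ 1
  · obtain ⟨u, hu, h1⟩ := hA
    have hpe : ∃ p ∈ K, K.filter (R.Adj u) ⊆ {p} := by
      rcases Finset.eq_empty_or_nonempty (K.filter (R.Adj u)) with he | ⟨p, hp⟩
      · have hne : K.Nonempty := by rw [← Finset.card_pos]; omega
        obtain ⟨p, hp⟩ := hne
        exact ⟨p, hp, by rw [he]; simp⟩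
      · refine ⟨p, (Finset.mem_filter.1 hp).1, ?_⟩
        intro x hx
        rw [Finset.card_le_one] at h1
        rw [Finset.mem_singleton]
        exact h1 x hx p hp
    obtain ⟨p, hp, hsub⟩ := hpe
    refine stepA h hK hU p hp ?_
    intro C hC hc hb
    have hn : u ∉ C := fun hh => Finset.disjoint_left.1 h.disj (Finset.mem_of_mem_erase (hC hh)) hu
    refine h.no4 C (hC.trans (Finset.erase_subset _ _)) hc hb u (Finset.mem_union_right _ hu) hn ?_
    intro i hi hui
    have hi' := Finset.mem_erase.1 (hC hi)
    have := hsub (Finset.mem_filter.2 ⟨hi'.2, hui⟩)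
    rw [Finset.mem_singleton] at this
    exact hi'.1 this
  · push Not at hA
    -- double counting
    have hdc : ∑ u ∈ U, (K.filter (R.Adj u)).card = ∑ a ∈ K, (U.filter (R.Adj a)).card := by
      simp only [Finset.card_filter]
      rw [Finset.sum_comm]
      refine Finset.sum_congr rfl fun a _ => Finset.sum_congr rfl fun u _ => ?_
      simp [R.adj_comm]
    have hlow : U.card * 2 ≤ ∑ u ∈ U, (K.filter (R.Adj u)).card := by
      rw [← smul_eq_mul]
      apply Finset.card_nsmul_le_sum
      intro u hu; exact hA u hu
    have hex : ∃ a ∈ K, 3 ≤ (U.filter (R.Adj a)).card := by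
      by_contra hcon
      push Not at hcon
      have : ∑ a ∈ K, (U.filter (R.Adj a)).card ≤ K.card * 2 := by
        rw [← smul_eq_mul]
        apply Finset.sum_le_card_nsmul
        intro a ha; have := hcon a ha; omega
      omega
    obtain ⟨a, ha, h3⟩ := hex
    have n1 := h.nbr a
    have hle : (K.filter (R.Adj a)).card ≤ 1 := by omega
    rcases Finset.eq_empty_or_nonempty (K.filter (R.Adj a)) with he | ⟨b, hb⟩
    · refine stepA h hK hU a ha ?_
      intro C hC hc hb
      refine h.no4 C (hC.trans (Finset.erase_subset _ _)) hc hb a (Finset.mem_union_left _ ha) ?_ ?_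
      · intro hh; exact (Finset.mem_erase.1 (hC hh)).1 rfl
      · intro i hi hai
        have : i ∈ K.filter (R.Adj a) := Finset.mem_filter.2 ⟨(Finset.mem_erase.1 (hC hi)).2, hai⟩
        rw [he] at this; simp at this
    · rw [Finset.card_le_one] at hle
      have hb' := Finset.mem_filter.1 hb
      refine stepB h hK hU a b ha hb'.1 hb'.2 ?_
      intro x hx hax
      exact hle x (Finset.mem_filter.2 ⟨hx, hax⟩) b hb

end comb
end RT37

set_option linter.unusedSectionVars false
set_option linter.all false

namespace RT37
section comb
variable {ι : Type*} [DecidableEq ι] {R : SimpleGraph ι} [DecidableRel R.Adj]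
variable {K U : Finset ι}

/-- a blue four-set with at least three elements in `K` is impossible. -/
lemma Str.no4' (h : Str R K U) (C : Finset ι) (hC : C ⊆ K ∪ U) (hc : C.card = 4) (hb : BC R C)
    (h3 : 3 ≤ (C ∩ K).card) : False := by
  have := h.e1 C hC hb
  omega

lemma card_inter_insert {C X : Finset ι} {u : ι} (hC : C ⊆ insert u X) :
    C.card ≤ (C ∩ X).card + 1 := by
  have : C ⊆ insert u (C ∩ X) := by
    intro i hi
    have := hC hi
    simp only [Finset.mem_insert, Finset.mem_inter] at this ⊢
    tauto
  exact (Finset.card_le_card this).trans (Finset.card_insert_le _ _)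

lemma Str.deg2 (h : Str R K U) (hK : K.card = 7) {v u : ι} (hv : v ∈ K) (hu : u ∈ U)
    (hn : ¬ R.Adj u v) : 2 ≤ (K.filter (R.Adj v)).card := by
  by_contra hlt
  have huK : u ∉ K := fun hh => Finset.disjoint_left.1 h.disj hh hu
  have hX : (insert u K).card = 8 := by rw [Finset.card_insert_of_notMem huK, hK]
  have hf : (insert u K).filter (R.Adj v) = K.filter (R.Adj v) := by
    rw [Finset.filter_insert, if_neg (fun hh => hn hh.symm)]
  have h1 := blue_nbr_count (R := R) v (insert u K) (Finset.mem_insert_of_mem hv)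
  rw [hf, hX] at h1
  obtain ⟨C, hC, hc, hb, hvC⟩ := blue_six h.tf v (insert u K) (Finset.mem_insert_of_mem hv) (by omega)
  refine h.no4' C ?_ hc hb ?_
  · intro i hi
    have := hC hi
    simp only [Finset.mem_insert, Finset.mem_union] at this ⊢
    rcases this with rfl | this
    · exact Or.inr hu
    · exact Or.inl this
  · have := card_inter_insert hC
    omega

lemma two_le_card {X : Finset ι} (h : 2 ≤ X.card) : ∃ a ∈ X, ∃ b ∈ X, a ≠ b := by
  have : 1 < X.card := h
  exact Finset.one_lt_card.1 this

lemma three_le_of {X : Finset ι} {a b c d : ι} (hb : b ∈ X) (hc : c ∈ X) (hd : d ∈ X)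
    (h1 : b ≠ c) (h2 : b ≠ d) (h3 : c ≠ d)
    (k1 : R.Adj a b) (k2 : R.Adj a c) (k3 : R.Adj a d) : 3 ≤ (X.filter (R.Adj a)).card := by
  have : ({b, c, d} : Finset ι).card = 3 := Finset.card_eq_three.2 ⟨b, c, d, h1, h2, h3, rfl⟩
  rw [← this]
  apply Finset.card_le_card
  intro i; simp only [Finset.mem_insert, Finset.mem_singleton, Finset.mem_filter]; grind

lemma four_le_of {X : Finset ι} {a b c d e : ι} (hb : b ∈ X) (hc : c ∈ X) (hd : d ∈ X) (he : e ∈ X)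
    (h1 : b ≠ c) (h2 : b ≠ d) (h3 : c ≠ d) (h4 : b ≠ e) (h5 : c ≠ e) (h6 : d ≠ e)
    (k1 : R.Adj a b) (k2 : R.Adj a c) (k3 : R.Adj a d) (k4 : R.Adj a e) :
    4 ≤ (X.filter (R.Adj a)).card := by
  have : ({b, c, d, e} : Finset ι).card = 4 := by
    rw [Finset.card_insert_of_notMem (by simp; tauto), Finset.card_eq_three.2 ⟨c, d, e, h3, h5, h6, rfl⟩]
  rw [← this]
  apply Finset.card_le_card
  intro i; simp only [Finset.mem_insert, Finset.mem_singleton, Finset.mem_filter]; grind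

/-- Case I of (7,10). -/
lemma case1 (h : Str R K U) (hK : K.card = 7) (hU : U.card = 3) {v : ι} (hv : v ∈ K)
    (hall : ∀ u ∈ U, R.Adj u v) : False := by
  have hT := h.tf
  have n1 := h.nbr v
  have eU : U.filter (R.Adj v) = U := Finset.filter_true_of_mem fun u hu => (hall u hu).symm
  rw [eU, hU] at n1
  have hd : (K.filter (R.Adj v)).card = 1 := by
    by_contra hne
    have h1 := blue_nbr_count (R := R) v K hv
    obtain ⟨C, hC, hc, hb, -⟩ := blue_six h.tf v K hv (by omega)
    refine h.no4' C (hC.trans Finset.subset_union_left) hc hb ?_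
    rw [Finset.inter_eq_left.2 hC]; omega
  obtain ⟨w, hw⟩ := Finset.card_eq_one.1 hd
  have hw' : w ∈ K.filter (R.Adj v) := by rw [hw]; simp
  rw [Finset.mem_filter] at hw'
  have huniq : ∀ x ∈ K, R.Adj v x → x = w := by
    intro x hx hvx
    have : x ∈ K.filter (R.Adj v) := by simp [hx, hvx]
    rw [hw] at this; simpa using this
  have nw : ∀ u ∈ U, ¬ R.Adj u w := fun u hu hh => hT u v w (hall u hu) hw'.2 hh
  obtain ⟨u0, hu0⟩ : U.Nonempty := by rw [← Finset.card_pos]; omega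
  have d2 := h.deg2 hK hw'.1 hu0 (nw u0 hu0)
  have hwv : w ≠ v := hw'.2.ne'
  have hQ : ((K.erase v).erase w).card = 5 := by
    rw [Finset.card_erase_of_mem (by simp [hw'.1, hwv]), Finset.card_erase_of_mem hv, hK]
  have hQm : ∀ x, x ∈ (K.erase v).erase w ↔ x ≠ w ∧ x ≠ v ∧ x ∈ K := by intro x; simp
  have hb : ∀ C ⊆ (K.erase v).erase w, C.card = 3 → ¬ BC R C := by
    intro C hC hc hbc
    refine h.no4 C (fun i hi => ((hQm i).1 (hC hi)).2.2) hc hbc v (Finset.mem_union_left _ hv) ?_ ?_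
    · intro hh; exact ((hQm v).1 (hC hh)).2.1 rfl
    · intro i hi hh; exact ((hQm i).1 (hC hi)).1 (huniq i ((hQm i).1 (hC hi)).2.2 hh)
  rcases c5_cover (U := U) (p := w) h.tf hQ hb (by
    intro x hx y hy hxy h1 h2 h3 u hu hup
    have hx' := (hQm x).1 hx
    have hy' := (hQm y).1 hy
    have := h.triU hw'.1 hx'.2.2 hy'.2.2 hu hx'.1.symm hy'.1.symm hxy h2 h3 h1
    tauto) with ⟨hno, _⟩ | ⟨-, c, hc, b, hb', b', hb'', hne, h1, h2, hall'⟩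
  · obtain ⟨a, ha, b, hb, hab⟩ := two_le_card d2
    rw [Finset.mem_filter] at ha hb
    have e1 : a = v := by
      by_contra hne
      exact hno a ((hQm a).2 ⟨ha.2.ne', hne, ha.1⟩) ha.2
    have e2 : b = v := by
      by_contra hne
      exact hno b ((hQm b).2 ⟨hb.2.ne', hne, hb.1⟩) hb.2
    exact hab (e1.trans e2.symm)
  · have e2 := two_le_of ((hQm _).1 hb').2.2 ((hQm _).1 hb'').2.2 hne h1 h2
    have n2 := h.nbr c
    have e3 : U.filter (R.Adj c) = U :=
      Finset.filter_true_of_mem fun u hu => (hall' u hu (nw u hu)).symm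
    rw [e3, hU] at n2
    omega

/-- `U` is blue in the (7,10) case. -/
lemma Ublue (h : Str R K U) (hK : K.card = 7) : BC R U := by
  intro u hu u' hu' hne hadj
  have hd := Finset.disjoint_left.1 h.disj
  have huK : u ∉ K := fun hh => hd hh hu
  have hu'K : u' ∉ K := fun hh => hd hh hu'
  have hX : (insert u (insert u' K)).card = 9 := by
    rw [Finset.card_insert_of_notMem (by simp [hne, huK]), Finset.card_insert_of_notMem hu'K, hK]
  obtain ⟨C, hC, hc, hb⟩ := ramsey34 h.tf _ hX
  have hCU : C ⊆ K ∪ U := by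
    intro i hi
    have := hC hi
    simp only [Finset.mem_insert, Finset.mem_union] at this ⊢
    rcases this with rfl | rfl | this
    · exact Or.inr hu
    · exact Or.inr hu'
    · exact Or.inl this
  refine h.no4' C hCU hc hb ?_
  by_cases h1 : u ∈ C
  · have : C ⊆ insert u K := by
      intro i hi
      have := hC hi
      simp only [Finset.mem_insert] at this ⊢
      rcases this with rfl | rfl | this
      · exact Or.inl rfl
      · exact (hb u h1 i hi hne hadj).elim
      · exact Or.inr this
    have := card_inter_insert this
    omega
  · have : C ⊆ insert u' K := by
      intro i hi
      have := hC hi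
      simp only [Finset.mem_insert] at this ⊢
      rcases this with rfl | rfl | this
      · exact (h1 hi).elim
      · exact Or.inl rfl
      · exact Or.inr this
    have := card_inter_insert this
    omega

lemma F4 (h : Str R K U) (hK : K.card = 7) (hU : U.card = 3) {c c' : ι} (hc : c ∈ K) (hc' : c' ∈ K)
    (hne : c ≠ c') (hn : ¬ R.Adj c c') : ∃ u ∈ U, R.Adj u c ∨ R.Adj u c' := by
  by_contra hcon
  push Not at hcon
  have hd := Finset.disjoint_left.1 h.disj
  have hb : BC R (insert c (insert c' U)) := by
    refine ((Ublue h hK).insert fun i hi hh => (hcon i hi).2 hh.symm).insert ?_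
    intro i hi hh
    rw [Finset.mem_insert] at hi
    rcases hi with rfl | hi
    · exact hn hh
    · exact (hcon i hi).1 hh.symm
  have h1 := h.e1 _ (by
    intro i hi
    simp only [Finset.mem_insert, Finset.mem_union] at hi ⊢
    rcases hi with rfl | rfl | hi
    · exact Or.inl hc
    · exact Or.inl hc'
    · exact Or.inr hi) hb
  have h2 : (insert c (insert c' U)).card = 5 := by
    rw [Finset.card_insert_of_notMem (by simp [hne]; exact fun hh => hd hc hh),
      Finset.card_insert_of_notMem (fun hh => hd hc' hh), hU]
  have h3 : 2 ≤ (insert c (insert c' U) ∩ K).card := by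
    rw [← Finset.card_pair hne]
    apply Finset.card_le_card
    intro i; simp only [Finset.mem_insert, Finset.mem_singleton, Finset.mem_inter]; grind
  omega

lemma prop_par {a b c : Prop} (h1 : a ∨ b) (h2 : a ∨ c) (h3 : b ∨ c) (t1 : ¬ (a ∧ b))
    (t2 : ¬ (a ∧ c)) (t3 : ¬ (b ∧ c)) : False := by grind

/-- a vertex in the intersection of two red neighbourhoods -/
lemma xfact (h : Str R K U) (hK : K.card = 7) (hU : U.card = 3) 
    (hall : ∀ v ∈ K, ∃ u ∈ U, ¬ R.Adj u v) {u u' u'' : ι} (hUe : U = {u, u', u''})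
    {x : ι} (hx : x ∈ K) (h1 : R.Adj u x) (h2 : R.Adj u' x) :
    ∃ y ∈ K, ∃ z ∈ K, z ≠ y ∧ R.Adj x y ∧ R.Adj x z ∧ R.Adj u'' y ∧ ¬ R.Adj u y ∧ ¬ R.Adj u' y ∧
      ¬ R.Adj u z ∧ ¬ R.Adj u' z := by
  have hT := h.tf
  obtain ⟨w, hw, hwx⟩ := hall x hx
  obtain ⟨c, hc, c', hc', hne⟩ := two_le_card (h.deg2 hK hx hw hwx)
  rw [Finset.mem_filter] at hc hc'
  have k : ∀ c, R.Adj x c → ¬ R.Adj u c ∧ ¬ R.Adj u' c := fun c hc =>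
    ⟨fun hh => hT u x c h1 hc hh, fun hh => hT u' x c h2 hc hh⟩
  obtain ⟨w', hw', hh⟩ := F4 h hK hU hc.1 hc'.1 hne (fun hh => hT x c c' hc.2 hh hc'.2)
  have : w' = u'' := by
    rw [hUe] at hw'
    simp only [Finset.mem_insert, Finset.mem_singleton] at hw'
    have := k c hc.2
    have := k c' hc'.2
    rcases hw' with rfl | rfl | rfl
    · tauto
    · tauto
    · rfl
  subst this
  rcases hh with hh | hh
  · exact ⟨c, hc.1, c', hc'.1, hne.symm, hc.2, hc'.2, hh, (k c hc.2).1, (k c hc.2).2,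
      (k c' hc'.2).1, (k c' hc'.2).2⟩
  · exact ⟨c', hc'.1, c, hc.1, hne, hc'.2, hc.2, hh, (k c' hc'.2).1, (k c' hc'.2).2,
      (k c hc.2).1, (k c hc.2).2⟩

lemma Rcard (h : Str R K U) (hK : K.card = 7) (hU : U.card = 3) 
    (hall : ∀ v ∈ K, ∃ u ∈ U, ¬ R.Adj u v) {u : ι} (hu : u ∈ U) :
    (K.filter (R.Adj u)).card = 3 := by
  have hT := h.tf
  have hd := Finset.disjoint_left.1 h.disj
  have le3 : (K.filter (R.Adj u)).card ≤ 3 := by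
    have := h.nbr u
    omega
  have hs := Finset.card_filter_add_card_filter_not (s := K) (R.Adj u)
  have nob : ∀ C ⊆ K.filter (fun x => ¬ R.Adj u x), C.card = 3 → ¬ BC R C := by
    intro C hC hc hb
    refine h.no4 C (hC.trans (Finset.filter_subset _ _)) hc hb u (Finset.mem_union_right _ hu) ?_ ?_
    · intro hh
      exact hd (Finset.mem_filter.1 (hC hh)).1 hu
    · intro i hi
      exact (Finset.mem_filter.1 (hC hi)).2
  have ge2 : 2 ≤ (K.filter (R.Adj u)).card := by
    by_contra hlt
    obtain ⟨C, hC, hc, hb⟩ := ramsey33 hT (K.filter (fun x => ¬ R.Adj u x)) (by omega)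
    exact nob C hC hc hb
  by_contra hne
  have h2 : (K.filter (R.Adj u)).card = 2 := by omega
  obtain ⟨p, q, hpq, hpqe⟩ := Finset.card_eq_two.1 h2
  have mp : p ∈ K.filter (R.Adj u) := by rw [hpqe]; simp
  have mq : q ∈ K.filter (R.Adj u) := by rw [hpqe]; simp
  rw [Finset.mem_filter] at mp mq
  obtain ⟨w, hw, hwp⟩ := hall p mp.1
  obtain ⟨c, hc, c', hc', hcc⟩ := two_le_card (h.deg2 hK mp.1 hw hwp)
  rw [Finset.mem_filter] at hc hc'
  have big : ∀ c ∈ K, R.Adj p c → ∀ u' ∈ U, ¬ R.Adj u' c := by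
    intro c hc hpc u' hu' hu'c
    have hcu : ¬ R.Adj u c := fun hh => hT u p c mp.2 hpc hh
    obtain ⟨c0, c1, c2, c3, c4, hQe, a01, a12, a23, a34, a40, hnd⟩ := five_cycle hT
      (K.filter (fun x => ¬ R.Adj u x)) (by omega) nob
    have two : ∃ a ∈ K.filter (fun x => ¬ R.Adj u x), ∃ b ∈ K.filter (fun x => ¬ R.Adj u x),
        a ≠ b ∧ R.Adj c a ∧ R.Adj c b := by
      have mc : c ∈ K.filter (fun x => ¬ R.Adj u x) := by simp [hc, hcu]
      rw [hQe] at mc ⊢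
      simp only [List.nodup_cons, List.mem_cons, not_or, List.not_mem_nil] at hnd
      simp only [Finset.mem_insert, Finset.mem_singleton] at mc
      rcases mc with rfl | rfl | rfl | rfl | rfl
      · exact ⟨c1, by simp, c4, by simp, by grind, a01, a40.symm⟩
      · exact ⟨c0, by simp, c2, by simp, by grind, a01.symm, a12⟩
      · exact ⟨c1, by simp, c3, by simp, by grind, a12.symm, a23⟩
      · exact ⟨c2, by simp, c4, by simp, by grind, a23.symm, a34⟩
      · exact ⟨c3, by simp, c0, by simp, by grind, a34.symm, a40⟩
    obtain ⟨a, ha, b, hb, hab, hca, hcb⟩ := two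
    rw [Finset.mem_filter] at ha hb
    have e := three_le_of ha.1 hb.1 mp.1 hab (by rintro rfl; exact ha.2 mp.2)
      (by rintro rfl; exact hb.2 mp.2) hca hcb hpc.symm
    have e2 := one_le_of hu' hu'c.symm
    have := h.nbr c
    omega
  obtain ⟨w', hw', hh⟩ := F4 h hK hU hc.1 hc'.1 hcc (fun hh => hT p c c' hc.2 hh hc'.2)
  rcases hh with hh | hh
  · exact big c hc.1 hc.2 w' hw' hh
  · exact big c' hc'.1 hc'.2 w' hw' hh

lemma perm7a {a b c d e f g : ι} : ({a, b, c, d, e, f, g} : Finset ι) ⊆ {b, a, c, e, d, f, g} := by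
  intro i; simp only [Finset.mem_insert, Finset.mem_singleton]; tauto

lemma perm7b {a b c d e f g : ι} : ({a, b, c, d, e, f, g} : Finset ι) ⊆ {c, a, b, f, d, e, g} := by
  intro i; simp only [Finset.mem_insert, Finset.mem_singleton]; tauto

set_option maxHeartbeats 1000000 in
lemma no710 (h : Str R K U) (hK : K.card = 7) (hU : U.card = 3) : False := by
  have hT := h.tf
  have hd := Finset.disjoint_left.1 h.disj
  by_cases hcase : ∃ v ∈ K, ∀ u ∈ U, R.Adj u v
  · obtain ⟨v, hv, hall⟩ := hcase
    exact case1 h hK hU hv hall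
  push Not at hcase
  obtain ⟨u1, u2, u3, n12, n13, n23, hUe⟩ := Finset.card_eq_three.1 hU
  have m1 : u1 ∈ U := by rw [hUe]; simp
  have m2 : u2 ∈ U := by rw [hUe]; simp
  have m3 : u3 ∈ U := by rw [hUe]; simp
  -- intersections
  have inter : ∀ u ∈ U, ∀ u' ∈ U, ∃ x ∈ K, R.Adj u x ∧ R.Adj u' x := by
    intro u hu u' hu'
    by_contra hcon
    push Not at hcon
    refine h.no4 (K.filter (R.Adj u)) (Finset.filter_subset _ _) (Rcard h hK hU hcase hu)
      (BC_nbr hT u K) u' (Finset.mem_union_right _ hu') ?_ ?_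
    · intro hh
      exact hd (Finset.mem_filter.1 hh).1 hu'
    · intro i hi
      rw [Finset.mem_filter] at hi
      exact hcon i hi.1 hi.2
  obtain ⟨x3, k3, a31, a32⟩ := inter u1 m1 u2 m2
  obtain ⟨x2, k2, a21, a23⟩ := inter u1 m1 u3 m3
  obtain ⟨x1, k1, a12, a13⟩ := inter u2 m2 u3 m3
  have hall3 : ∀ x ∈ K, ¬ (R.Adj u1 x ∧ R.Adj u2 x ∧ R.Adj u3 x) := by
    intro x hx hh
    obtain ⟨u, hu, hn⟩ := hcase x hx
    rw [hUe] at hu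
    simp only [Finset.mem_insert, Finset.mem_singleton] at hu
    rcases hu with rfl | rfl | rfl <;> tauto
  have b3 : ¬ R.Adj u3 x3 := fun hh => hall3 x3 k3 ⟨a31, a32, hh⟩
  have b2 : ¬ R.Adj u2 x2 := fun hh => hall3 x2 k2 ⟨a21, hh, a23⟩
  have b1 : ¬ R.Adj u1 x1 := fun hh => hall3 x1 k1 ⟨hh, a12, a13⟩
  obtain ⟨y3, ky3, z3, kz3, zy3, xy3, xz3, e33, e31, e32, f31, f32⟩ :=
    xfact h hK hU hcase (u := u1) (u' := u2) (u'' := u3) hUe k3 a31 a32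
  obtain ⟨y2, ky2, z2, kz2, zy2, xy2, xz2, e22, e21, e23, f21, f23⟩ :=
    xfact h hK hU hcase (u := u1) (u' := u3) (u'' := u2) (by rw [hUe]; ext i; simp; tauto) k2 a21 a23
  obtain ⟨y1, ky1, z1, kz1, zy1, xy1, xz1, e11, e12, e13, f12, f13⟩ :=
    xfact h hK hU hcase (u := u2) (u' := u3) (u'' := u1) (by rw [hUe]; ext i; simp; tauto) k1 a12 a13
  have dx32 : x3 ≠ x2 := by rintro rfl; exact b2 a32
  have dx31 : x3 ≠ x1 := by rintro rfl; exact b1 a31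
  have dx21 : x2 ≠ x1 := by rintro rfl; exact b1 a21
  -- R sets explicit
  have full : ∀ u ∈ U, ∀ a b c, a ∈ K → b ∈ K → c ∈ K → a ≠ b → a ≠ c → b ≠ c → R.Adj u a → R.Adj u b →
      R.Adj u c → ∀ x ∈ K, R.Adj u x → x = a ∨ x = b ∨ x = c := by
    intro u hu a b c ha hb hc hab hac hbc ua ub uc x hx ux
    by_contra hcon
    push Not at hcon
    have := four_le_of ha hb hc hx hab hac hbc hcon.1.symm hcon.2.1.symm hcon.2.2.symm ua ub uc ux
    rw [Rcard h hK hU hcase hu] at this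
    omega
  have r1 := full u1 m1 x2 x3 y1 k2 k3 ky1 dx32.symm (by rintro rfl; exact e13 a23)
    (by rintro rfl; exact e12 a32) a21 a31 e11
  have r2 := full u2 m2 x1 x3 y2 k1 k3 ky2 dx31.symm (by rintro rfl; exact e23 a13)
    (by rintro rfl; exact e21 a31) a12 a32 e22
  have r3 := full u3 m3 x1 x2 y3 k1 k2 ky3 dx21.symm (by rintro rfl; exact e32 a12)
    (by rintro rfl; exact e31 a21) a13 a23 e33
  -- z's are in no R
  have g3 : ¬ R.Adj u3 z3 := by
    intro hh
    rcases r3 z3 kz3 hh with rfl | rfl | rfl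
    · exact f32 a12
    · exact f31 a21
    · exact zy3 rfl
  have g2 : ¬ R.Adj u2 z2 := by
    intro hh
    rcases r2 z2 kz2 hh with rfl | rfl | rfl
    · exact f23 a13
    · exact f21 a31
    · exact zy2 rfl
  have g1 : ¬ R.Adj u1 z1 := by
    intro hh
    rcases r1 z1 kz1 hh with rfl | rfl | rfl
    · exact f13 a23
    · exact f12 a32
    · exact zy1 rfl
  have ny12 : y1 ≠ y2 := by rintro rfl; exact e12 e22
  have ny13 : y1 ≠ y3 := by rintro rfl; exact e13 e33
  have ny23 : y2 ≠ y3 := by rintro rfl; exact e23 e33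
  -- K
  have hKe : K = {x1, x2, x3, y1, y2, y3, z3} := by
    symm
    apply Finset.eq_of_subset_of_card_le
    · intro i; simp only [Finset.mem_insert, Finset.mem_singleton]
      rintro (rfl | rfl | rfl | rfl | rfl | rfl | rfl) <;> assumption
    · have hnd : [x1, x2, x3, y1, y2, y3, z3].Nodup := by
        simp only [List.nodup_cons, List.mem_cons, not_or, List.not_mem_nil]
        refine ⟨⟨dx21.symm, dx31.symm, ?_, ?_, ?_, ?_, not_false⟩, ⟨dx32.symm, ?_, ?_, ?_, ?_, not_false⟩, ⟨?_, ?_, ?_, ?_, not_false⟩,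
          ⟨ny12, ny13, ?_, not_false⟩, ⟨ny23, ?_, not_false⟩, ⟨zy3.symm, not_false⟩, ⟨not_false, List.nodup_nil⟩⟩ <;>
          (rintro rfl; contradiction)
      have := List.toFinset_card_of_nodup hnd
      simp only [List.toFinset_cons, List.toFinset_nil, insert_empty_eq, List.length_cons, List.length_nil] at this
      rw [this, hK]
  have zz : ∀ z ∈ K, ¬ R.Adj u1 z → ¬ R.Adj u2 z → ¬ R.Adj u3 z → z = z3 := by
    intro z hz t1 t2 t3
    rw [hKe] at hz
    simp only [Finset.mem_insert, Finset.mem_singleton] at hz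
    rcases hz with rfl | rfl | rfl | rfl | rfl | rfl | rfl <;> first | rfl | contradiction
  have ez2 := zz z2 kz2 f21 g2 f23
  have ez1 := zz z1 kz1 g1 f12 f13
  rw [ez2] at xz2
  rw [ez1] at xz1
  have nz : ∀ y ∈ K, y ≠ x1 → y ≠ x2 → y ≠ x3 → ¬ R.Adj y z3 := by
    intro y hy h1 h2 h3 hh
    have := four_le_of k1 k2 k3 hy dx21.symm dx31.symm dx32.symm h1.symm h2.symm h3.symm
      xz1.symm xz2.symm xz3.symm hh.symm
    have := h.nbr z3
    omega
  have step : ∀ u v v' x x' x'' y y' y'' : ι, u ∈ U → K ⊆ {x, x', x'', y, y', y'', z3} →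
      y ∈ K → x ∈ K → y' ∈ K → y'' ∈ K → x ≠ y' → x ≠ y'' → y' ≠ y'' → 
      R.Adj u x' → R.Adj u x'' → R.Adj u y → R.Adj x y → ¬ R.Adj y z3 →
      (R.Adj y y' ∨ R.Adj y y'') ∧ ¬ (R.Adj y y' ∧ R.Adj y y'') := by
    intro u v v' x x' x'' y y' y'' hu hKs hy hx hy' hy'' d1 d2 d3 ux' ux'' uy xy nyz
    constructor
    · obtain ⟨w, hw, hwy⟩ := hcase y hy
      obtain ⟨c, hc, c', hc', hcc⟩ := two_le_card (h.deg2 hK hy hw hwy)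
      rw [Finset.mem_filter] at hc hc'
      have key : ∀ c ∈ K, R.Adj y c → c = x ∨ c = y' ∨ c = y'' := by
        intro c hc hyc
        have := hKs hc
        simp only [Finset.mem_insert, Finset.mem_singleton] at this
        rcases this with rfl | rfl | rfl | rfl | rfl | rfl | rfl
        · exact Or.inl rfl
        · exact (hT u y c uy hyc ux').elim
        · exact (hT u y c uy hyc ux'').elim
        · exact (hyc.ne rfl).elim
        · exact Or.inr (Or.inl rfl)
        · exact Or.inr (Or.inr rfl)
        · exact (nyz hyc).elim
      rcases key c hc.1 hc.2 with e | e | e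
      · rcases key c' hc'.1 hc'.2 with e' | e' | e'
        · exact (hcc (e.trans e'.symm)).elim
        · left; rw [← e']; exact hc'.2
        · right; rw [← e']; exact hc'.2
      · left; rw [← e]; exact hc.2
      · right; rw [← e]; exact hc.2
    · rintro ⟨q1, q2⟩
      have e := three_le_of hx hy' hy'' d1 d2 d3 xy.symm q1 q2
      have e2 := one_le_of hu uy.symm
      have := h.nbr y
      omega
  have v12 : x1 ≠ y2 := by rintro rfl; exact e23 a13
  have v13 : x1 ≠ y3 := by rintro rfl; exact e32 a12
  have v21 : x2 ≠ y1 := by rintro rfl; exact e13 a23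
  have v23 : x2 ≠ y3 := by rintro rfl; exact e31 a21
  have v31 : x3 ≠ y1 := by rintro rfl; exact e12 a32
  have v32 : x3 ≠ y2 := by rintro rfl; exact e21 a31
  have v11 : x1 ≠ y1 := xy1.ne
  have v22 : x2 ≠ y2 := xy2.ne
  have v33 : x3 ≠ y3 := xy3.ne
  have s1 := step u1 u2 u3 x1 x2 x3 y1 y2 y3 m1 (by rw [hKe]) ky1 k1 ky2 ky3 v12 v13 ny23
    a21 a31 e11 xy1 (nz y1 ky1 v11.symm v21.symm v31.symm)
  have s2 := step u2 u1 u3 x2 x1 x3 y2 y1 y3 m2 (hKe.le.trans perm7a)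
    ky2 k2 ky1 ky3 v21 v23 ny13
    a12 a32 e22 xy2 (nz y2 ky2 v12.symm v22.symm v32.symm)
  have s3 := step u3 u1 u2 x3 x1 x2 y3 y1 y2 m3 (hKe.le.trans perm7b)
    ky3 k3 ky1 ky2 v31 v32 ny12
    a13 a23 e33 xy3 (nz y3 ky3 v13.symm v23.symm v33.symm)
  rw [R.adj_comm y2 y1] at s2
  rw [R.adj_comm y3 y1, R.adj_comm y3 y2] at s3
  exact prop_par s1.1 s2.1 s3.1 s1.2 s2.2 s3.2

lemma no89 (h : Str R K U) (hK : K.card = 8) (hU : U.card = 1) : False := by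
  have hX : (K ∪ U).card = 9 := by
    rw [Finset.card_union_of_disjoint h.disj, hK, hU]
  obtain ⟨C, hC, hc, hb⟩ := ramsey34 h.tf _ hX
  refine h.no4' C hC hc hb ?_
  obtain ⟨u, hu⟩ := Finset.card_eq_one.1 hU
  have : C ⊆ insert u K := by
    intro i hi
    have := hC hi
    rw [hu] at this
    simp only [Finset.mem_insert, Finset.mem_union, Finset.mem_singleton] at this ⊢
    tauto
  have := card_inter_insert this
  omega

lemma no21 (h : Str R K U) (hK : 21 ≤ (K ∪ U).card) : False := by
  obtain ⟨C, hC, hc, hb⟩ := ramsey3 h.tf 6 (K ∪ U) (by simpa [Nat.choose] using hK)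
  have := h.e2 C hC hb
  omega

end comb
end RT37

set_option linter.unusedSectionVars false
set_option linter.all false

namespace RT37
section comb
variable {ι : Type*} [DecidableEq ι] {R : SimpleGraph ι} [DecidableRel R.Adj]
variable {K U : Finset ι}

lemma blue_pair (hT : TF R) {X : Finset ι} (hX : 3 ≤ X.card) :
    ∃ x ∈ X, ∃ y ∈ X, x ≠ y ∧ ¬ R.Adj x y := by
  obtain ⟨C, hC, hc, hb⟩ := ramsey3 hT 2 X (by simpa [Nat.choose] using hX)
  obtain ⟨x, y, hxy, rfl⟩ := Finset.card_eq_two.1 hc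
  exact ⟨x, hC (by simp), y, hC (by simp), hxy, hb x (by simp) y (by simp) hxy⟩

lemma five_one (hT : TF R) (hdis : Disjoint K U) (hK : K.card = 5) (hU : U.card = 7)
    (P1 : ∀ C ⊆ K ∪ U, BC R C → C.card + (C ∩ K).card ≤ 5) : False := by
  have hd := Finset.disjoint_left.1 hdis
  have no3 : ∀ C ⊆ K, C.card = 3 → ¬ BC R C := by
    intro C hC hc hb
    have := P1 C (hC.trans Finset.subset_union_left) hb
    rw [Finset.inter_eq_left.2 hC] at this
    omega
  have red2 : ∀ c ∈ K, ∃ a ∈ K, ∃ b ∈ K, a ≠ b ∧ R.Adj c a ∧ R.Adj c b := by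
    intro c mc
    obtain ⟨c0, c1, c2, c3, c4, hQe, a01, a12, a23, a34, a40, hnd⟩ := five_cycle hT K hK no3
    rw [hQe] at mc ⊢
    simp only [List.nodup_cons, List.mem_cons, not_or, List.not_mem_nil] at hnd
    simp only [Finset.mem_insert, Finset.mem_singleton] at mc
    rcases mc with rfl | rfl | rfl | rfl | rfl
    · exact ⟨c1, by simp, c4, by simp, by grind, a01, a40.symm⟩
    · exact ⟨c0, by simp, c2, by simp, by grind, a01.symm, a12⟩
    · exact ⟨c1, by simp, c3, by simp, by grind, a12.symm, a23⟩
    · exact ⟨c2, by simp, c4, by simp, by grind, a23.symm, a34⟩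
    · exact ⟨c3, by simp, c0, by simp, by grind, a34.symm, a40⟩
  have le2 : ∀ u, (K.filter (R.Adj u)).card ≤ 2 := by
    intro u
    by_contra hlt
    obtain ⟨C, hC, hc⟩ := Finset.exists_subset_card_eq (show 3 ≤ (K.filter (R.Adj u)).card by omega)
    exact no3 C (hC.trans (Finset.filter_subset _ _)) hc ((BC_nbr hT u K).mono hC)
  -- four-set with two in K
  have four : ∀ x ∈ K, ∀ y ∈ K, ∀ u ∈ U, ∀ u' ∈ U, x ≠ y → u ≠ u' → BC R {x, y, u, u'} → False := by
    intro x hx y hy u hu u' hu' hxy huu hb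
    have hxu : x ≠ u := by rintro rfl; exact hd hx hu
    have hxu' : x ≠ u' := by rintro rfl; exact hd hx hu'
    have hyu : y ≠ u := by rintro rfl; exact hd hy hu
    have hyu' : y ≠ u' := by rintro rfl; exact hd hy hu'
    have h1 := P1 _ (by
      intro i; simp only [Finset.mem_insert, Finset.mem_singleton, Finset.mem_union]
      rintro (rfl | rfl | rfl | rfl) <;> tauto) hb
    have h2 : ({x, y, u, u'} : Finset ι).card = 4 := by
      rw [Finset.card_insert_of_notMem (by simp; tauto),
        Finset.card_eq_three.2 ⟨y, u, u', hyu, hyu', huu, rfl⟩]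
    have h3 : 2 ≤ (({x, y, u, u'} : Finset ι) ∩ K).card := by
      rw [← Finset.card_pair hxy]
      apply Finset.card_le_card
      intro i; simp only [Finset.mem_insert, Finset.mem_singleton, Finset.mem_inter]; grind
    omega
  have empt : ∃ u ∈ U, ∀ c ∈ K, ¬ R.Adj u c := by
    by_contra hcon
    push Not at hcon
    choose! f hf using hcon
    have := Finset.card_le_card_of_injOn f (s := U) (t := K) (fun u hu => (hf u hu).1) (by
      intro u hu u' hu' he
      by_contra hne
      obtain ⟨a, ha, b, hb, hab, h1, h2⟩ := red2 (f u) (hf u hu).1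
      refine four a ha b hb u hu u' hu' hab hne ((BC_nbr hT (f u) {a, b, u, u'}).mono ?_)
      intro i hi
      rw [Finset.mem_filter]
      refine ⟨hi, ?_⟩
      simp only [Finset.mem_insert, Finset.mem_singleton] at hi
      rcases hi with rfl | rfl | rfl | rfl
      · exact h1
      · exact h2
      · exact (hf i hu).2.symm
      · rw [he]; exact (hf i hu').2.symm)
    omega
  obtain ⟨u, hu, hue⟩ := empt
  have allred : ∀ u' ∈ U, u' ≠ u → R.Adj u u' := by
    intro u' hu' hne
    by_contra hn
    have hs := Finset.card_filter_add_card_filter_not (s := K) (R.Adj u')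
    have := le2 u'
    obtain ⟨x, hx, y, hy, hxy, hnxy⟩ := blue_pair hT (X := K.filter (fun x => ¬ R.Adj u' x)) (by omega)
    rw [Finset.mem_filter] at hx hy
    refine four x hx.1 y hy.1 u' hu' u hu hxy hne ?_
    refine (((BC3 (a := u') (b := u) (c := u') ?_ ?_ ?_).mono (D := {u', u}) ?_).insert ?_).insert ?_
    · exact fun hh => hn hh.symm
    · exact fun hh => hh.ne rfl
    · exact hn
    · intro i; simp; tauto
    · intro i; simp only [Finset.mem_insert, Finset.mem_singleton]
      rintro (rfl | rfl)
      · exact fun hh => hy.2 hh.symm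
      · exact fun hh => hue y hy.1 hh.symm
    · intro i; simp only [Finset.mem_insert, Finset.mem_singleton]
      rintro (rfl | rfl | rfl)
      · exact hnxy
      · exact fun hh => hx.2 hh.symm
      · exact fun hh => hue x hx.1 hh.symm
  have hb := (BC_nbr hT u U).mono (D := U.erase u) (by
    intro i hi
    rw [Finset.mem_erase] at hi
    rw [Finset.mem_filter]
    exact ⟨hi.2, allred i hi.2 hi.1⟩)
  have := P1 _ ((Finset.erase_subset _ _).trans Finset.subset_union_right) hb
  rw [Finset.card_erase_of_mem hu, hU] at this
  omega

lemma genA (hT : TF R) (hdis : Disjoint K U) (a : ℕ)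
    (P1 : ∀ C ⊆ K ∪ U, BC R C → C.card + (C ∩ K).card + a ≤ 6)
    (P2 : ∀ C ⊆ K ∪ U, BC R C → C.Nonempty → C.card + 1 + a ≤ 6)
    (hc : (8 ≤ K.card + a ∧ K.card ≤ 8 ∧ K.card + U.card + a = 9) ∨
      (7 ≤ K.card + a ∧ K.card ≤ 7 ∧ K.card + U.card + a = 10) ∨
      (6 ≤ K.card + a ∧ K.card ≤ 6 ∧ K.card + U.card + a = 13) ∨
      (K.card + U.card + a = 21)) : False := by
  have hcu := Finset.card_union_of_disjoint hdis
  have big : ∀ k, 1 ≤ k → (k+1).choose 2 ≤ K.card + U.card → k + 1 + a ≤ 6 := by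
    intro k hk hch
    obtain ⟨C, hC, hc, hb⟩ := ramsey3 hT k (K ∪ U) (by omega)
    have := P2 C hC hb (by rw [← Finset.card_pos]; omega)
    omega
  have a6 : a ≤ 6 := by
    have := P1 ∅ (by simp) (by intro i hi; simp at hi)
    omega
  have r6 : 6 ≤ K.card → a = 0 := by
    intro h6
    obtain ⟨C, hC, hc, hb⟩ := ramsey33 hT K h6
    have := P1 C (hC.trans Finset.subset_union_left) hb
    rw [Finset.inter_eq_left.2 hC] at this
    omega
  rcases Nat.eq_zero_or_pos a with rfl | hpos
  · have hS : Str R K U := by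
      refine ⟨hT, hdis, fun C hC hb => by have := P1 C hC hb; omega, ?_⟩
      intro C hC hb
      rcases C.eq_empty_or_nonempty with rfl | hne
      · simp
      · have := P2 C hC hb hne
        omega
    rcases hc with hc | hc | hc | hc
    · exact no89 hS (by omega) (by omega)
    · exact no710 hS (by omega) (by omega)
    · exact no613 hS (by omega) (by omega)
    · exact no21 hS (by omega)
  have b1 := big 1 le_rfl
  have b2 := big 2 (by norm_num)
  have b3 := big 3 (by norm_num)
  have b4 := big 4 (by norm_num)
  have b5 := big 5 (by norm_num)
  norm_num [Nat.choose] at b1 b2 b3 b4 b5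
  by_cases c1 : a = 1
  · subst c1
    have hk : K.card = 5 ∧ U.card = 7 := by omega
    exact five_one hT hdis hk.1 hk.2 (fun C hC hb => by have := P1 C hC hb; omega)
  have hk : K.card = 5 ∧ U.card = 3 ∧ a = 2 := by omega
  obtain ⟨hK, hU, rfl⟩ := hk
  have le2 : ∀ u, (K.filter (R.Adj u)).card ≤ 2 := by
    intro u
    by_contra hlt
    have := P1 _ ((Finset.filter_subset _ _).trans Finset.subset_union_left) (BC_nbr hT u K)
    rw [Finset.inter_eq_left.2 (Finset.filter_subset _ _)] at this
    omega
  obtain ⟨u, hu⟩ : U.Nonempty := by rw [← Finset.card_pos]; omega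
  have huK : ∀ x ∈ K, x ≠ u := by rintro x hx rfl; exact Finset.disjoint_left.1 hdis hx hu
  have hs := Finset.card_filter_add_card_filter_not (s := K) (R.Adj u)
  have := le2 u
  obtain ⟨x, hx, y, hy, hxy, hnxy⟩ := blue_pair hT (X := K.filter (fun x => ¬ R.Adj u x)) (by omega)
  rw [Finset.mem_filter] at hx hy
  have h1 := P1 {x, y, u} (by
    intro i; simp only [Finset.mem_insert, Finset.mem_singleton, Finset.mem_union]
    rintro (rfl | rfl | rfl)
    · exact Or.inl hx.1
    · exact Or.inl hy.1
    · exact Or.inr hu)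
    (BC3 hnxy (fun hh => hx.2 hh.symm) (fun hh => hy.2 hh.symm))
  rw [Finset.card_eq_three.2 ⟨x, y, u, hxy, huK x hx.1, huK y hy.1, rfl⟩] at h1
  have h3 : 2 ≤ (({x, y, u} : Finset ι) ∩ K).card := by
    rw [← Finset.card_pair hxy]
    apply Finset.card_le_card
    intro i; simp only [Finset.mem_insert, Finset.mem_singleton, Finset.mem_inter]; grind
  omega

/-- The combinatorial core, with clusters of two types. -/
theorem comb_main (hT : TF R) (B : ι → Prop) (full : ι → ι → Prop) (S K : Finset ι) (hKS : K ⊆ S)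
    (hRB : ∀ i j, R.Adj i j → B i ∧ B j)
    (hK : ∀ i ∈ K, ∀ j ∈ K, i ≠ j → full i j)
    (hE : ∀ C ⊆ S, ∀ D ⊆ C, BC R C → (∀ i ∈ D, B i) → (∀ i ∈ D, ∀ j ∈ D, i ≠ j → full i j) →
      C.card + D.card ≤ 6)
    (hc : (K.card = 8 ∧ S.card = 9) ∨ (K.card = 7 ∧ S.card = 10) ∨ (K.card = 6 ∧ S.card = 13) ∨
      S.card = 21) : False := by
  classical
  have hsp := Finset.card_filter_add_card_filter_not (s := S) B
  set N := S.filter (fun i => ¬ B i) with hN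
  set SB := S.filter B with hSB
  have hKB : (K.filter B).card + N.card ≥ K.card := by
    have h1 := Finset.card_filter_add_card_filter_not (s := K) B
    have h2 : (K.filter (fun i => ¬ B i)).card ≤ N.card :=
      Finset.card_le_card (Finset.filter_subset_filter _ hKS)
    omega
  have hKle : (K.filter B).card ≤ K.card := Finset.card_filter_le _ _
  have hsub : K.filter B ⊆ SB := Finset.filter_subset_filter _ hKS
  have hun : K.filter B ∪ (SB \ K.filter B) = SB := Finset.union_sdiff_of_subset hsub
  have hcard : (K.filter B).card + (SB \ K.filter B).card = SB.card := by
    rw [Finset.card_sdiff_of_subset hsub]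
    have := Finset.card_le_card hsub
    omega
  have hNblue : ∀ C ⊆ SB, BC R C → BC R (C ∪ N) ∧ (C ∪ N).card = C.card + N.card ∧ C ∪ N ⊆ S := by
    intro C hC hb
    refine ⟨?_, ?_, ?_⟩
    · intro i hi j hj hij hadj
      rw [Finset.mem_union] at hi hj
      have := hRB i j hadj
      rcases hi with hi | hi
      · rcases hj with hj | hj
        · exact hb i hi j hj hij hadj
        · exact (Finset.mem_filter.1 hj).2 this.2
      · exact (Finset.mem_filter.1 hi).2 this.1
    · apply Finset.card_union_of_disjoint
      rw [Finset.disjoint_left]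
      intro i hi hi'
      exact (Finset.mem_filter.1 hi').2 (Finset.mem_filter.1 (hC hi)).2
    · exact Finset.union_subset (hC.trans (Finset.filter_subset _ _)) (Finset.filter_subset _ _)
  refine genA (K := K.filter B) (U := SB \ K.filter B) hT Finset.disjoint_sdiff N.card ?_ ?_ ?_
  · rw [hun]
    intro C hC hb
    obtain ⟨h1, h2, h3⟩ := hNblue C hC hb
    have := hE _ h3 (C ∩ K.filter B) (Finset.inter_subset_left.trans Finset.subset_union_left) h1
      (fun i hi => (Finset.mem_filter.1 (Finset.mem_inter.1 hi).2).2)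
      (fun i hi j hj => hK i (Finset.mem_filter.1 (Finset.mem_inter.1 hi).2).1 j
        (Finset.mem_filter.1 (Finset.mem_inter.1 hj).2).1)
    omega
  · rw [hun]
    rintro C hC hb ⟨v, hv⟩
    obtain ⟨h1, h2, h3⟩ := hNblue C hC hb
    have := hE _ h3 {v} (by simp [hv]) h1
      (fun i hi => by rw [Finset.mem_singleton.1 hi]; exact (Finset.mem_filter.1 (hC hv)).2)
      (fun i hi j hj hij => (hij ((Finset.mem_singleton.1 hi).trans (Finset.mem_singleton.1 hj).symm)).elim)
    rw [Finset.card_singleton] at this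
    omega
  · omega

end comb
end RT37

set_option linter.unusedSectionVars false
set_option linter.all false

namespace RT37
section lag
variable {ι : Type*} [Fintype ι] [DecidableEq ι]

def QF (W : ι → ι → ℝ) (x : ι → ℝ) : ℝ := ∑ i, ∑ j, W i j * x i * x j

lemma QF_shift (W : ι → ι → ℝ) (hs : ∀ i j, W i j = W j i) (x e : ι → ℝ) (t : ℝ) :
    QF W (fun i => x i + t * e i) =
      QF W x + t * (2 * ∑ i, ∑ j, W i j * e i * x j) + t ^ 2 * QF W e := by
  have h : ∑ i, ∑ j, W i j * x i * e j = ∑ i, ∑ j, W i j * e i * x j := by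
    rw [Finset.sum_comm]
    refine Finset.sum_congr rfl fun i _ => Finset.sum_congr rfl fun j _ => ?_
    rw [hs j i]; ring
  have h2 : 2 * ∑ i, ∑ j, W i j * e i * x j =
      ∑ i, ∑ j, W i j * e i * x j + ∑ i, ∑ j, W i j * x i * e j := by rw [h]; ring
  rw [h2]
  unfold QF
  rw [← Finset.sum_add_distrib, Finset.mul_sum, Finset.mul_sum, ← Finset.sum_add_distrib,
    ← Finset.sum_add_distrib]
  refine Finset.sum_congr rfl fun i _ => ?_
  rw [← Finset.sum_add_distrib, Finset.mul_sum, Finset.mul_sum, ← Finset.sum_add_distrib,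
    ← Finset.sum_add_distrib]
  refine Finset.sum_congr rfl fun j _ => ?_
  ring

lemma QF_dir (W : ι → ι → ℝ) (hs : ∀ i j, W i j = W j i) (hd : ∀ i, W i i = 0) {a b : ι}
    (hab : a ≠ b) (h0 : W a b = 0) :
    QF W (fun i => if i = a then 1 else if i = b then -1 else 0) = 0 := by
  unfold QF
  refine Finset.sum_eq_zero fun i _ => Finset.sum_eq_zero fun j _ => ?_
  have h0' : W b a = 0 := by rw [hs]; exact h0
  by_cases h1 : i = a <;> by_cases h2 : j = a <;> by_cases h3 : i = b <;> by_cases h4 : j = b <;>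
    simp_all

lemma lag (W : ι → ι → ℝ) (hs : ∀ i j, W i j = W j i) (hd : ∀ i, W i i = 0) :
    ∀ (m : ℕ) (x : ι → ℝ), (∀ i, 0 ≤ x i) → ∑ i, x i = 1 →
      (Finset.univ.filter fun i => x i ≠ 0).card = m →
      ∃ y : ι → ℝ, (∀ i, 0 ≤ y i) ∧ ∑ i, y i = 1 ∧ (∀ i, x i = 0 → y i = 0) ∧ QF W x ≤ QF W y ∧
        ∀ i j, i ≠ j → y i ≠ 0 → y j ≠ 0 → W i j ≠ 0 := by
  intro m
  induction m using Nat.strong_induction_on with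
  | _ m ih =>
  intro x hx hx1 hm
  by_cases hgood : ∀ i j, i ≠ j → x i ≠ 0 → x j ≠ 0 → W i j ≠ 0
  · exact ⟨x, hx, hx1, fun i h => h, le_rfl, hgood⟩
  push Not at hgood
  -- key step with sign
  have step : ∀ a b, a ≠ b → x a ≠ 0 → x b ≠ 0 → W a b = 0 →
      0 ≤ ∑ i, ∑ j, W i j * (if i = a then (1:ℝ) else if i = b then -1 else 0) * x j →
      ∃ y : ι → ℝ, (∀ i, 0 ≤ y i) ∧ ∑ i, y i = 1 ∧ (∀ i, x i = 0 → y i = 0) ∧ QF W x ≤ QF W y ∧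
        ∀ i j, i ≠ j → y i ≠ 0 → y j ≠ 0 → W i j ≠ 0 := by
    intro a b hab ha hb h0 hpos
    set e : ι → ℝ := fun i => if i = a then (1:ℝ) else if i = b then -1 else 0 with he
    set z : ι → ℝ := fun i => x i + x b * e i with hz
    have hza : z a = x a + x b := by simp [hz, he]
    have hzb : z b = 0 := by simp [hz, he, hab.symm]
    have hzo : ∀ i, i ≠ a → i ≠ b → z i = x i := by intro i h1 h2; simp [hz, he, h1, h2]
    have z0 : ∀ i, 0 ≤ z i := by
      intro i
      by_cases h1 : i = a
      · rw [h1, hza]; exact add_nonneg (hx _) (hx _)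
      by_cases h2 : i = b
      · rw [h2, hzb]
      rw [hzo i h1 h2]; exact hx i
    have zs : ∀ i, x i = 0 → z i = 0 := by
      intro i hi
      by_cases h1 : i = a
      · rw [h1] at hi; exact (ha hi).elim
      by_cases h2 : i = b
      · rw [h2, hzb]
      rw [hzo i h1 h2]; exact hi
    have es : ∑ i, e i = 0 := by
      have : ∀ i, e i = (if i = a then (1:ℝ) else 0) - (if i = b then 1 else 0) := by
        intro i
        by_cases h1 : i = a
        · subst h1; simp [he, hab]
        · simp [he, h1]; split_ifs <;> simp
      simp only [this, Finset.sum_sub_distrib]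
      simp
    have z1 : ∑ i, z i = 1 := by
      simp only [hz, Finset.sum_add_distrib, ← Finset.mul_sum, es, hx1]; ring
    have hq : QF W x ≤ QF W z := by
      rw [hz, QF_shift W hs, QF_dir W hs hd hab h0]
      have : 0 ≤ x b * (2 * ∑ i, ∑ j, W i j * e i * x j) := mul_nonneg (hx b) (by linarith)
      linarith
    have hlt : (Finset.univ.filter fun i => z i ≠ 0).card < m := by
      rw [← hm]
      apply Finset.card_lt_card
      refine ⟨?_, ?_⟩
      · intro i; simp only [Finset.mem_filter, Finset.mem_univ, true_and]
        exact fun h1 h2 => h1 (zs i h2)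
      · intro hh
        have := hh (show b ∈ _ by simp [hb])
        simp [hzb] at this
    obtain ⟨y, y0, y1, ys, yq, yg⟩ := ih _ hlt z z0 z1 rfl
    exact ⟨y, y0, y1, fun i hi => ys i (zs i hi), hq.trans yq, yg⟩
  obtain ⟨a, b, hab, ha, hb, h0⟩ := hgood
  by_cases hpos : 0 ≤ ∑ i, ∑ j, W i j * (if i = a then (1:ℝ) else if i = b then -1 else 0) * x j
  · exact step a b hab ha hb h0 hpos
  · refine step b a hab.symm hb ha (by rw [hs]; exact h0) ?_
    have : ∑ i, ∑ j, W i j * (if i = b then (1:ℝ) else if i = a then -1 else 0) * x j =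
      - ∑ i, ∑ j, W i j * (if i = a then (1:ℝ) else if i = b then -1 else 0) * x j := by
      rw [← Finset.sum_neg_distrib]
      refine Finset.sum_congr rfl fun i _ => ?_
      rw [← Finset.sum_neg_distrib]
      refine Finset.sum_congr rfl fun j _ => ?_
      by_cases h1 : i = a
      · subst h1; simp [hab]
      · by_cases h2 : i = b
        · subst h2; simp [h1]
        · simp [h1, h2]
    rw [this]; linarith

lemma QF_le (W : ι → ι → ℝ) (hd : ∀ i, W i i = 0) (h1 : ∀ i j, W i j ≤ 1) (y : ι → ℝ)
    (y0 : ∀ i, 0 ≤ y i) (y1 : ∑ i, y i = 1) :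
    0 < (Finset.univ.filter fun i => y i ≠ 0).card ∧
    QF W y ≤ 1 - 1 / ((Finset.univ.filter fun i => y i ≠ 0).card : ℝ) := by
  set S := Finset.univ.filter fun i => y i ≠ 0 with hS
  have hsum : ∑ i ∈ S, y i = 1 := by
    rw [← y1, hS]
    exact Finset.sum_filter_ne_zero _
  have hpos : 0 < S.card := by
    rw [Finset.card_pos]
    by_contra hne
    rw [Finset.not_nonempty_iff_eq_empty] at hne
    rw [hne] at hsum; simp at hsum
  refine ⟨hpos, ?_⟩
  have hcs : (∑ i ∈ S, y i) ^ 2 ≤ S.card * ∑ i ∈ S, y i ^ 2 := sq_sum_le_card_mul_sum_sq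
  have hle : ∑ i ∈ S, y i ^ 2 ≤ ∑ i, y i ^ 2 :=
    Finset.sum_le_sum_of_subset_of_nonneg (Finset.subset_univ _) fun i _ _ => sq_nonneg _
  have hq : QF W y ≤ 1 - ∑ i, y i ^ 2 := by
    have e1 : (1:ℝ) = ∑ i, ∑ j, y i * y j := by
      rw [← Finset.sum_mul_sum, y1]; norm_num
    have e2 : ∑ i, y i ^ 2 = ∑ i, ∑ j, if i = j then y i * y j else 0 := by
      refine Finset.sum_congr rfl fun i _ => ?_
      simp [sq]
    rw [e2]
    nth_rewrite 1 [e1]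
    unfold QF
    rw [← Finset.sum_sub_distrib]
    refine Finset.sum_le_sum fun i _ => ?_
    rw [← Finset.sum_sub_distrib]
    refine Finset.sum_le_sum fun j _ => ?_
    split_ifs with h
    · subst h; rw [hd]; simp
    · have := mul_nonneg (y0 i) (y0 j)
      have := h1 i j
      nlinarith
  have hp : (0:ℝ) < S.card := by exact_mod_cast hpos
  rw [hsum] at hcs
  have : 1 / (S.card : ℝ) ≤ ∑ i ∈ S, y i ^ 2 := by
    rw [div_le_iff₀ hp]; linarith
  linarith

/-- Weighted Turán step: produces the clique pair. -/
theorem lag_main (P F : ι → ι → Prop) (hPs : ∀ i j, P i j → P j i) (hFs : ∀ i j, F i j → F j i)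
    (hPi : ∀ i, ¬ P i i) (hFP : ∀ i j, F i j → P i j) (W : ι → ι → ℝ)
    (hW : ∀ i j, W i j ≤ (open Classical in if F i j then 1 else if P i j then 1/2 else 0))
    (x : ι → ℝ) (x0 : ∀ i, 0 ≤ x i) (x1 : ∑ i, x i = 1) (hx : 7 / 8 < ∑ i, ∑ j, W i j * x i * x j) :
    ∃ S K : Finset ι, K ⊆ S ∧ (∀ i ∈ S, ∀ j ∈ S, i ≠ j → P i j) ∧
      (∀ i ∈ K, ∀ j ∈ K, i ≠ j → F i j) ∧
      ((K.card = 8 ∧ S.card = 9) ∨ (K.card = 7 ∧ S.card = 10) ∨ (K.card = 6 ∧ S.card = 13) ∨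
      S.card = 21) := by
  classical
  set A : ι → ι → ℝ := fun i j => if P i j then 1 else 0 with hA
  set B : ι → ι → ℝ := fun i j => if F i j then 1 else 0 with hB
  set V : ι → ι → ℝ := fun i j => (A i j + B i j) / 2 with hV
  have hAs : ∀ i j, A i j = A j i := by
    intro i j; simp only [hA]; congr 1; exact propext ⟨hPs i j, hPs j i⟩
  have hBs : ∀ i j, B i j = B j i := by
    intro i j; simp only [hB]; congr 1; exact propext ⟨hFs i j, hFs j i⟩
  have hAd : ∀ i, A i i = 0 := by intro i; simp [hA, hPi]
  have hBd : ∀ i, B i i = 0 := by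
    intro i; simp only [hB]; rw [if_neg]; exact fun h => hPi i (hFP i i h)
  have hVs : ∀ i j, V i j = V j i := by intro i j; simp only [hV]; rw [hAs, hBs]
  have hVd : ∀ i, V i i = 0 := by intro i; simp only [hV]; rw [hAd, hBd]; norm_num
  have hWV : ∀ i j, W i j ≤ V i j := by
    intro i j
    refine (hW i j).trans ?_
    simp only [hV, hA, hB]
    by_cases h1 : F i j
    · simp [h1, hFP i j h1]
    · by_cases h2 : P i j <;> simp [h1, h2]
  have hVx : 7 / 8 < QF V x := by
    refine hx.trans_le ?_
    unfold QF
    refine Finset.sum_le_sum fun i _ => Finset.sum_le_sum fun j _ => ?_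
    exact mul_le_mul_of_nonneg_right (mul_le_mul_of_nonneg_right (hWV i j) (x0 i)) (x0 j)
  obtain ⟨y, y0, y1, -, yq, yg⟩ := lag V hVs hVd _ x x0 x1 rfl
  obtain ⟨z, z0, z1, zs, zq, zg⟩ := lag B hBs hBd _ y y0 y1 rfl
  obtain ⟨sp, sle⟩ := QF_le A hAd (by intro i j; simp only [hA]; split_ifs <;> norm_num) y y0 y1
  obtain ⟨kp, kle⟩ := QF_le B hBd (by intro i j; simp only [hB]; split_ifs <;> norm_num) z z0 z1
  set S := Finset.univ.filter fun i => y i ≠ 0 with hS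
  set K := Finset.univ.filter fun i => z i ≠ 0 with hK
  have hQ : QF V y = (QF A y + QF B y) / 2 := by
    unfold QF
    rw [← Finset.sum_add_distrib, Finset.sum_div]
    refine Finset.sum_congr rfl fun i _ => ?_
    rw [← Finset.sum_add_distrib, Finset.sum_div]
    refine Finset.sum_congr rfl fun j _ => ?_
    simp only [hV]; ring
  have hKS : K ⊆ S := by
    intro i; simp only [hK, hS, Finset.mem_filter, Finset.mem_univ, true_and]
    exact fun h1 h2 => h1 (zs i h2)
  have hSP : ∀ i ∈ S, ∀ j ∈ S, i ≠ j → P i j := by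
    intro i hi j hj hij
    simp only [hS, Finset.mem_filter, Finset.mem_univ, true_and] at hi hj
    have := yg i j hij hi hj
    by_contra hn
    apply this
    have hn' : ¬ F i j := fun h => hn (hFP i j h)
    simp [hV, hA, hB, hn, hn']
  have hKF : ∀ i ∈ K, ∀ j ∈ K, i ≠ j → F i j := by
    intro i hi j hj hij
    simp only [hK, Finset.mem_filter, Finset.mem_univ, true_and] at hi hj
    have := zg i j hij hi hj
    by_contra hn
    apply this
    simp [hB, hn]
  have key : 1 / (S.card : ℝ) + 1 / (K.card : ℝ) < 1 / 4 := by linarith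
  have hle := Finset.card_le_card hKS
  have sp' : (0:ℝ) < S.card := by exact_mod_cast sp
  have kp' : (0:ℝ) < K.card := by exact_mod_cast kp
  have key2 : 4 * (K.card + S.card) < K.card * S.card := by
    rw [div_add_div _ _ sp'.ne' kp'.ne', div_lt_div_iff₀ (mul_pos sp' kp') (by norm_num)] at key
    have : (4 * (K.card + S.card) : ℝ) < K.card * S.card := by linarith
    exact_mod_cast this
  have trim : ∀ k s, k ≤ K.card → s ≤ S.card → k ≤ s → ∃ S' K' : Finset ι, K' ⊆ S' ∧
      (∀ i ∈ S', ∀ j ∈ S', i ≠ j → P i j) ∧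
      (∀ i ∈ K', ∀ j ∈ K', i ≠ j → F i j) ∧ K'.card = k ∧ S'.card = s := by
    intro k s hk hs hks
    obtain ⟨K', hK', hk'⟩ := Finset.exists_subset_card_eq hk
    obtain ⟨S', h1, h2, h3⟩ := Finset.exists_subsuperset_card_eq (hK'.trans hKS) (by omega) hs
    exact ⟨S', K', h1, fun i hi j hj => hSP i (h2 hi) j (h2 hj),
      fun i hi j hj => hKF i (hK' hi) j (hK' hj), hk', h3⟩
  have cases4 : (8 ≤ K.card ∧ 9 ≤ S.card) ∨ (7 ≤ K.card ∧ 10 ≤ S.card) ∨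
      (6 ≤ K.card ∧ 13 ≤ S.card) ∨ 21 ≤ S.card := by
    generalize K.card = k at *
    generalize S.card = s at *
    by_cases h8 : 8 ≤ k
    · left; refine ⟨h8, ?_⟩
      by_contra h
      have h8' : s = 8 := by omega
      have h8'' : k = 8 := by omega
      subst h8'; subst h8''; omega
    · have : k ≤ 7 := by omega
      interval_cases k <;> omega
  rcases cases4 with h | h | h | h
  · obtain ⟨S', K', a, b, c, d, e⟩ := trim 8 9 h.1 h.2 (by norm_num)
    exact ⟨S', K', a, b, c, by omega⟩
  · obtain ⟨S', K', a, b, c, d, e⟩ := trim 7 10 h.1 h.2 (by norm_num)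
    exact ⟨S', K', a, b, c, by omega⟩
  · obtain ⟨S', K', a, b, c, d, e⟩ := trim 6 13 h.1 h.2 (by norm_num)
    exact ⟨S', K', a, b, c, by omega⟩
  · obtain ⟨S', K', a, b, c, d, e⟩ := trim 0 21 (by omega) h (by norm_num)
    exact ⟨S', K', a, b, c, by omega⟩

end lag
end RT37

set_option linter.unusedSectionVars false
set_option linter.all false

namespace RT37
section emb
open Classical
variable {V : Type*} {ι : Type*}

/-- number of adjacent pairs -/
noncomputable def cnt (H : SimpleGraph V) (X Y : Finset V) : ℝ :=
  ∑ x ∈ X, ((Y.filter (H.Adj x)).card : ℝ)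

lemma cnt_nonneg (H : SimpleGraph V) (X Y : Finset V) : 0 ≤ cnt H X Y :=
  Finset.sum_nonneg fun _ _ => Nat.cast_nonneg _

lemma cnt_eq (H : SimpleGraph V) (X Y : Finset V) :
    cnt H X Y = ∑ x ∈ X, ∑ y ∈ Y, if H.Adj x y then (1:ℝ) else 0 := by
  unfold cnt
  refine Finset.sum_congr rfl fun x _ => ?_
  rw [Finset.card_filter]
  push_cast
  rfl

lemma cnt_comm (H : SimpleGraph V) (X Y : Finset V) : cnt H X Y = cnt H Y X := by
  rw [cnt_eq, cnt_eq, Finset.sum_comm]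
  simp only [H.adj_comm]

lemma cnt_mono (H : SimpleGraph V) {X X' Y Y' : Finset V} (hX : X ⊆ X') (hY : Y ⊆ Y') :
    cnt H X Y ≤ cnt H X' Y' := by
  unfold cnt
  refine (Finset.sum_le_sum fun x _ => ?_).trans
    (Finset.sum_le_sum_of_subset_of_nonneg hX fun _ _ _ => Nat.cast_nonneg _)
  exact_mod_cast Finset.card_le_card (Finset.filter_subset_filter _ hY)

lemma cnt_sup (H H' : SimpleGraph V) (X Y : Finset V) :
    cnt (H ⊔ H') X Y ≤ cnt H X Y + cnt H' X Y := by
  unfold cnt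
  rw [← Finset.sum_add_distrib]
  refine Finset.sum_le_sum fun x _ => ?_
  rw [← Nat.cast_add, Nat.cast_le]
  refine le_trans (Finset.card_le_card ?_) (Finset.card_union_le _ _)
  intro y hy
  simp only [Finset.mem_filter, Finset.mem_union, SimpleGraph.sup_adj] at hy ⊢
  tauto

/-- few bad vertices -/
lemma bad_small {H : SimpleGraph V} {c β : ℝ} {A X Y : Finset V} (hX : X ⊆ A)
    (hY : 0 < Y.card) (hA : 0 < A.card) (hβ : 0 < β)
    (h : ∀ Z ⊆ A, β * A.card ≤ Z.card → c * Z.card * Y.card ≤ cnt H Z Y) :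
    ((X.filter fun v => ((Y.filter (H.Adj v)).card : ℝ) < c * Y.card).card : ℝ) < β * A.card := by
  by_contra hcon
  push Not at hcon
  set Z := X.filter fun v => ((Y.filter (H.Adj v)).card : ℝ) < c * Y.card with hZ
  have hA' : (0:ℝ) < A.card := by exact_mod_cast hA
  have hZc : (0:ℝ) < Z.card := lt_of_lt_of_le (mul_pos hβ hA') hcon
  have hZn : Z.Nonempty := by rw [← Finset.card_pos]; exact_mod_cast hZc
  have h1 := h Z ((Finset.filter_subset _ _).trans hX) hcon
  have h2 : cnt H Z Y < ∑ x ∈ Z, c * Y.card := by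
    unfold cnt
    refine Finset.sum_lt_sum_of_nonempty hZn fun x hx => ?_
    exact (Finset.mem_filter.1 hx).2
  rw [Finset.sum_const, nsmul_eq_mul] at h2
  nlinarith

/-- many good vertices -/
lemma good_many {H : SimpleGraph V} {c β : ℝ} {A : Finset V} {X : Finset V} (hX : X ⊆ A)
    (hA : 0 < A.card) (hβ : 0 < β) (C : Finset ι) (Y : ι → Finset V)
    (hY : ∀ j ∈ C, 0 < (Y j).card)
    (h : ∀ j ∈ C, ∀ Z ⊆ A, β * A.card ≤ Z.card → c * Z.card * (Y j).card ≤ cnt H Z (Y j)) :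
    (X.card : ℝ) - C.card * (β * A.card) ≤
      ((X.filter fun v => ∀ j ∈ C, c * (Y j).card ≤ (((Y j).filter (H.Adj v)).card : ℝ)).card : ℝ) := by
  have hsub : X ⊆ (X.filter fun v => ∀ j ∈ C, c * (Y j).card ≤ (((Y j).filter (H.Adj v)).card : ℝ)) ∪
      C.biUnion fun j => X.filter fun v => (((Y j).filter (H.Adj v)).card : ℝ) < c * (Y j).card := by
    intro v hv
    by_cases hg : ∀ j ∈ C, c * (Y j).card ≤ (((Y j).filter (H.Adj v)).card : ℝ)
    · exact Finset.mem_union_left _ (Finset.mem_filter.2 ⟨hv, hg⟩)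
    · push Not at hg
      obtain ⟨j, hj, hlt⟩ := hg
      exact Finset.mem_union_right _ (Finset.mem_biUnion.2 ⟨j, hj, Finset.mem_filter.2 ⟨hv, hlt⟩⟩)
  have h1 := (Finset.card_le_card hsub).trans (Finset.card_union_le _ _)
  have h2 : ((C.biUnion fun j => X.filter fun v =>
      (((Y j).filter (H.Adj v)).card : ℝ) < c * (Y j).card).card : ℝ) ≤ C.card * (β * A.card) := by
    refine (Nat.cast_le.2 Finset.card_biUnion_le).trans ?_
    rw [Nat.cast_sum, ← nsmul_eq_mul]
    exact Finset.sum_le_card_nsmul _ _ _ fun j hj => (bad_small hX (hY j hj) hA hβ (h j hj)).le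
  have h3 : (X.card : ℝ) ≤ _ := Nat.cast_le.2 h1
  rw [Nat.cast_add] at h3
  linarith

lemma pow_ge (M : ℝ) (hM : 2 ≤ M) (r : ℕ) : (r : ℝ) + 1 ≤ M ^ r := by
  have h := one_add_mul_le_pow (show (-2:ℝ) ≤ M - 1 by linarith) r
  have : (1 + (M - 1)) = M := by ring
  rw [this] at h
  have : (r:ℝ) * 1 ≤ r * (M - 1) := mul_le_mul_of_nonneg_left (by linarith) (Nat.cast_nonneg _)
  linarith

lemma embed (H : SimpleGraph V) (A : ι → Finset V) (β θ M : ℝ) (hβ : 0 < β) (hθ : 0 < θ)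
    (hM : 2 ≤ M) (hMθ : 1 ≤ M * θ) :
    ∀ (r : ℕ) (C D : Finset ι), C.card = r → D ⊆ C → (∀ i ∈ C, 0 < (A i).card) →
    (∀ i ∈ C, ∀ j ∈ C, i ≠ j → ∀ X ⊆ A i, ∀ Y ⊆ A j, β * (A i).card ≤ X.card →
      β * (A j).card ≤ Y.card → θ * X.card * Y.card ≤ cnt H X Y) →
    (∀ i ∈ D, ∀ j ∈ D, i ≠ j → ∀ X ⊆ A i, ∀ Y ⊆ A j, β * (A i).card ≤ X.card →
      β * (A j).card ≤ Y.card → (1 / 2 + θ) * X.card * Y.card ≤ cnt H X Y) →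
    (∀ i ∈ D, ∀ X ⊆ A i, β * (A i).card ≤ X.card → ∃ x ∈ X, ∃ y ∈ X, H.Adj x y) →
    ∀ X : ι → Finset V, (∀ i ∈ C, X i ⊆ A i) → (∀ i ∈ C, β * M ^ r * (A i).card ≤ (X i).card) →
    ∃ Q : Finset V, Q ⊆ C.biUnion X ∧ Q.card = C.card + D.card ∧ H.IsClique (Q : Set V) := by
  intro r
  have hM0 : 0 < M := by linarith
  induction r with
  | zero =>
    intro C D hC hD _ _ _ _ X _ _
    rw [Finset.card_eq_zero] at hC
    subst hC
    rw [Finset.subset_empty] at hD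
    subst hD
    exact ⟨∅, by simp, by simp, by simp⟩
  | succ r ih =>
    intro C D hC hD hA h1 h2 h3 X hXA hX
    have hpow := pow_ge M hM r
    have hpow' := pow_ge M hM (r+1)
    have hβle : ∀ i ∈ C, β * (A i).card ≤ (X i).card := by
      intro i hi
      refine le_trans ?_ (hX i hi)
      have : (0:ℝ) ≤ β * (A i).card := by positivity
      have h1M : (1:ℝ) ≤ M ^ (r+1) := one_le_pow₀ (by linarith)
      nlinarith
    have hXpos : ∀ i ∈ C, 0 < (X i).card := by
      intro i hi
      have : (0:ℝ) < β * (A i).card := mul_pos hβ (by exact_mod_cast hA i hi)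
      have := this.trans_le (hβle i hi)
      exact_mod_cast this
    have shrink : ∀ i ∈ C, θ * (X i).card ≥ β * M ^ r * (A i).card := by
      intro i hi
      have h := hX i hi
      have e : β * M ^ r * (A i).card ≤ θ * (β * M ^ (r+1) * (A i).card) := by
        have : (0:ℝ) ≤ β * M ^ r * (A i).card := by positivity
        rw [pow_succ]
        nlinarith
      exact e.trans (mul_le_mul_of_nonneg_left h hθ.le)
    by_cases hCD : D = C
    · -- doubled cluster
      subst hCD
      obtain ⟨i, hi⟩ : D.Nonempty := by rw [← Finset.card_pos]; omega
      have hce : (D.erase i).card = r := by rw [Finset.card_erase_of_mem hi, hC]; rfl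
      have hg := good_many (H := H) (c := 1 / 2 + θ) (β := β) (hXA i hi) (hA i hi) hβ (D.erase i) X
        (fun j hj => hXpos j (Finset.mem_of_mem_erase hj))
        (fun j hj Z hZ hZc => h2 i hi j (Finset.mem_of_mem_erase hj) (Finset.ne_of_mem_erase hj).symm
          Z hZ (X j) (hXA j (Finset.mem_of_mem_erase hj)) hZc (hβle j (Finset.mem_of_mem_erase hj)))
      rw [hce] at hg
      set Z := (X i).filter fun v => ∀ j ∈ D.erase i, (1 / 2 + θ) * (X j).card ≤
        (((X j).filter (H.Adj v)).card : ℝ) with hZ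
      have hZc : β * (A i).card ≤ Z.card := by
        refine le_trans ?_ hg
        have h := hX i hi
        have : (0:ℝ) ≤ β * (A i).card := by positivity
        push_cast at hpow'
        nlinarith
      obtain ⟨x, hx, y, hy, hxy⟩ := h3 i hi Z ((Finset.filter_subset _ _).trans (hXA i hi)) hZc
      rw [hZ, Finset.mem_filter] at hx hy
      have hcap : ∀ j ∈ D.erase i, θ * (X j).card ≤
          ((((X j).filter (H.Adj x)).filter (H.Adj y)).card : ℝ) := by
        intro j hj
        have a1 := hx.2 j hj
        have a2 := hy.2 j hj
        have a3 := Finset.card_union_add_card_inter ((X j).filter (H.Adj x)) ((X j).filter (H.Adj y))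
        have a4 : ((X j).filter (H.Adj x) ∪ (X j).filter (H.Adj y)).card ≤ (X j).card :=
          Finset.card_le_card (Finset.union_subset (Finset.filter_subset _ _) (Finset.filter_subset _ _))
        have a5 : (X j).filter (H.Adj x) ∩ (X j).filter (H.Adj y) =
            ((X j).filter (H.Adj x)).filter (H.Adj y) := by
          ext v; simp only [Finset.mem_filter, Finset.mem_inter]; tauto
        rw [a5] at a3
        have a3' : (((X j).filter (H.Adj x) ∪ (X j).filter (H.Adj y)).card : ℝ) +
          (((X j).filter (H.Adj x)).filter (H.Adj y)).card = ((X j).filter (H.Adj x)).card +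
          ((X j).filter (H.Adj y)).card := by exact_mod_cast a3
        have a4' : (((X j).filter (H.Adj x) ∪ (X j).filter (H.Adj y)).card : ℝ) ≤ (X j).card := by
          exact_mod_cast a4
        have : (0:ℝ) ≤ θ * (X j).card := by positivity
        nlinarith
      obtain ⟨Q, hQ, hQc, hQq⟩ := ih (D.erase i) (D.erase i) hce subset_rfl
        (fun j hj => hA j (Finset.mem_of_mem_erase hj))
        (fun j hj k hk => h1 j (Finset.mem_of_mem_erase hj) k (Finset.mem_of_mem_erase hk))
        (fun j hj k hk => h2 j (Finset.mem_of_mem_erase hj) k (Finset.mem_of_mem_erase hk))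
        (fun j hj => h3 j (Finset.mem_of_mem_erase hj))
        (fun j => ((X j).filter (H.Adj x)).filter (H.Adj y))
        (fun j hj => (Finset.filter_subset _ _).trans
          ((Finset.filter_subset _ _).trans (hXA j (Finset.mem_of_mem_erase hj))))
        (fun j hj => (shrink j (Finset.mem_of_mem_erase hj)).le.trans (hcap j hj))
      have hQx : ∀ v ∈ Q, H.Adj x v ∧ H.Adj y v ∧ v ∈ D.biUnion X := by
        intro v hv
        have := hQ hv
        rw [Finset.mem_biUnion] at this
        obtain ⟨j, hj, hv'⟩ := this
        simp only [Finset.mem_filter] at hv'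
        exact ⟨hv'.1.2, hv'.2, Finset.mem_biUnion.2 ⟨j, Finset.mem_of_mem_erase hj, hv'.1.1⟩⟩
      refine ⟨insert x (insert y Q), ?_, ?_, ?_⟩
      · intro v hv
        rw [Finset.mem_insert, Finset.mem_insert] at hv
        rcases hv with rfl | rfl | hv
        · exact Finset.mem_biUnion.2 ⟨i, hi, hx.1⟩
        · exact Finset.mem_biUnion.2 ⟨i, hi, hy.1⟩
        · exact (hQx v hv).2.2
      · have nx : x ∉ insert y Q := by
          rw [Finset.mem_insert]
          rintro (hh | hh)
          · exact hxy.ne hh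
          · exact (hQx x hh).1.ne rfl
        have ny : y ∉ Q := fun hh => (hQx y hh).2.1.ne rfl
        rw [Finset.card_insert_of_notMem nx, Finset.card_insert_of_notMem ny, hQc, hce, hC]
        omega
      · rw [Finset.coe_insert, Finset.coe_insert, SimpleGraph.isClique_insert,
          SimpleGraph.isClique_insert]
        refine ⟨⟨hQq, fun v hv _ => (hQx v hv).2.1⟩, ?_⟩
        intro v hv _
        rcases hv with rfl | hv
        · exact hxy
        · exact (hQx v hv).1
    · obtain ⟨i, hi, hiD⟩ : ∃ i ∈ C, i ∉ D := by
        by_contra hcon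
        push Not at hcon
        exact hCD (Finset.Subset.antisymm hD hcon)
      have hce : (C.erase i).card = r := by rw [Finset.card_erase_of_mem hi, hC]; rfl
      have hg := good_many (H := H) (c := θ) (β := β) (hXA i hi) (hA i hi) hβ (C.erase i) X
        (fun j hj => hXpos j (Finset.mem_of_mem_erase hj))
        (fun j hj Z hZ hZc => h1 i hi j (Finset.mem_of_mem_erase hj) (Finset.ne_of_mem_erase hj).symm
          Z hZ (X j) (hXA j (Finset.mem_of_mem_erase hj)) hZc (hβle j (Finset.mem_of_mem_erase hj)))
      rw [hce] at hg
      set Z := (X i).filter fun v => ∀ j ∈ C.erase i, θ * (X j).card ≤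
        (((X j).filter (H.Adj v)).card : ℝ) with hZ
      have hZc : (0:ℝ) < Z.card := by
        refine lt_of_lt_of_le ?_ hg
        have h := hX i hi
        have : (0:ℝ) < β * (A i).card := mul_pos hβ (by exact_mod_cast hA i hi)
        push_cast at hpow'
        nlinarith
      obtain ⟨x, hx⟩ : Z.Nonempty := by rw [← Finset.card_pos]; exact_mod_cast hZc
      rw [hZ, Finset.mem_filter] at hx
      have hDe : D ⊆ C.erase i := fun j hj => Finset.mem_erase.2 ⟨fun e => hiD (e ▸ hj), hD hj⟩
      obtain ⟨Q, hQ, hQc, hQq⟩ := ih (C.erase i) D hce hDe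
        (fun j hj => hA j (Finset.mem_of_mem_erase hj))
        (fun j hj k hk => h1 j (Finset.mem_of_mem_erase hj) k (Finset.mem_of_mem_erase hk))
        h2 h3
        (fun j => ((X j).filter (H.Adj x)))
        (fun j hj => (Finset.filter_subset _ _).trans (hXA j (Finset.mem_of_mem_erase hj)))
        (fun j hj => (shrink j (Finset.mem_of_mem_erase hj)).le.trans (hx.2 j hj))
      have hQx : ∀ v ∈ Q, H.Adj x v ∧ v ∈ C.biUnion X := by
        intro v hv
        have := hQ hv
        rw [Finset.mem_biUnion] at this
        obtain ⟨j, hj, hv'⟩ := this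
        simp only [Finset.mem_filter] at hv'
        exact ⟨hv'.2, Finset.mem_biUnion.2 ⟨j, Finset.mem_of_mem_erase hj, hv'.1⟩⟩
      refine ⟨insert x Q, ?_, ?_, ?_⟩
      · intro v hv
        rw [Finset.mem_insert] at hv
        rcases hv with rfl | hv
        · exact Finset.mem_biUnion.2 ⟨i, hi, hx.1⟩
        · exact (hQx v hv).2
      · have nx : x ∉ Q := fun hh => (hQx x hh).1.ne rfl
        rw [Finset.card_insert_of_notMem nx, hQc, hce, hC]
        omega
      · rw [Finset.coe_insert, SimpleGraph.isClique_insert]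
        exact ⟨hQq, fun v hv _ => (hQx v hv).1⟩

end emb
end RT37

set_option linter.unusedSectionVars false
set_option linter.all false

namespace RT37
section proc
open Classical

lemma pairproc : ∀ (b : ℕ) (γ : ℝ), 0 < γ → ∃ σ ρ₀ γ' : ℝ, 0 < σ ∧ σ ≤ 1 ∧ 0 < ρ₀ ∧ 0 < γ' ∧ γ' ≤ γ ∧
    ∀ (V ι : Type) (Rd : SimpleGraph V) (S : Finset ι) (N : Finset (ι × ι)) (A : ι → Finset V),
      N.card ≤ b →
      (∀ i ∈ S, ∀ j ∈ S, i ≠ j → (i, j) ∉ N → cnt Rd (A i) (A j) ≤ γ' * (A i).card * (A j).card) →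
      ∃ (A' : ι → Finset V) (ρ : ℝ) (N' : Finset (ι × ι)), ρ₀ ≤ ρ ∧ ρ ≤ 1 / 2 ∧
        (∀ i, A' i ⊆ A i ∧ σ * (A i).card ≤ (A' i).card) ∧
        (∀ i ∈ S, ∀ j ∈ S, i ≠ j → (i, j) ∉ N' →
          cnt Rd (A' i) (A' j) ≤ γ * (A' i).card * (A' j).card) ∧
        (∀ i ∈ S, ∀ j ∈ S, i ≠ j → (i, j) ∈ N' → ∀ X ⊆ A' i, ∀ Y ⊆ A' j,
          ρ * (A' i).card ≤ X.card → ρ * (A' j).card ≤ Y.card →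
          ρ * X.card * Y.card < cnt Rd X Y) := by
  intro b
  induction b with
  | zero =>
    intro γ hγ
    refine ⟨1, 1/2, γ, one_pos, le_rfl, by norm_num, hγ, le_rfl, ?_⟩
    intro V ι Rd S N A hN hb
    have hN0 : N = ∅ := Finset.card_eq_zero.1 (by omega)
    refine ⟨A, 1/2, ∅, le_rfl, le_rfl, fun i => ⟨subset_rfl, by simp⟩, ?_, ?_⟩
    · intro i hi j hj hij _
      exact hb i hi j hj hij (by simp [hN0])
    · intro i hi j hj hij hh
      simp at hh
  | succ b ih =>
    intro γ hγ
    obtain ⟨σ₁, ρ₁, γ₁, hσ, hσ1, hρ₁, hγ₁, hγle, hP⟩ := ih γ hγ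
    set ρ := min γ₁ (1/2) with hρdef
    have hρ : 0 < ρ := lt_min hγ₁ (by norm_num)
    have hρh : ρ ≤ 1/2 := min_le_right _ _
    have hργ : ρ ≤ γ₁ := min_le_left _ _
    have hρsq : ρ ^ 2 ≤ 1 := by nlinarith
    refine ⟨ρ * σ₁, min ρ ρ₁, ρ ^ 2 * γ₁, by positivity, by nlinarith, lt_min hρ hρ₁, by positivity,
      by nlinarith, ?_⟩
    intro V ι Rd S N A hN hb
    by_cases hgood : ∀ i ∈ S, ∀ j ∈ S, i ≠ j → (i, j) ∈ N → ∀ X ⊆ A i, ∀ Y ⊆ A j,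
          ρ * (A i).card ≤ X.card → ρ * (A j).card ≤ Y.card →
          ρ * X.card * Y.card < cnt Rd X Y
    · refine ⟨A, ρ, N, min_le_left _ _, hρh, fun i => ⟨subset_rfl, ?_⟩, ?_, hgood⟩
      · have : (0:ℝ) ≤ (A i).card := Nat.cast_nonneg _
        have : ρ * σ₁ ≤ 1 := by nlinarith
        nlinarith
      · intro i hi j hj hij hn
        refine (hb i hi j hj hij hn).trans ?_
        have : (0:ℝ) ≤ (A i).card := Nat.cast_nonneg _
        have : (0:ℝ) ≤ (A j).card := Nat.cast_nonneg _
        have : ρ ^ 2 * γ₁ ≤ γ := by nlinarith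
        gcongr
    · push Not at hgood
      obtain ⟨i, hi, j, hj, hij, hN', X, hX, Y, hY, hXc, hYc, hle⟩ := hgood
      set B : ι → Finset V := fun k => if k = i then X else if k = j then Y else A k with hB
      have hBi : B i = X := by simp [hB]
      have hBj : B j = Y := by simp [hB, hij.symm]
      have hBo : ∀ k, k ≠ i → k ≠ j → B k = A k := by intro k h1 h2; simp [hB, h1, h2]
      have hBA : ∀ k, B k ⊆ A k ∧ ρ * (A k).card ≤ (B k).card := by
        intro k
        by_cases h1 : k = i
        · rw [h1, hBi]; exact ⟨hX, hXc⟩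
        by_cases h2 : k = j
        · rw [h2, hBj]; exact ⟨hY, hYc⟩
        rw [hBo k h1 h2]
        refine ⟨subset_rfl, ?_⟩
        have : (0:ℝ) ≤ (A k).card := Nat.cast_nonneg _
        nlinarith
      obtain ⟨A', ρ', N'', h1, h2, h3, h4, h5⟩ := hP V ι Rd S (N.erase (i, j)) B
        (by rw [Finset.card_erase_of_mem hN']; omega) (by
          intro k hk l hl hkl hn
          by_cases hkl' : (k, l) = (i, j)
          · rw [Prod.mk.injEq] at hkl'
            rw [hkl'.1, hkl'.2, hBi, hBj]
            refine hle.trans ?_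
            gcongr
          · have hn' : (k, l) ∉ N := fun hh => hn (Finset.mem_erase.2 ⟨hkl', hh⟩)
            refine (cnt_mono Rd (hBA k).1 (hBA l).1).trans ((hb k hk l hl hkl hn').trans ?_)
            have e1 := (hBA k).2
            have e2 := (hBA l).2
            have e3 : (ρ * (A k).card) * (ρ * (A l).card) ≤ (B k).card * (B l).card :=
              mul_le_mul e1 e2 (by positivity) (Nat.cast_nonneg _)
            calc ρ ^ 2 * γ₁ * (A k).card * (A l).card
                = γ₁ * ((ρ * (A k).card) * (ρ * (A l).card)) := by ring
              _ ≤ γ₁ * ((B k).card * (B l).card) := mul_le_mul_of_nonneg_left e3 hγ₁.le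
              _ = _ := by ring)
      refine ⟨A', ρ', N'', (min_le_right _ _).trans h1, h2, fun k => ⟨(h3 k).1.trans (hBA k).1, ?_⟩, h4, h5⟩
      refine le_trans ?_ (h3 k).2
      have := mul_le_mul_of_nonneg_left (hBA k).2 hσ.le
      linarith

/-- a red triple of clusters contains a red triangle -/
lemma red_tri {V : Type} {Rd : SimpleGraph V} (hT : TF Rd) {ρ : ℝ} (hρ : 0 < ρ) (hρ2 : ρ ≤ 1/2)
    {A B C : Finset V} (hA : 0 < A.card) (hB : 0 < B.card) (hC : 0 < C.card)
    (hAB : ∀ X ⊆ A, ∀ Y ⊆ B, ρ * A.card ≤ X.card → ρ * B.card ≤ Y.card → ρ * X.card * Y.card < cnt Rd X Y)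
    (hAC : ∀ X ⊆ A, ∀ Y ⊆ C, ρ * A.card ≤ X.card → ρ * C.card ≤ Y.card → ρ * X.card * Y.card < cnt Rd X Y)
    (hBC : ∀ X ⊆ B, ∀ Y ⊆ C, ρ * B.card ≤ X.card → ρ * C.card ≤ Y.card → ρ * X.card * Y.card < cnt Rd X Y) :
    False := by
  have hself : ∀ B : Finset V, ρ * (B.card : ℝ) ≤ B.card := by
    intro B
    have : (0:ℝ) ≤ B.card := Nat.cast_nonneg _
    nlinarith
  have b1 := bad_small (H := Rd) (c := ρ) (β := ρ) (A := A) (X := A) (Y := B) subset_rfl hB hA hρ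
    (fun Z hZ hZc => (hAB Z hZ B subset_rfl hZc (hself B)).le)
  have b2 := bad_small (H := Rd) (c := ρ) (β := ρ) (A := A) (X := A) (Y := C) subset_rfl hC hA hρ
    (fun Z hZ hZc => (hAC Z hZ C subset_rfl hZc (hself C)).le)
  have hA' : (0:ℝ) < A.card := by exact_mod_cast hA
  obtain ⟨v, hv, hvB, hvC⟩ : ∃ v ∈ A, ρ * B.card ≤ ((B.filter (Rd.Adj v)).card : ℝ) ∧
      ρ * C.card ≤ ((C.filter (Rd.Adj v)).card : ℝ) := by
    by_contra hcon
    push Not at hcon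
    have hsub : A ⊆ (A.filter fun v => ((B.filter (Rd.Adj v)).card : ℝ) < ρ * B.card) ∪
        (A.filter fun v => ((C.filter (Rd.Adj v)).card : ℝ) < ρ * C.card) := by
      intro v hv
      rw [Finset.mem_union, Finset.mem_filter, Finset.mem_filter]
      by_cases h : ρ * B.card ≤ ((B.filter (Rd.Adj v)).card : ℝ)
      · exact Or.inr ⟨hv, hcon v hv h⟩
      · exact Or.inl ⟨hv, not_le.1 h⟩
    have h1 : (A.card : ℝ) ≤ _ := Nat.cast_le.2 ((Finset.card_le_card hsub).trans (Finset.card_union_le _ _))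
    rw [Nat.cast_add] at h1
    nlinarith
  have h := hBC _ (Finset.filter_subset (Rd.Adj v) B) _ (Finset.filter_subset (Rd.Adj v) C) hvB hvC
  have hpos : 0 < cnt Rd (B.filter (Rd.Adj v)) (C.filter (Rd.Adj v)) := lt_of_le_of_lt (by positivity) h
  unfold cnt at hpos
  obtain ⟨x, hx, hx'⟩ := Finset.exists_ne_zero_of_sum_ne_zero hpos.ne'
  have : ((C.filter (Rd.Adj v)).filter (Rd.Adj x)).card ≠ 0 := by exact_mod_cast hx'
  obtain ⟨y, hy⟩ := Finset.card_pos.1 (Nat.pos_of_ne_zero this)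
  simp only [Finset.mem_filter] at hx hy
  exact hT v x y hx.2 hy.2 hy.1.2

theorem dens_aux {θ β a b x y c e e1 e2 : ℝ} (h1 : e ≤ e1 + e2) (h2 : e1 ≤ θ * β ^ 2 * a * b)
    (h4 : θ * ((β * a) * (β * b)) ≤ θ * (x * y)) (hcc : (c + θ) * x * y ≤ e) : c * x * y ≤ e2 := by
  have e3 : θ * β ^ 2 * a * b = θ * ((β * a) * (β * b)) := by ring
  have e4 : (c + θ) * x * y = c * x * y + θ * (x * y) := by ring
  linarith

set_option maxHeartbeats 1000000 in
theorem cluster_main (θ : ℝ) (hθ : 0 < θ) (hθ1 : θ ≤ 1) : ∃ κ : ℝ, 0 < κ ∧ κ ≤ 1 ∧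
    ∀ (V ι : Type) (E₁ E₂ : SimpleGraph V) (S K : Finset ι) (A : ι → Finset V) (F : ι → ι → Prop),
      TF E₁ → (∀ Q : Finset V, E₂.IsClique (Q : Set V) → Q.card ≤ 6) → K ⊆ S →
      (∀ i ∈ S, 0 < (A i).card) →
      (∀ i ∈ S, ∀ I : Finset V, (∀ x ∈ I, ∀ y ∈ I, x ≠ y → ¬ (E₁ ⊔ E₂).Adj x y) →
        (I.card : ℝ) < κ * (A i).card) →
      (∀ i ∈ S, ∀ j ∈ S, i ≠ j → ∀ X ⊆ A i, ∀ Y ⊆ A j, κ * (A i).card ≤ X.card →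
        κ * (A j).card ≤ Y.card → 2 * θ * X.card * Y.card ≤ cnt (E₁ ⊔ E₂) X Y) →
      (∀ i ∈ S, ∀ j ∈ S, i ≠ j → F i j → ∀ X ⊆ A i, ∀ Y ⊆ A j, κ * (A i).card ≤ X.card →
        κ * (A j).card ≤ Y.card → (1 / 2 + 2 * θ) * X.card * Y.card ≤ cnt (E₁ ⊔ E₂) X Y) →
      (∀ i ∈ K, ∀ j ∈ K, i ≠ j → F i j) →
      ((K.card = 8 ∧ S.card = 9) ∨ (K.card = 7 ∧ S.card = 10) ∨ (K.card = 6 ∧ S.card = 13) ∨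
      S.card = 21) → False := by
  set M : ℝ := 2 / θ with hM
  have hM2 : 2 ≤ M := by rw [hM, le_div_iff₀ hθ]; linarith
  have hMθ : 1 ≤ M * θ := by rw [hM, div_mul_cancel₀ _ hθ.ne']; norm_num
  have hM0 : 0 < M := by linarith
  set β : ℝ := (M ^ 21)⁻¹ with hβdef
  have hβ : 0 < β := by positivity
  have hβ1 : β ≤ 1 := inv_le_one_of_one_le₀ (one_le_pow₀ (by linarith))
  obtain ⟨σ, ρ₀, γ', hσ, hσ1, hρ₀, hγ', hγle, hproc⟩ := pairproc 441 (θ * β ^ 2) (by positivity)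
  set τ : ℝ := min (ρ₀ * σ) 1 with hτdef
  have hτ : 0 < τ := lt_min (by positivity) one_pos
  have hτ1 : τ ≤ 1 := min_le_right _ _
  have hτρ : τ ≤ ρ₀ * σ := min_le_left _ _
  have hστ : σ * τ ≤ 1 := by nlinarith
  refine ⟨β * (σ * τ), by positivity, by nlinarith [mul_pos hσ hτ], ?_⟩
  intro V ι E₁ E₂ S K A F hT h7 hKS hA hind hd hdF hKF hc
  -- types
  have htype : ∀ i, ∃ Z ⊆ A i, τ * (A i).card ≤ Z.card ∧
      ((∀ x ∈ Z, ∀ y ∈ Z, ¬ E₁.Adj x y) ∨ (Z = A i ∧ ∀ W ⊆ A i, (∀ x ∈ W, ∀ y ∈ W, ¬ E₁.Adj x y) →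
        (W.card : ℝ) < τ * (A i).card)) := by
    intro i
    by_cases h : ∃ Z ⊆ A i, τ * (A i).card ≤ Z.card ∧ (∀ x ∈ Z, ∀ y ∈ Z, ¬ E₁.Adj x y)
    · obtain ⟨Z, h1, h2, h3⟩ := h
      exact ⟨Z, h1, h2, Or.inl h3⟩
    · push Not at h
      refine ⟨A i, subset_rfl, ?_, Or.inr ⟨rfl, ?_⟩⟩
      · have : (0:ℝ) ≤ (A i).card := Nat.cast_nonneg _
        nlinarith
      · intro W hW hfree
        by_contra hlt
        push Not at hlt
        obtain ⟨x, hx, y, hy, hxy⟩ := h W hW hlt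
        exact hfree x hx y hy hxy
  choose A1 hA1s hA1c hA1t using htype
  -- pairs
  have hScard : S.card ≤ 21 := by omega
  obtain ⟨A2, ρ, N, hρ, hρ2, hA2, hblue, hred⟩ := hproc V ι E₁ S (S ×ˢ S) A1
    (by rw [Finset.card_product]; nlinarith) (by
      intro i hi j hj _ hn
      exact (hn (Finset.mk_mem_product hi hj)).elim)
  have hρ0 : 0 < ρ := hρ₀.trans_le hρ
  have hA2A : ∀ i, A2 i ⊆ A i := fun i => (hA2 i).1.trans (hA1s i)
  have hA2c : ∀ i, σ * τ * (A i).card ≤ (A2 i).card := by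
    intro i
    have := mul_le_mul_of_nonneg_left (hA1c i) hσ.le
    have := (hA2 i).2
    linarith
  have hA2p : ∀ i ∈ S, 0 < (A2 i).card := by
    intro i hi
    have h1 : (0:ℝ) < (A i).card := by exact_mod_cast hA i hi
    have h2 : (0:ℝ) < (A2 i).card := lt_of_lt_of_le (by positivity) (hA2c i)
    exact_mod_cast h2
  have hκ : ∀ i, ∀ X : Finset V, β * (A2 i).card ≤ X.card → β * (σ * τ) * (A i).card ≤ X.card := by
    intro i X hX
    have := mul_le_mul_of_nonneg_left (hA2c i) hβ.le
    linarith
  -- reduced red graph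
  let R : SimpleGraph ι :=
    { Adj := fun i j => i ≠ j ∧ i ∈ S ∧ j ∈ S ∧ (i, j) ∈ N ∧ (j, i) ∈ N
      symm := ⟨fun i j h => ⟨h.1.symm, h.2.2.1, h.2.1, h.2.2.2.2, h.2.2.2.1⟩⟩
      loopless := ⟨fun i h => h.1 rfl⟩ }
  have hRreg : ∀ i j, R.Adj i j → ∀ X ⊆ A2 i, ∀ Y ⊆ A2 j,
          ρ * (A2 i).card ≤ X.card → ρ * (A2 j).card ≤ Y.card →
          ρ * X.card * Y.card < cnt E₁ X Y := by
    intro i j h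
    exact hred i h.2.1 j h.2.2.1 h.1 h.2.2.2.1
  have hRT : TF R := by
    intro i j k h1 h2 h3
    exact red_tri hT hρ0 hρ2 (hA2p i h1.2.1) (hA2p j h2.2.1) (hA2p k h2.2.2.1) (hRreg i j h1)
      (hRreg i k h3) (hRreg j k h2)
  have hRblue : ∀ i ∈ S, ∀ j ∈ S, i ≠ j → ¬ R.Adj i j →
      cnt E₁ (A2 i) (A2 j) ≤ θ * β ^ 2 * (A2 i).card * (A2 j).card := by
    intro i hi j hj hij hn
    by_cases h1 : (i, j) ∈ N
    · by_cases h2 : (j, i) ∈ N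
      · exact (hn ⟨hij, hi, hj, h1, h2⟩).elim
      · have := hblue j hj i hi hij.symm h2
        rw [cnt_comm]
        linarith
    · exact hblue i hi j hj hij h1
  let B : ι → Prop := fun i => ∀ x ∈ A1 i, ∀ y ∈ A1 i, ¬ E₁.Adj x y
  have hRB1 : ∀ i j, R.Adj i j → B i := by
    intro i j h
    rcases hA1t i with hB | ⟨he, hsmall⟩
    · exact hB
    exfalso
    have hji := hRreg j i h.symm
    have h1 := bad_small (H := E₁) (c := ρ) (β := 1/2) (A := A2 j) (X := A2 j) (Y := A2 i) subset_rfl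
      (hA2p i h.2.1) (hA2p j h.2.2.1) (by norm_num) (by
        intro Z hZ hZc
        refine (hji Z hZ (A2 i) subset_rfl ?_ ?_).le
        · have : (0:ℝ) ≤ (A2 j).card := Nat.cast_nonneg _
          nlinarith
        · have : (0:ℝ) ≤ (A2 i).card := Nat.cast_nonneg _
          nlinarith)
    obtain ⟨v, hv, hvc⟩ : ∃ v ∈ A2 j, ρ * (A2 i).card ≤ (((A2 i).filter (E₁.Adj v)).card : ℝ) := by
      by_contra hcon
      push Not at hcon
      rw [Finset.filter_true_of_mem hcon] at h1
      have : (0:ℝ) < (A2 j).card := by exact_mod_cast hA2p j h.2.2.1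
      linarith
    have h2 := hsmall ((A2 i).filter (E₁.Adj v)) ((Finset.filter_subset _ _).trans (hA2A i)) (by
      intro x hx y hy hxy
      rw [Finset.mem_filter] at hx hy
      exact hT v x y hx.2 hxy hy.2)
    have h3 := (hA2 i).2
    rw [he] at h3
    have h4 : ρ₀ * (σ * (A i).card) ≤ ρ * (A2 i).card :=
      mul_le_mul hρ h3 (by positivity) hρ0.le
    have h5 : τ * (A i).card ≤ ρ₀ * σ * (A i).card :=
      mul_le_mul_of_nonneg_right hτρ (Nat.cast_nonneg _)
    linarith
  refine comb_main (R := R) hRT B F S K hKS (fun i j h => ⟨hRB1 i j h, hRB1 j i h.symm⟩) hKF ?_ hc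
  intro C hCS D hDC hBC hDB hDF
  have dens : ∀ i ∈ C, ∀ j ∈ C, i ≠ j → ∀ X ⊆ A2 i, ∀ Y ⊆ A2 j, β * (A2 i).card ≤ X.card →
      β * (A2 j).card ≤ Y.card → ∀ c : ℝ, (c + θ) * X.card * Y.card ≤ cnt (E₁ ⊔ E₂) X Y →
      c * X.card * Y.card ≤ cnt E₂ X Y := by
    intro i hi j hj hij X hX Y hY hXc hYc c hcc
    have h1 := cnt_sup E₁ E₂ X Y
    have h2 := (cnt_mono E₁ hX hY).trans (hRblue i (hCS hi) j (hCS hj) hij (hBC i hi j hj hij))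
    have h3 : (β * (A2 i).card) * (β * (A2 j).card) ≤ X.card * Y.card :=
      mul_le_mul hXc hYc (by positivity) (Nat.cast_nonneg _)
    have h4 := mul_le_mul_of_nonneg_left h3 hθ.le
    exact dens_aux h1 h2 h4 hcc
  obtain ⟨Q, -, hQc, hQ⟩ := embed E₂ A2 β θ M hβ hθ hM2 hMθ C.card C D rfl hDC
    (fun i hi => hA2p i (hCS hi))
    (by
      intro i hi j hj hij X hX Y hY hXc hYc
      refine dens i hi j hj hij X hX Y hY hXc hYc θ ?_
      have := hd i (hCS hi) j (hCS hj) hij X (hX.trans (hA2A i)) Y (hY.trans (hA2A j)) (hκ i X hXc) (hκ j Y hYc)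
      linarith)
    (by
      intro i hi j hj hij X hX Y hY hXc hYc
      refine dens i (hDC hi) j (hDC hj) hij X hX Y hY hXc hYc (1/2 + θ) ?_
      have := hdF i (hCS (hDC hi)) j (hCS (hDC hj)) hij (hDF i hi j hj hij) X (hX.trans (hA2A i)) Y
        (hY.trans (hA2A j)) (hκ i X hXc) (hκ j Y hYc)
      linarith)
    (by
      intro i hi X hX hXc
      by_contra hcon
      push Not at hcon
      have hlt := hind i (hCS (hDC hi)) X (by
        intro x hx y hy _ hadj
        rw [SimpleGraph.sup_adj] at hadj
        rcases hadj with hadj | hadj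
        · exact hDB i hi x ((hA2 i).1 (hX hx)) y ((hA2 i).1 (hX hy)) hadj
        · exact hcon x hx y hy hadj)
      exact absurd (hκ i X hXc) (not_le.2 hlt))
    A2 (fun i _ => subset_rfl) (by
      intro i hi
      have hCc : C.card ≤ 21 := (Finset.card_le_card hCS).trans hScard
      have h1 : M ^ C.card ≤ M ^ 21 := pow_le_pow_right₀ (by linarith) hCc
      have h2 : β * M ^ C.card ≤ 1 := by
        calc β * M ^ C.card ≤ β * M ^ 21 := mul_le_mul_of_nonneg_left h1 hβ.le
          _ = 1 := inv_mul_cancel₀ (by positivity)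
      have : (0:ℝ) ≤ (A2 i).card := Nat.cast_nonneg _
      nlinarith)
  rw [← hQc]
  exact h7 Q hQ

end proc
end RT37

set_option linter.unusedVariables false
set_option linter.style.longLine false
namespace RT37
section Reg
open Classical

theorem cnt_dens {V : Type} (G : SimpleGraph V) (X Y : Finset V) :
    ((G.edgeDensity X Y : ℚ) : ℝ) = cnt G X Y / (X.card * Y.card) := by
  have : (G.interedges X Y).card = ∑ x ∈ X, (Y.filter (G.Adj x)).card := by
    unfold SimpleGraph.interedges Rel.interedges
    rw [Finset.card_filter, Finset.sum_product]
    exact Finset.sum_congr rfl fun x _ => (Finset.card_filter _ _).symm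
  rw [SimpleGraph.edgeDensity_def, this]
  unfold cnt
  push_cast
  rfl

theorem cnt_le_mul {V : Type} (G : SimpleGraph V) (X Y : Finset V) :
    cnt G X Y ≤ X.card * Y.card := by
  unfold cnt
  calc _ ≤ ∑ x ∈ X, (Y.card : ℝ) := Finset.sum_le_sum fun x _ => by
          exact_mod_cast Finset.card_filter_le _ _
    _ = _ := by simp

theorem cnt_of_unif {V : Type} (G : SimpleGraph V) {s t X Y : Finset V} {e κ d : ℝ}
    (hu : G.IsUniform e s t) (hκ : e ≤ κ) (hX : X ⊆ s) (hY : Y ⊆ t) (hXc : κ * s.card ≤ X.card)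
    (hYc : κ * t.card ≤ Y.card) (hd : d + e ≤ ((G.edgeDensity s t : ℚ) : ℝ)) :
    d * X.card * Y.card ≤ cnt G X Y := by
  have hs : (0:ℝ) ≤ s.card := Nat.cast_nonneg _
  have ht : (0:ℝ) ≤ t.card := Nat.cast_nonneg _
  have h := hu hX hY (by nlinarith) (by nlinarith)
  have h2 := (abs_lt.1 h).1
  have h3 : d ≤ ((G.edgeDensity X Y : ℚ) : ℝ) := by linarith
  rw [cnt_dens] at h3
  rcases Nat.eq_zero_or_pos X.card with h0 | h0
  · rw [h0]; simp [cnt_nonneg]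
  rcases Nat.eq_zero_or_pos Y.card with h1 | h1
  · rw [h1]; simp [cnt_nonneg]
  have : (0:ℝ) < X.card * Y.card := by positivity
  rw [le_div_iff₀ this] at h3
  linarith

theorem cnt_parts {V : Type} [Fintype V] [DecidableEq V] (G : SimpleGraph V) (P : Finpartition (Finset.univ : Finset V)) :
    cnt G Finset.univ Finset.univ = ∑ U ∈ P.parts, ∑ W ∈ P.parts, cnt G U W := by
  have key : ∀ f : V → ℝ, ∑ x, f x = ∑ U ∈ P.parts, ∑ x ∈ U, f x := by
    intro f
    conv_lhs => rw [← P.biUnion_parts]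
    exact Finset.sum_biUnion P.supIndep.pairwiseDisjoint
  simp_rw [cnt_eq]
  rw [key]
  refine Finset.sum_congr rfl fun U _ => ?_
  exact (Finset.sum_congr rfl fun x _ => key _).trans Finset.sum_comm

theorem cnt_edges {n : ℕ} (G : SimpleGraph (Fin n)) :
    cnt G Finset.univ Finset.univ = 2 * (G.edgeSet.ncard : ℝ) := by
  have h := G.sum_degrees_eq_twice_card_edges
  have h1 : G.edgeSet.ncard = G.edgeFinset.card := by
    rw [← SimpleGraph.coe_edgeFinset, Set.ncard_coe_finset]
  rw [h1]
  unfold cnt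
  have h2 : ((∑ v, G.degree v : ℕ) : ℝ) = 2 * G.edgeFinset.card := by rw [h]; push_cast; ring
  rw [← h2]
  push_cast
  refine Finset.sum_congr rfl fun v _ => ?_
  rw [← SimpleGraph.card_neighborFinset_eq_degree, SimpleGraph.neighborFinset_eq_filter]

theorem div_aux {n k : ℕ} (hk : 0 < k) (hn : k ≤ n) : n < 2 * k * (n / k) := by
  rw [mul_assoc, two_mul, ← add_lt_add_iff_right (n % k), add_right_comm, add_assoc,
    Nat.mod_add_div n k, add_comm, add_lt_add_iff_right]
  apply (Nat.mod_lt n hk).trans_le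
  simpa using Nat.mul_le_mul_left k ((Nat.one_le_div_iff hk).2 hn)

set_option maxHeartbeats 2000000 in
theorem main (e : ℝ) (he : 0 < e) (he1 : e ≤ 1) : ∃ δ : ℝ, 0 < δ ∧ ∃ N : ℕ, 0 < N ∧
      ∀ n : ℕ, N ≤ n → ∀ G : SimpleGraph (Fin n),
        (∀ s : Finset (Fin n),
            (∀ x ∈ s, ∀ y ∈ s, x ≠ y → ¬ G.Adj x y) → (s.card : ℝ) ≤ δ * n) →
        (∃ E₁ E₂ : SimpleGraph (Fin n),
            E₁ ⊔ E₂ = G ∧ E₁ ⊓ E₂ = ⊥ ∧ E₁.CliqueFree 3 ∧ E₂.CliqueFree 7) →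
        (G.edgeSet.ncard : ℝ) ≤ (7 / 16 + e) * n ^ 2 := by
  obtain ⟨κ, hκ, hκ1, hmain⟩ := cluster_main (e / 4) (by positivity) (by linarith)
  set e₁ : ℝ := min κ (e / 8) with he₁
  have he₁0 : 0 < e₁ := lt_min hκ (by positivity)
  have he₁κ : e₁ ≤ κ := min_le_left _ _
  have he₁e : e₁ ≤ e / 8 := min_le_right _ _
  set l : ℕ := ⌈4 / e⌉₊ with hl
  have hle : 4 / e ≤ l := Nat.le_ceil _
  set M : ℕ := SzemerediRegularity.bound e₁ l with hM
  have hM0 : 0 < M := SzemerediRegularity.bound_pos _ _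
  have hMR : (0:ℝ) < M := by exact_mod_cast hM0
  refine ⟨κ / (4 * M), by positivity, l + 1, by omega, ?_⟩
  rintro n hn G hind ⟨E₁, E₂, hE, -, h3, h7⟩
  have hn0 : 0 < n := by omega
  have hnR : (0:ℝ) < n := by exact_mod_cast hn0
  obtain ⟨P, hPe, hPl, hPM, hPu⟩ := szemeredi_regularity G he₁0 (l := l) (by rw [Fintype.card_fin]; omega)
  by_contra hcon
  push Not at hcon
  have hne : (Finset.univ : Finset (Fin n)).Nonempty := ⟨⟨0, hn0⟩, Finset.mem_univ _⟩
  have hk0 : 0 < P.parts.card := by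
    have : (0:ℝ) < l := lt_of_lt_of_le (by positivity) hle
    have : 0 < l := by exact_mod_cast this
    omega
  have hkn : P.parts.card ≤ n := by simpa using P.card_parts_le_card
  have hkR : (0:ℝ) < P.parts.card := by exact_mod_cast hk0
  have hknR : (P.parts.card : ℝ) ≤ n := by exact_mod_cast hkn
  -- sizes
  have hlow : ∀ U ∈ P.parts, (n:ℝ) ≤ 2 * M * U.card := by
    intro U hU
    have h1 := hPe.average_le_card_part hU
    rw [Finset.card_univ, Fintype.card_fin] at h1
    have h2 := div_aux hk0 hkn
    have : n ≤ 2 * M * U.card := h2.le.trans (Nat.mul_le_mul (by omega) h1)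
    exact_mod_cast this
  have hup : ∀ U ∈ P.parts, (P.parts.card : ℝ) * U.card ≤ 2 * n := by
    intro U hU
    have h1 := hPe.card_part_le_average_add_one hU
    rw [Finset.card_univ, Fintype.card_fin] at h1
    have h2 : P.parts.card * U.card ≤ 2 * n := by
      have h3 := Nat.mul_le_mul_left P.parts.card h1
      have h4 := Nat.mul_div_le n P.parts.card
      rw [Nat.mul_add] at h3
      omega
    exact_mod_cast h2
  have hsum : ∑ U ∈ P.parts, (U.card : ℝ) = n := by
    have := P.sum_card_parts
    rw [Finset.card_univ, Fintype.card_fin] at this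
    exact_mod_cast this
  have hdiag : ∑ U ∈ P.parts, (U.card : ℝ) * U.card ≤ e / 2 * n ^ 2 := by
    have h1 : (P.parts.card : ℝ) * ∑ U ∈ P.parts, (U.card : ℝ) * U.card ≤ 2 * n * n := by
      rw [Finset.mul_sum]
      calc _ ≤ ∑ U ∈ P.parts, 2 * (n:ℝ) * U.card := Finset.sum_le_sum fun U hU => by
            rw [← mul_assoc]
            exact mul_le_mul_of_nonneg_right (hup U hU) (Nat.cast_nonneg _)
        _ = _ := by rw [← Finset.mul_sum, hsum]
    have h2 : 4 / e ≤ (P.parts.card : ℝ) := hle.trans (by exact_mod_cast hPl)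
    have h3 : 0 ≤ ∑ U ∈ P.parts, (U.card : ℝ) * U.card := Finset.sum_nonneg fun U _ => by positivity
    have h4 := (mul_le_mul_of_nonneg_right h2 h3).trans h1
    have h5 := mul_le_mul_of_nonneg_left h4 (by positivity : 0 ≤ e / 4)
    have h6 : e / 4 * (4 / e * ∑ U ∈ P.parts, (U.card : ℝ) * U.card) = ∑ U ∈ P.parts, (U.card : ℝ) * U.card := by
      rw [← mul_assoc, div_mul_div_comm, mul_comm e 4, div_self (by positivity), one_mul]
    rw [h6] at h5
    linarith
  have hnon : ∑ p ∈ P.nonUniforms G e₁, ((p.1.card : ℝ) * p.2.card) ≤ e / 2 * n ^ 2 := by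
    have h1 := hPe.sum_nonUniforms_lt' hne he₁0 hPu
    rw [Finset.card_univ, Fintype.card_fin] at h1
    have h2 : ((n:ℝ) + P.parts.card) ^ 2 ≤ (2 * n) ^ 2 := by
      apply pow_le_pow_left₀ (by positivity); linarith
    have h3 : e₁ * ((n:ℝ) + P.parts.card) ^ 2 ≤ e / 8 * (2 * n) ^ 2 :=
      mul_le_mul he₁e h2 (by positivity) (by positivity)
    linarith
  -- weights
  let d : Finset (Fin n) → Finset (Fin n) → ℝ := fun U W => ((G.edgeDensity U W : ℚ) : ℝ)
  have dsymm : ∀ U W, d U W = d W U := fun U W => by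
    simp only [d]; rw [SimpleGraph.edgeDensity_comm]
  have d1 : ∀ U W, d U W ≤ 1 := fun U W => by
    simp only [d]; exact_mod_cast G.edgeDensity_le_one U W
  have dc : ∀ U ∈ P.parts, ∀ W ∈ P.parts, cnt G U W = d U W * (U.card * W.card) := by
    intro U hU W hW
    simp only [d]
    rw [cnt_dens]
    have hU0 : (0:ℝ) < U.card := by exact_mod_cast (P.nonempty_of_mem_parts hU).card_pos
    have hW0 : (0:ℝ) < W.card := by exact_mod_cast (P.nonempty_of_mem_parts hW).card_pos
    field_simp
  let w : Finset (Fin n) → Finset (Fin n) → ℝ := fun U W =>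
    if U ≠ W ∧ G.IsUniform e₁ U W then d U W - e else 0
  have hpair : ∀ U ∈ P.parts, ∀ W ∈ P.parts, cnt G U W ≤ w U W * (U.card * W.card) +
      e * (U.card * W.card) + (if U = W then (U.card : ℝ) * W.card else 0) +
      (if (U, W) ∈ P.nonUniforms G e₁ then (U.card : ℝ) * W.card else 0) := by
    intro U hU W hW
    have hp : (0:ℝ) ≤ U.card * W.card := by positivity
    have hc := cnt_le_mul G U W
    have hep : 0 ≤ e * ((U.card : ℝ) * W.card) := by positivity
    simp only [w]
    by_cases h1 : U = W
    · rw [if_neg (fun h => h.1 h1), if_pos h1]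
      split_ifs <;> linarith
    · by_cases h2 : G.IsUniform e₁ U W
      · rw [if_pos ⟨h1, h2⟩, if_neg h1, if_neg (by
          rw [Finpartition.mk_mem_nonUniforms]; exact fun h => h.2.2.2 h2), dc U hU W hW]
        apply le_of_eq; ring
      · rw [if_neg (fun h => h2 h.2), if_neg h1, if_pos (by
          rw [Finpartition.mk_mem_nonUniforms]; exact ⟨hU, hW, h1, h2⟩)]
        linarith
  have htot : cnt G Finset.univ Finset.univ ≤
      (∑ U ∈ P.parts, ∑ W ∈ P.parts, w U W * (U.card * W.card)) + e * n ^ 2 + e / 2 * n ^ 2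
        + e / 2 * n ^ 2 := by
    rw [cnt_parts G P]
    refine (Finset.sum_le_sum fun U hU => Finset.sum_le_sum fun W hW => hpair U hU W hW).trans ?_
    simp_rw [Finset.sum_add_distrib]
    have t1 : ∑ U ∈ P.parts, ∑ W ∈ P.parts, e * ((U.card : ℝ) * W.card) = e * n ^ 2 := by
      simp_rw [← Finset.mul_sum]
      rw [← Finset.sum_mul, hsum]; ring
    have t2 : ∑ U ∈ P.parts, ∑ W ∈ P.parts, (if U = W then (U.card : ℝ) * W.card else 0)
        ≤ e / 2 * n ^ 2 := by
      refine le_trans (le_of_eq ?_) hdiag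
      refine Finset.sum_congr rfl fun U hU => ?_
      rw [Finset.sum_ite_eq, if_pos hU]
    have t3 : ∑ U ∈ P.parts, ∑ W ∈ P.parts,
        (if (U, W) ∈ P.nonUniforms G e₁ then (U.card : ℝ) * W.card else 0) ≤ e / 2 * n ^ 2 := by
      refine le_trans (le_of_eq ?_) hnon
      rw [← Finset.sum_product', ← Finset.sum_filter]
      refine Finset.sum_congr ?_ fun _ _ => rfl
      ext ⟨U, W⟩
      rw [Finset.mem_filter, Finset.mem_product, Finpartition.mk_mem_nonUniforms]
      exact ⟨fun h => h.2, fun h => ⟨⟨h.1, h.2.1⟩, h⟩⟩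
    linarith
  have hbig : 7 / 8 * (n:ℝ) ^ 2 < ∑ U ∈ P.parts, ∑ W ∈ P.parts, w U W * (U.card * W.card) := by
    rw [cnt_edges] at htot
    linarith
  -- apply the weighted Lagrangian lemma
  let PP : {U // U ∈ P.parts} → {U // U ∈ P.parts} → Prop := fun i j =>
    (i.1 ≠ j.1 ∧ G.IsUniform e₁ i.1 j.1) ∧ e ≤ d i.1 j.1
  let FF : {U // U ∈ P.parts} → {U // U ∈ P.parts} → Prop := fun i j =>
    PP i j ∧ 1 / 2 + e ≤ d i.1 j.1
  have hPPs : ∀ i j, PP i j → PP j i := fun i j h => by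
    refine ⟨⟨h.1.1.symm, h.1.2.symm⟩, ?_⟩
    rw [dsymm]; exact h.2
  have hFFs : ∀ i j, FF i j → FF j i := fun i j h => by
    refine ⟨hPPs _ _ h.1, ?_⟩
    rw [dsymm]; exact h.2
  obtain ⟨S, K, hKS, hSP, hKF, hc⟩ := lag_main PP FF hPPs hFFs (fun i h => h.1.1 rfl) (fun i j h => h.1)
    (fun i j => w i.1 j.1) (by
      intro i j
      simp only [w]
      by_cases hu : i.1 ≠ j.1 ∧ G.IsUniform e₁ i.1 j.1
      · rw [if_pos hu]
        by_cases hF : FF i j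
        · rw [if_pos hF]; have := d1 i.1 j.1; linarith
        · rw [if_neg hF]
          by_cases hP : PP i j
          · rw [if_pos hP]
            have : ¬ (1 / 2 + e ≤ d i.1 j.1) := fun h => hF ⟨hP, h⟩
            linarith
          · rw [if_neg hP]
            have : ¬ (e ≤ d i.1 j.1) := fun h => hP ⟨hu, h⟩
            linarith
      · rw [if_neg hu]
        split_ifs <;> norm_num)
    (fun i => (i.1.card : ℝ) / n) (fun i => by positivity)
    (by
      rw [← Finset.sum_div, Finset.sum_coe_sort P.parts (fun U => (U.card : ℝ)), hsum]
      exact div_self hnR.ne')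
    (by
      have h1 : ∑ i : {U // U ∈ P.parts}, ∑ j : {U // U ∈ P.parts},
          w i.1 j.1 * ((i.1.card : ℝ) / n) * ((j.1.card : ℝ) / n) =
          (∑ U ∈ P.parts, ∑ W ∈ P.parts, w U W * (U.card * W.card)) / n ^ 2 := by
        rw [← Finset.sum_coe_sort P.parts, Finset.sum_div]
        refine Finset.sum_congr rfl fun i _ => ?_
        rw [← Finset.sum_coe_sort P.parts, Finset.sum_div]
        refine Finset.sum_congr rfl fun j _ => ?_
        field_simp
      rw [h1, lt_div_iff₀ (by positivity)]
      exact hbig)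
  subst hE
  refine hmain (Fin n) {U // U ∈ P.parts} E₁ E₂ S K (fun i => i.1) FF ?_ ?_ hKS ?_ ?_ ?_ ?_ hKF hc
  · intro a b c hab hbc hac
    exact h3 {a, b, c} (SimpleGraph.is3Clique_triple_iff.2 ⟨hab, hac, hbc⟩)
  · intro Q hQ
    by_contra hcard
    obtain ⟨Q', hQ', hc'⟩ := Finset.exists_subset_card_eq (s := Q) (n := 7) (by omega)
    exact h7 Q' ⟨hQ.subset (by exact_mod_cast hQ'), hc'⟩
  · intro i _
    exact (P.nonempty_of_mem_parts i.2).card_pos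
  · intro i _ I hI
    have h1 := hind I hI
    have h2 := hlow i.1 i.2
    have h4 := mul_le_mul_of_nonneg_left h2 (by positivity : 0 ≤ κ / (4 * M))
    have h5 : κ / (4 * M) * (2 * M * (i.1.card : ℝ)) = κ * i.1.card / 2 := by field_simp; norm_num
    have h6 : (0:ℝ) < i.1.card := by exact_mod_cast (P.nonempty_of_mem_parts i.2).card_pos
    have h7 : 0 < κ * (i.1.card : ℝ) := by positivity
    linarith
  · intro i hi j hj hij X hX Y hY hXc hYc
    have hp := hSP i hi j hj hij
    refine cnt_of_unif _ hp.1.2 he₁κ hX hY hXc hYc ?_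
    have := hp.2
    simp only [d] at this
    linarith
  · intro i hi j hj hij hF X hX Y hY hXc hYc
    have hp := hSP i hi j hj hij
    refine cnt_of_unif _ hp.1.2 he₁κ hX hY hXc hYc ?_
    have := hF.2
    simp only [d] at this
    linarith

end Reg
end RT37

theorem rt_3_7_upper :
    ∀ ε : ℝ, 0 < ε → ∃ δ : ℝ, 0 < δ ∧ ∃ N : ℕ, 0 < N ∧
      ∀ n : ℕ, N ≤ n → ∀ G : SimpleGraph (Fin n),
        (∀ s : Finset (Fin n),
            (∀ x ∈ s, ∀ y ∈ s, x ≠ y → ¬ G.Adj x y) → (s.card : ℝ) ≤ δ * n) →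
        (∃ E₁ E₂ : SimpleGraph (Fin n),
            E₁ ⊔ E₂ = G ∧ E₁ ⊓ E₂ = ⊥ ∧ E₁.CliqueFree 3 ∧ E₂.CliqueFree 7) →
        (G.edgeSet.ncard : ℝ) ≤ (7 / 16 + ε) * n ^ 2 := by
  intro ε hε
  obtain ⟨δ, hδ, N, hN, h⟩ := RT37.main (min ε 1) (lt_min hε one_pos) (min_le_right _ _)
  refine ⟨δ, hδ, N, hN, fun n hn G h1 h2 => (h n hn G h1 h2).trans ?_⟩
  have := min_le_left ε 1
  gcongr
end

section
/- For every ε > 0 and every δ > 0 there exists a positive integer N such that for every n ≥ N there exists a simple graph G on n vertices whose independence number is at most δn, whose edge set can be partitioned into two sets E₁ and E₂ such that (V(G), E₁) contains no clique on 3 vertices and (V(G), E₂) contains no clique on 7 vertices, and which has at least (7/16 − ε)·n² edges. -/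
/-- Iterated weighted Mycielski construction. -/
lemma myc (m : ℕ) : ∃ (V : Type) (_ : Fintype V) (_ : DecidableEq V) (r : V → V → Prop)
    (c : V → ℕ) (w : V → ℕ) (b : ℕ),
    (∀ x y, r x y → r y x) ∧ (∀ x y z, r x y → r y z → r x z → False) ∧
    (∀ x y, r x y → c x ≠ c y) ∧ (∀ x, c x < m + 1) ∧ 0 < b ∧
    (∀ s : Finset V, (∀ x ∈ s, ∀ y ∈ s, ¬ r x y) → ∑ x ∈ s, w x ≤ b) ∧
    ((∑ x, w x : ℕ) : ℝ) = b * (1 + ∑ i ∈ Finset.range m, 1 / ((i : ℝ) + 1)) := by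
  classical
  induction m with
  | zero =>
    refine ⟨Unit, inferInstance, inferInstance, fun _ _ => False, fun _ => 0, fun _ => 1, 1,
      by simp, by simp, by simp, by simp, by simp, ?_, by simp⟩
    intro s _
    simpa using Finset.card_le_univ s
  | succ m ih =>
    obtain ⟨V, _, _, r, c, w, b, hsym, htri, hc, hcm, hb, hind, htot⟩ := ih
    let r' : Option (V ⊕ V) → Option (V ⊕ V) → Prop := fun p q =>
      match p, q with
      | none, some (Sum.inr _) => True
      | some (Sum.inr _), none => True
      | some (Sum.inl x), some (Sum.inl y) => r x y
      | some (Sum.inl x), some (Sum.inr y) => r x y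
      | some (Sum.inr x), some (Sum.inl y) => r x y
      | _, _ => False
    let c' : Option (V ⊕ V) → ℕ := fun p =>
      match p with
      | none => m + 1
      | some (Sum.inl x) => c x
      | some (Sum.inr x) => c x
    let w' : Option (V ⊕ V) → ℕ := fun p =>
      match p with
      | none => b
      | some (Sum.inl x) => m * w x
      | some (Sum.inr x) => w x
    refine ⟨Option (V ⊕ V), inferInstance, inferInstance, r', c', w', (m + 1) * b,
      ?_, ?_, ?_, ?_, by positivity, ?_, ?_⟩
    · rintro (_ | x | x) (_ | y | y) h <;> simp only [r'] at h ⊢ <;> exact hsym _ _ h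
    · rintro (_ | x | x) (_ | y | y) (_ | z | z) h1 h2 h3 <;> simp only [r'] at h1 h2 h3 <;>
        exact htri _ _ _ h1 h2 h3
    · rintro (_ | x | x) (_ | y | y) h <;> simp only [r', c'] at h ⊢
      · have := hcm y; omega
      · exact hc _ _ h
      · exact hc _ _ h
      · have := hcm x; omega
      · exact hc _ _ h
    · rintro (_ | x | x) <;> simp only [c']
      · omega
      · have := hcm x; omega
      · have := hcm x; omega
    · intro s hs
      set A : Finset V := Finset.univ.filter (fun x => some (Sum.inl x) ∈ s) with hA
      set B : Finset V := Finset.univ.filter (fun x => some (Sum.inr x) ∈ s) with hB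
      have hsum : ∑ x ∈ s, w' x = (if none ∈ s then b else 0) + (m * ∑ x ∈ A, w x + ∑ x ∈ B, w x) := by
        have : ∑ x ∈ s, w' x = ∑ x, if x ∈ s then w' x else 0 := by simp
        rw [this, Fintype.sum_option, Fintype.sum_sum_type, hA, hB, Finset.sum_filter,
          Finset.sum_filter, Finset.mul_sum]
        simp [w']
      have hAi : ∀ x ∈ A, ∀ y ∈ A, ¬ r x y := by
        intro x hx y hy
        exact hs _ (by simpa [hA] using hx) _ (by simpa [hA] using hy)
      have hAB : ∀ x ∈ A, ∀ y ∈ B, ¬ r x y := by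
        intro x hx y hy
        exact hs _ (by simpa [hA] using hx) _ (by simpa [hB] using hy)
      have hAb := hind A hAi
      rw [hsum]
      by_cases hn : none ∈ s
      · have hBe : B = ∅ := by
          apply Finset.eq_empty_of_forall_notMem
          intro x hx
          have : some (Sum.inr x) ∈ s := by simpa [hB] using hx
          exact hs _ hn _ this trivial
        simp only [hn, hBe, if_true, Finset.sum_empty]
        nlinarith
      · simp only [hn, if_false]
        have hCi : ∀ i ∈ Finset.range (m + 1),
            ∑ x ∈ A, w x + ∑ x ∈ (B \ A).filter (fun x => c x = i), w x ≤ b := by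
          intro i _
          rw [← Finset.sum_union]
          · apply hind
            intro x hx y hy hxy
            simp only [Finset.mem_union, Finset.mem_filter, Finset.mem_sdiff] at hx hy
            rcases hx with hx | hx <;> rcases hy with hy | hy
            · exact hAi x hx y hy hxy
            · exact hAB x hx y hy.1.1 hxy
            · exact hAB y hy x hx.1.1 (hsym _ _ hxy)
            · exact hc _ _ hxy (hx.2.trans hy.2.symm)
          · rw [Finset.disjoint_left]
            intro x hx hx'
            simp only [Finset.mem_filter, Finset.mem_sdiff] at hx'
            exact hx'.1.2 hx
        have h1 := Finset.sum_le_sum hCi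
        rw [Finset.sum_add_distrib, Finset.sum_fiberwise_of_maps_to
          (fun x _ => Finset.mem_range.2 (hcm x))] at h1
        simp only [Finset.sum_const, Finset.card_range, smul_eq_mul] at h1
        have h2 : ∑ x ∈ B, w x ≤ ∑ x ∈ A, w x + ∑ x ∈ B \ A, w x := by
          rw [← Finset.sum_union Finset.disjoint_sdiff]
          apply Finset.sum_le_sum_of_subset
          intro x hx
          by_cases h : x ∈ A <;> simp [h, hx]
        nlinarith
    · rw [Fintype.sum_option, Fintype.sum_sum_type]
      simp only [w']
      rw [← Finset.mul_sum, Finset.sum_range_succ]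
      push_cast at htot ⊢
      rw [htot]
      field_simp
      ring

/-- Triangle-free graphs with small independence ratio. -/
lemma tri_free (δ : ℝ) (hδ : 0 < δ) : ∃ (T : ℕ) (r : Fin T → Fin T → Prop), 0 < T ∧
    (∀ x y, r x y → r y x) ∧ (∀ x y z, r x y → r y z → r x z → False) ∧ (∀ x, ¬ r x x) ∧
    (∀ s : Finset (Fin T), (∀ x ∈ s, ∀ y ∈ s, ¬ r x y) → (s.card : ℝ) ≤ δ * T) := by
  classical
  obtain ⟨m, hm⟩ := ((Filter.tendsto_atTop.1
    Real.tendsto_sum_range_one_div_nat_succ_atTop) (1 / δ)).exists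
  obtain ⟨V, _, _, r, c, w, b, hsym, htri, hc, hcm, hb, hind, htot⟩ := myc m
  have hb' : (0 : ℝ) < b := by exact_mod_cast hb
  have hT : (b : ℝ) ≤ δ * (∑ x, w x : ℕ) := by
    rw [htot]
    have : 1 ≤ δ * (1 + ∑ i ∈ Finset.range m, 1 / ((i : ℝ) + 1)) := by
      rw [div_le_iff₀ hδ] at hm
      nlinarith
    nlinarith
  let e : (Σ v, Fin (w v)) ≃ Fin (∑ x, w x) := Fintype.equivFinOfCardEq (by simp)
  refine ⟨∑ x, w x, fun x y => r (e.symm x).1 (e.symm y).1, ?_, fun x y => hsym _ _,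
    fun x y z => htri _ _ _, fun x h => hc _ _ h rfl, ?_⟩
  · rcases Nat.eq_zero_or_pos (∑ x, w x) with h | h
    · rw [h] at hT; simp at hT; omega
    · exact h
  · intro s hs
    refine le_trans ?_ hT
    have h1 : s.card ≤ ∑ v ∈ s.image (fun x => (e.symm x).1), w v := by
      rw [Finset.card_eq_sum_card_image (fun x => (e.symm x).1) s]
      apply Finset.sum_le_sum
      intro v _
      have : (s.filter (fun x => (e.symm x).1 = v)) ⊆
          (Finset.univ : Finset (Fin (w v))).image (fun i => e ⟨v, i⟩) := by
        intro x hx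
        simp only [Finset.mem_filter] at hx
        obtain ⟨_, rfl⟩ := hx
        simp only [Finset.mem_image, Finset.mem_univ, true_and]
        exact ⟨(e.symm x).2, by simp⟩
      refine (Finset.card_le_card this).trans (Finset.card_image_le.trans (by simp))
    have h2 : ∑ v ∈ s.image (fun x => (e.symm x).1), w v ≤ b := by
      apply hind
      intro x hx y hy
      simp only [Finset.mem_image] at hx hy
      obtain ⟨x, hx, rfl⟩ := hx
      obtain ⟨y, hy, rfl⟩ := hy
      exact hs x hx y hy
    exact_mod_cast h1.trans h2

/-- The red graph on the eight parts (the Wagner graph). -/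
def rd (a b : Fin 8) : Prop := b = a + 1 ∨ a = b + 1 ∨ b = a + 4

instance : DecidableRel rd := fun a b => by unfold rd; infer_instance

lemma rd_symm : ∀ a b, rd a b → rd b a := by decide
lemma rd_irr : ∀ a, ¬ rd a a := by decide
lemma rd_tri : ∀ a b c, rd a b → rd b c → rd a c → False := by decide
set_option maxRecDepth 100000 in
lemma rd_ind : ∀ s : Finset (Fin 8), (∀ a ∈ s, ∀ b ∈ s, ¬ rd a b) → s.card ≤ 3 := by decide

lemma card_mod (n M v : ℕ) (hM : 0 < M) :
    ((Finset.univ.filter (fun i : Fin n => (i : ℕ) % M = v)).card : ℝ) ≤ n / M + 1 := by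
  have h : (Finset.univ.filter (fun i : Fin n => (i : ℕ) % M = v)).card ≤ n / M + 1 := by
    have : (Finset.univ.filter (fun i : Fin n => (i : ℕ) % M = v)).card ≤
        (Finset.range (n / M + 1)).card := by
      apply Finset.card_le_card_of_injOn (fun i : Fin n => (i : ℕ) / M)
      · intro i _
        simp only [Finset.coe_range, Set.mem_Iio]
        exact Nat.lt_succ_of_le (Nat.div_le_div_right i.2.le)
      · intro i hi j hj hij
        simp only [Finset.coe_filter, Finset.mem_univ, true_and, Set.mem_setOf_eq] at hi hj hij
        apply Fin.ext
        rw [← Nat.div_add_mod (i : ℕ) M, ← Nat.div_add_mod (j : ℕ) M, hij, hi, hj]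
    simpa using this
  calc _ ≤ ((n / M + 1 : ℕ) : ℝ) := by exact_mod_cast h
    _ ≤ _ := by
      push_cast
      have := @Nat.cast_div_le ℝ _ _ _ n M
      linarith

/-- Lower bound half of ρ(3,7) = 7/16: for every ε > 0 and δ > 0 there is N such that
for every n ≥ N there is an n-vertex graph with independence number at most δn whose
edges can be 2-colored with no red K₃ and no blue K₇, having at least (7/16 − ε)n² edges. -/
theorem rt_3_7_lower :
    ∀ ε : ℝ, 0 < ε → ∀ δ : ℝ, 0 < δ → ∃ N : ℕ, 0 < N ∧
      ∀ n : ℕ, N ≤ n → ∃ G : SimpleGraph (Fin n),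
        (∀ s : Finset (Fin n),
            (∀ x ∈ s, ∀ y ∈ s, x ≠ y → ¬ G.Adj x y) → (s.card : ℝ) ≤ δ * n) ∧
        (∃ E₁ E₂ : SimpleGraph (Fin n),
            E₁ ⊔ E₂ = G ∧ E₁ ⊓ E₂ = ⊥ ∧ E₁.CliqueFree 3 ∧ E₂.CliqueFree 7) ∧
        (7 / 16 - ε) * n ^ 2 ≤ (G.edgeSet.ncard : ℝ) := by
  classical
  intro ε hε δ hδ
  obtain ⟨T, r, hT, hsym, htri, hirr, hind⟩ := tri_free δ hδ
  obtain ⟨N₀, hN₀⟩ := exists_nat_gt (1 / ε)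
  refine ⟨N₀ + 2 * T, by omega, ?_⟩
  intro n hn
  have hTR : (0 : ℝ) < T := by exact_mod_cast hT
  have hnR : (N₀ : ℝ) + 2 * T ≤ n := by exact_mod_cast hn
  have hN₀' : (0 : ℝ) ≤ N₀ := Nat.cast_nonneg _
  let p : Fin n → Fin 8 := fun i => ⟨(i : ℕ) % 8, Nat.mod_lt _ (by norm_num)⟩
  let f : Fin n → Fin T := fun i => ⟨(i : ℕ) / 8 % T, Nat.mod_lt _ hT⟩
  let R : SimpleGraph (Fin n) :=
    { Adj := fun i j => rd (p i) (p j)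
      symm := ⟨fun i j h => rd_symm _ _ h⟩
      loopless := ⟨fun i h => rd_irr _ h⟩ }
  let B : SimpleGraph (Fin n) :=
    { Adj := fun i j => (p i = p j ∧ r (f i) (f j)) ∨ (p i ≠ p j ∧ ¬ rd (p i) (p j))
      symm := ⟨fun i j h => by
        rcases h with h | h
        · exact Or.inl ⟨h.1.symm, hsym _ _ h.2⟩
        · exact Or.inr ⟨h.1.symm, fun h' => h.2 (rd_symm _ _ h')⟩⟩
      loopless := ⟨fun i h => by
        rcases h with h | h
        · exact hirr _ h.2
        · exact h.1 rfl⟩ }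
  have hadj : ∀ i j, p i ≠ p j → (R ⊔ B).Adj i j := by
    intro i j hij
    by_cases h : rd (p i) (p j)
    · exact Or.inl h
    · exact Or.inr (Or.inr ⟨hij, h⟩)
  refine ⟨R ⊔ B, ?_, ⟨R, B, rfl, ?_, ?_, ?_⟩, ?_⟩
  · intro s hs
    rcases s.eq_empty_or_nonempty with rfl | ⟨x₀, hx₀⟩
    · simp; positivity
    have hp : ∀ x ∈ s, p x = p x₀ := by
      intro x hx
      by_contra h
      exact hs x hx x₀ hx₀ (fun h' => h (by rw [h'])) (hadj _ _ h)
    have h1 : ((s.image f).card : ℝ) ≤ δ * T := by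
      apply hind
      intro a ha b hb hab
      simp only [Finset.mem_image] at ha hb
      obtain ⟨x, hx, rfl⟩ := ha
      obtain ⟨y, hy, rfl⟩ := hb
      refine hs x hx y hy ?_ (Or.inr (Or.inl ⟨(hp x hx).trans (hp y hy).symm, hab⟩))
      rintro rfl
      exact hirr _ hab
    have h2 : (s.card : ℝ) ≤ (s.image f).card * ((n : ℝ) / (8 * T : ℕ) + 1) := by
      rw [Finset.card_eq_sum_card_image f s]
      push_cast
      rw [← nsmul_eq_mul, ← Finset.sum_const]
      apply Finset.sum_le_sum
      intro t _
      refine le_trans ?_ ((card_mod n (8 * T) ((p x₀ : ℕ) + 8 * t) (by omega)).trans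
        (by push_cast; rfl))
      norm_cast
      apply Finset.card_le_card
      intro x hx
      simp only [Finset.mem_filter, Finset.mem_univ, true_and] at hx ⊢
      have e1 : (x : ℕ) % 8 = p x₀ := by rw [← hp x hx.1]
      have e2 : (x : ℕ) / 8 % T = t := by rw [← hx.2]
      rw [Nat.mod_mul, e1, e2]
    have h3 : δ * T * ((n : ℝ) / (8 * T : ℕ) + 1) = δ * (n / 8 + T) := by
      push_cast
      field_simp
    have h4 : (s.card : ℝ) ≤ δ * T * ((n : ℝ) / (8 * T : ℕ) + 1) :=
      h2.trans (mul_le_mul_of_nonneg_right h1 (by positivity))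
    rw [h3] at h4
    refine h4.trans (mul_le_mul_of_nonneg_left ?_ hδ.le)
    linarith
  · ext i j
    simp only [SimpleGraph.inf_adj, SimpleGraph.bot_adj, iff_false, not_and]
    intro h h'
    rcases h' with h' | h'
    · have h : rd (p i) (p j) := h
      rw [h'.1] at h
      exact rd_irr _ h
    · exact h'.2 h
  · intro s hs
    obtain ⟨a, b, c, hab, hac, hbc, _⟩ := SimpleGraph.is3Clique_iff.1 hs
    exact rd_tri _ _ _ hab hbc hac
  · intro s hs
    have hcl := hs.1
    have h1 : (s.image p).card ≤ 3 := by
      apply rd_ind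
      intro a ha b hb hab
      simp only [Finset.mem_image] at ha hb
      obtain ⟨x, hx, rfl⟩ := ha
      obtain ⟨y, hy, rfl⟩ := hb
      have hxy : x ≠ y := by
        rintro rfl
        exact rd_irr _ hab
      rcases hcl hx hy hxy with h | h
      · rw [h.1] at hab
        exact rd_irr _ hab
      · exact h.2 hab
    have h2 : s.card ≤ 2 * (s.image p).card := by
      apply Finset.card_le_mul_card_image
      intro q _
      by_contra! h
      obtain ⟨a, b, c, ha, hb, hc, hab, hac, hbc⟩ := Finset.two_lt_card_iff.1 h
      simp only [Finset.mem_filter] at ha hb hc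
      have key : ∀ x y, x ∈ s → y ∈ s → p x = q → p y = q → x ≠ y → r (f x) (f y) := by
        intro x y hx hy hpx hpy hxy
        rcases hcl hx hy hxy with h | h
        · exact h.2
        · exact absurd (hpx.trans hpy.symm) h.1
      exact htri _ _ _ (key a b ha.1 hb.1 ha.2 hb.2 hab) (key b c hb.1 hc.1 hb.2 hc.2 hbc)
        (key a c ha.1 hc.1 ha.2 hc.2 hac)
    have := hs.2
    omega
  · generalize R ⊔ B = G at hadj ⊢
    have hE : (G.edgeSet.ncard : ℝ) = (G.edgeFinset.card : ℝ) := by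
      rw [← SimpleGraph.coe_edgeFinset, Set.ncard_coe_finset]
    rw [hE]
    have hdeg : ∀ i, (n : ℝ) - (n / 8 + 1) ≤ G.degree i := by
      intro i
      have h1 : (Finset.univ.filter (fun j : Fin n => ¬ (j : ℕ) % 8 = p i)) ⊆
          G.neighborFinset i := by
        intro j hj
        simp only [Finset.mem_filter, Finset.mem_univ, true_and] at hj
        rw [SimpleGraph.mem_neighborFinset]
        exact hadj _ _ (fun h => hj (by rw [h]))
      have h2 := Finset.card_le_card h1
      rw [SimpleGraph.card_neighborFinset_eq_degree] at h2
      have h3 := Finset.card_filter_add_card_filter_not (s := (Finset.univ : Finset (Fin n)))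
        (fun j : Fin n => (j : ℕ) % 8 = p i)
      simp only [Finset.card_univ, Fintype.card_fin] at h3
      have h4 := card_mod n 8 (p i) (by norm_num)
      have h2' : ((Finset.univ.filter (fun j : Fin n => ¬ (j : ℕ) % 8 = p i)).card : ℝ) ≤
        G.degree i := by exact_mod_cast h2
      have h3' : ((Finset.univ.filter (fun j : Fin n => (j : ℕ) % 8 = p i)).card : ℝ) +
        (Finset.univ.filter (fun j : Fin n => ¬ (j : ℕ) % 8 = p i)).card = n := by
        exact_mod_cast h3
      push_cast at h4
      linarith
    have hsum : (∑ i, (G.degree i : ℝ)) = 2 * G.edgeFinset.card := by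
      exact_mod_cast G.sum_degrees_eq_twice_card_edges
    have hle : (n : ℝ) * (n - (n / 8 + 1)) ≤ ∑ i, (G.degree i : ℝ) := by
      have := Finset.sum_le_sum (fun i (_ : i ∈ (Finset.univ : Finset (Fin n))) => hdeg i)
      rw [Finset.sum_const, Finset.card_univ, Fintype.card_fin, nsmul_eq_mul] at this
      exact this
    have hen : 1 ≤ ε * n := by
      rw [div_lt_iff₀ hε] at hN₀
      nlinarith
    nlinarith [mul_le_mul_of_nonneg_right hen (Nat.cast_nonneg n : (0:ℝ) ≤ n),
      (Nat.cast_nonneg n : (0:ℝ) ≤ n)]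
end

section
/- Let p, q ≥ 3 be integers and let t ≥ 2 be an integer such that the complete graph on t − 1 vertices admits a 2-coloring of its edges with no red clique on q vertices and no blue clique on p vertices. Then for every δ > 0 there exists a positive integer N such that for every n ≥ N divisible by t and for every simple graph H on n/t vertices which contains no clique on p vertices and has independence number at most δ·n/t, there exists a simple graph G on n vertices with independence number at most δn, whose edge set can be partitioned into a 'red' part containing no clique on 2q vertices and a 'blue' part containing no clique on p vertices, and such that G has at least (1 − 1/t)·n²/2 + e(H) edges. -/
/-- There is a finite triangle-free graph with a probability weight such that every independent
set has weight at most `a`. -/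
def GoodWeight (a : ℝ) : Prop :=
  ∃ (V : Type) (_ : Fintype V) (F : SimpleGraph V) (w : V → ℝ),
    (∀ x y z, F.Adj x y → F.Adj y z → F.Adj x z → False) ∧ (∀ v, 0 ≤ w v) ∧ (∑ v, w v = 1) ∧
    ∀ s : Finset V, (∀ x ∈ s, ∀ y ∈ s, ¬ F.Adj x y) → ∑ v ∈ s, w v ≤ a

theorem GoodWeight.mono {a b : ℝ} (h : GoodWeight a) (hab : a ≤ b) : GoodWeight b := by
  obtain ⟨V, i, F, w, h1, h2, h3, h4⟩ := h
  exact ⟨V, i, F, w, h1, h2, h3, fun s hs => (h4 s hs).trans hab⟩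

theorem goodWeight_one : GoodWeight 1 := by
  refine ⟨Unit, inferInstance, ⊥, fun _ => 1, by simp, by simp, by simp, ?_⟩
  intro s _
  simp only [Finset.sum_const, nsmul_eq_mul, mul_one]
  exact_mod_cast s.card_le_univ.trans (by simp)

/-- Zykov step. -/
def zykov {V : Type} (F : SimpleGraph V) (k : ℕ) : SimpleGraph ((Fin k × V) ⊕ (Fin k → V)) where
  Adj x y := match x, y with
    | .inl (i, v), .inl (j, u) => i = j ∧ F.Adj v u
    | .inl (i, v), .inr f => f i = v
    | .inr f, .inl (i, v) => f i = v
    | .inr _, .inr _ => False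
  symm := ⟨by
    rintro (⟨i, v⟩ | f) (⟨j, u⟩ | g) h
    · exact ⟨h.1.symm, h.2.symm⟩
    · exact h
    · exact h
    · exact h⟩
  loopless := ⟨by
    rintro (⟨i, v⟩ | f) h
    · exact F.loopless.irrefl v h.2
    · exact h⟩

theorem zykov_bound {k : ℕ} {a : ℝ} (ha : 0 < a) (ha1 : a ≤ 1) (hk : 4 / a ^ 2 ≤ k)
    (b : Fin k → ℝ) (hb0 : ∀ i, 0 ≤ b i) (hb : ∀ i, b i ≤ a) :
    (1 - a / 4) / k * ∑ i, b i + a / 4 * ∏ i, (1 - b i) ≤ a - a ^ 2 / 8 := by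
  have hk0 : (0 : ℝ) < k := lt_of_lt_of_le (by positivity) hk
  have hprod : ∏ i, (1 - b i) ≤ Real.exp (-∑ i, b i) := by
    rw [← Finset.sum_neg_distrib, Real.exp_sum]
    refine Finset.prod_le_prod (fun i _ => by linarith [hb i]) (fun i _ => ?_)
    have := Real.add_one_le_exp (-b i)
    linarith
  have hsum0 : 0 ≤ ∑ i, b i := Finset.sum_nonneg fun i _ => hb0 i
  have hsum : ∑ i, b i ≤ k * a := by
    calc _ ≤ ∑ i : Fin k, a := Finset.sum_le_sum fun i _ => hb i
      _ = _ := by simp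
  set S := ∑ i, b i with hS
  have e1 : (1 - a / 4) / k * S = (1 - a / 4) * (S / k) := by ring
  have hm : S / k ≤ a := by rw [div_le_iff₀ hk0]; linarith
  have hm0 : 0 ≤ S / k := by positivity
  rw [e1]
  have hmul : a / 4 * ∏ i, (1 - b i) ≤ a / 4 * Real.exp (-S) := by gcongr
  rcases le_total (S / k) (a / 2) with h | h
  · have : Real.exp (-S) ≤ 1 := by simpa using hsum0
    nlinarith
  · have hS2 : 2 / a ≤ S := by
      rw [le_div_iff₀ hk0] at h
      have : 2 / a = a / 2 * (4 / a ^ 2) := by field_simp; norm_num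
      rw [this]
      exact (by gcongr : a / 2 * (4 / a ^ 2) ≤ a / 2 * k).trans h
    have : Real.exp (-S) ≤ a / 2 := by
      rw [Real.exp_neg, inv_le_comm₀ (Real.exp_pos _) (by positivity)]
      have := Real.add_one_le_exp S
      rw [inv_div]; linarith
    nlinarith

theorem GoodWeight.step {a : ℝ} (ha : 0 < a) (ha1 : a ≤ 1) (h : GoodWeight a) :
    GoodWeight (a - a ^ 2 / 8) := by
  classical
  obtain ⟨V, _, F, w, h1, h2, h3, h4⟩ := h
  obtain ⟨k, hk⟩ := exists_nat_ge (4 / a ^ 2)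
  have hk0 : (0 : ℝ) < k := lt_of_lt_of_le (by positivity) hk
  refine ⟨_, inferInstance, zykov F k,
    Sum.elim (fun x => (1 - a / 4) / k * w x.2) (fun f => a / 4 * ∏ i, w (f i)), ?_, ?_, ?_, ?_⟩
  · rintro (⟨i, v⟩ | f) (⟨j, u⟩ | g) (⟨l, z⟩ | e) hxy hyz hxz <;> simp only [zykov] at hxy hyz hxz
    · exact h1 _ _ _ hxy.2 hyz.2 hxz.2
    · obtain ⟨rfl, h⟩ := hxy
      subst hyz; subst hxz; exact F.loopless.irrefl _ h
    · obtain ⟨rfl, h⟩ := hxz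
      subst hyz; subst hxy; exact F.loopless.irrefl _ h
    · obtain ⟨rfl, h⟩ := hyz
      subst hxz; subst hxy; exact F.loopless.irrefl _ h
  · rintro (x | f)
    · exact mul_nonneg (div_nonneg (by linarith) hk0.le) (h2 _)
    · exact mul_nonneg (by linarith) (Finset.prod_nonneg fun i _ => h2 _)
  · have : ∑ f : Fin k → V, ∏ i, w (f i) = 1 := by
      have := Finset.prod_univ_sum (fun _ : Fin k => (Finset.univ : Finset V)) (fun _ v => w v)
      simpa [h3, Fintype.piFinset_univ] using this.symm
    simp only [Fintype.sum_sum_type, Sum.elim_inl, Sum.elim_inr, ← Finset.mul_sum, this,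
      Fintype.sum_prod_type, h3]
    simp
    field_simp
    ring
  · intro s hs
    set A : Fin k → Finset V := fun i => Finset.univ.filter fun v => Sum.inl (i, v) ∈ s with hA
    have hAmem : ∀ i v, v ∈ A i ↔ Sum.inl (i, v) ∈ s := by simp [hA]
    have hb := zykov_bound ha ha1 hk (fun i => ∑ v ∈ A i, w v)
      (fun i => Finset.sum_nonneg fun _ _ => h2 _)
      (fun i => h4 _ (fun x hx y hy hxy =>
        hs _ ((hAmem i x).1 hx) _ ((hAmem i y).1 hy) ⟨rfl, hxy⟩))
    refine le_trans ?_ hb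
    rw [← Finset.univ_inter s, ← Finset.sum_ite_mem, Fintype.sum_sum_type]
    refine add_le_add ?_ ?_
    · rw [Fintype.sum_prod_type, Finset.mul_sum]
      refine Finset.sum_le_sum fun i _ => ?_
      rw [Finset.mul_sum, ← Finset.univ_inter (A i), ← Finset.sum_ite_mem]
      simp [hAmem]
    · have hc : ∀ i, 1 - ∑ v ∈ A i, w v = ∑ v ∈ (A i)ᶜ, w v := by
        intro i; rw [← h3, ← Finset.sum_add_sum_compl (A i)]; ring
      simp only [hc, Finset.prod_univ_sum, Finset.mul_sum]
      rw [← Finset.sum_filter]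
      refine Finset.sum_le_sum_of_subset_of_nonneg ?_ ?_
      · intro f hf
        simp only [Finset.mem_filter, Finset.mem_univ, true_and] at hf
        simp only [Fintype.mem_piFinset, Finset.mem_compl, hAmem]
        intro i hi
        exact hs _ hf _ hi rfl
      · intro f _ _
        exact mul_nonneg (by linarith) (Finset.prod_nonneg fun i _ => h2 _)

theorem goodWeight_all {ε : ℝ} (hε : 0 < ε) : GoodWeight ε := by
  have key : ∀ n : ℕ, GoodWeight (max ε (1 - n * (ε ^ 2 / 8))) := by
    intro n
    induction n with
    | zero => exact goodWeight_one.mono (by simp)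
    | succ n ih =>
      rcases le_total (1 - n * (ε ^ 2 / 8)) ε with h | h
      · rw [max_eq_left h] at ih
        exact ih.mono (le_max_left _ _)
      · rw [max_eq_right h] at ih
        refine (GoodWeight.step (by linarith) ?_ ih).mono ?_
        · have : 0 ≤ n * (ε ^ 2 / 8) := by positivity
          linarith
        · refine le_trans ?_ (le_max_right _ _)
          push_cast
          have : ε ^ 2 ≤ (1 - n * (ε ^ 2 / 8)) ^ 2 := by gcongr
          linarith
  obtain ⟨n, hn⟩ := exists_nat_ge (1 / (ε ^ 2 / 8))
  refine (key n).mono (max_le le_rfl ?_)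
  rw [div_le_iff₀ (by positivity)] at hn
  linarith

/-- Triangle-free graphs with small independence number on all large vertex sets. -/
theorem exists_triangleFree {ε : ℝ} (hε : 0 < ε) : ∃ M : ℕ, ∀ m : ℕ, M ≤ m →
    ∃ F : SimpleGraph (Fin m), (∀ x y z, F.Adj x y → F.Adj y z → F.Adj x z → False) ∧
      ∀ s : Finset (Fin m), (∀ x ∈ s, ∀ y ∈ s, ¬ F.Adj x y) → (s.card : ℝ) ≤ ε * m := by
  classical
  obtain ⟨V, _, F, w, h1, h2, h3, h4⟩ := goodWeight_all (half_pos hε)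
  obtain ⟨M, hM⟩ := exists_nat_ge (Fintype.card V / (ε / 2))
  refine ⟨M, fun m hm => ?_⟩
  have hcard : Fintype.card (Fin m) ≤ Fintype.card (Σ v : V, Fin ⌈w v * m⌉₊) := by
    simp only [Fintype.card_fin, Fintype.card_sigma]
    have : (m : ℝ) ≤ ∑ v, (⌈w v * m⌉₊ : ℝ) := by
      calc (m : ℝ) = ∑ v, w v * m := by rw [← Finset.sum_mul, h3, one_mul]
        _ ≤ _ := Finset.sum_le_sum fun v _ => Nat.le_ceil _
    exact_mod_cast this
  obtain ⟨g⟩ := Function.Embedding.nonempty_of_card_le hcard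
  refine ⟨F.comap (fun x => (g x).1), fun x y z hxy hyz hxz => h1 _ _ _ hxy hyz hxz, ?_⟩
  intro s hs
  set T := s.image (fun x => (g x).1) with hT
  have hT4 := h4 T (by
    intro x hx y hy
    simp only [hT, Finset.mem_image] at hx hy
    obtain ⟨x, hx, rfl⟩ := hx
    obtain ⟨y, hy, rfl⟩ := hy
    exact hs x hx y hy)
  have hle : s.card ≤ (T.sigma fun v => (Finset.univ : Finset (Fin ⌈w v * m⌉₊))).card := by
    refine Finset.card_le_card_of_injOn g ?_ g.injective.injOn
    intro x hx
    simp only [Finset.coe_sigma, Set.mem_sigma_iff, Finset.mem_coe, Finset.mem_univ, and_true, hT]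
    exact Finset.mem_image_of_mem _ hx
  rw [Finset.card_sigma] at hle
  simp only [Finset.card_univ, Fintype.card_fin] at hle
  have hle' : (s.card : ℝ) ≤ ∑ v ∈ T, (⌈w v * m⌉₊ : ℝ) := by exact_mod_cast hle
  have h5 : ∑ v ∈ T, (⌈w v * m⌉₊ : ℝ) ≤ ∑ v ∈ T, (w v * m + 1) :=
    Finset.sum_le_sum fun v _ => (Nat.ceil_lt_add_one (mul_nonneg (h2 v) (by positivity))).le
  rw [Finset.sum_add_distrib, ← Finset.sum_mul] at h5
  simp only [Finset.sum_const, nsmul_eq_mul, mul_one] at h5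
  have h6 : (T.card : ℝ) ≤ Fintype.card V := by exact_mod_cast T.card_le_univ
  have h7 : (Fintype.card V : ℝ) ≤ m * (ε / 2) := by
    rw [← div_le_iff₀ (by positivity)]
    exact hM.trans (by exact_mod_cast hm)
  have h8 : (∑ v ∈ T, w v) * m ≤ ε / 2 * m := by gcongr
  linarith

theorem two_mul_edges {n : ℕ} (G : SimpleGraph (Fin n)) [DecidableRel G.Adj] :
    2 * (G.edgeSet.ncard : ℝ) = ∑ x, ∑ y, if G.Adj x y then (1 : ℝ) else 0 := by
  have h := G.sum_degrees_eq_twice_card_edges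
  have h2 : G.edgeSet.ncard = G.edgeFinset.card := by
    rw [← SimpleGraph.coe_edgeFinset, Set.ncard_coe_finset]
  rw [h2]
  have h' : (2 : ℝ) * G.edgeFinset.card = ∑ x, (G.degree x : ℝ) := by exact_mod_cast h.symm
  rw [h']
  refine Finset.sum_congr rfl fun x _ => ?_
  simp [← SimpleGraph.card_neighborFinset_eq_degree, SimpleGraph.neighborFinset_eq_filter]

/-- red graph -/
def redG {ι α β : Type*} (e : α → Option ι × β) (R : SimpleGraph ι) (F : SimpleGraph β) :
    SimpleGraph α where
  Adj x y := match (e x).1, (e y).1 with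
    | none, none => False
    | none, some _ => True
    | some _, none => True
    | some i, some j => R.Adj i j ∨ (i = j ∧ F.Adj (e x).2 (e y).2)
  symm := ⟨by
    intro x y h
    revert h
    cases (e x).1 <;> cases (e y).1 <;> simp [SimpleGraph.adj_comm, eq_comm]⟩
  loopless := ⟨by
    intro x h
    revert h
    cases (e x).1 <;> simp⟩

/-- blue graph -/
def blueG {ι α β : Type*} (e : α → Option ι × β) (B : SimpleGraph ι) (H : SimpleGraph β) :
    SimpleGraph α where
  Adj x y := match (e x).1, (e y).1 with
    | none, none => H.Adj (e x).2 (e y).2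
    | none, some _ => False
    | some _, none => False
    | some i, some j => B.Adj i j
  symm := ⟨by
    intro x y h
    revert h
    cases (e x).1 <;> cases (e y).1 <;> simp [SimpleGraph.adj_comm]⟩
  loopless := ⟨by
    intro x h
    revert h
    cases (e x).1 <;> simp⟩

theorem redG_cliqueFree {ι α β : Type*} (e : α ≃ Option ι × β) {R : SimpleGraph ι}
    {F : SimpleGraph β} {q : ℕ} (hR : R.CliqueFree q)
    (hF : ∀ x y z, F.Adj x y → F.Adj y z → F.Adj x z → False) :
    (redG e R F).CliqueFree (2 * q) := by
  classical
  intro s hs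
  obtain ⟨hc, hcard⟩ := hs
  set S0 := s.filter fun x => (e x).1 = none with hS0
  set S1 := s.filter fun x => ¬ (e x).1 = none with hS1
  have hsum : S0.card + S1.card = s.card := Finset.card_filter_add_card_filter_not _
  have h0 : S0.card ≤ 1 := by
    rw [Finset.card_le_one]
    intro x hx y hy
    by_contra hxy
    simp only [hS0, Finset.mem_filter] at hx hy
    have := hc hx.1 hy.1 hxy
    simp [redG, hx.2, hy.2] at this
  set T : Finset ι := s.biUnion fun x => (e x).1.toFinset with hTdef
  have hTmem : ∀ i, i ∈ T ↔ ∃ x ∈ s, (e x).1 = some i := by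
    intro i; simp [hTdef, Option.mem_toFinset]
  have hTc : R.IsClique T := by
    intro i hi j hj hij
    obtain ⟨x, hx, hxi⟩ := (hTmem i).1 hi
    obtain ⟨y, hy, hyj⟩ := (hTmem j).1 hj
    have hxy : x ≠ y := by
      rintro rfl
      rw [hxi] at hyj
      exact hij (Option.some.inj hyj)
    have := hc hx hy hxy
    simpa [redG, hxi, hyj, hij] using this
  have hTcard : T.card < q := by
    by_contra hlt
    exact hR.mono (not_lt.1 hlt) T ⟨hTc, rfl⟩
  have h1 : S1.card ≤ 2 * T.card := by
    have hmaps : ∀ x ∈ S1, (e x).1 ∈ T.image some := by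
      intro x hx
      simp only [hS1, Finset.mem_filter] at hx
      obtain ⟨i, hi⟩ := Option.ne_none_iff_exists'.1 hx.2
      rw [hi]
      exact Finset.mem_image_of_mem _ ((hTmem i).2 ⟨x, hx.1, hi⟩)
    have := Finset.card_le_mul_card_image_of_maps_to hmaps 2 ?_
    · rwa [Finset.card_image_of_injective _ (Option.some_injective _)] at this
    · intro o ho
      obtain ⟨i, hi, rfl⟩ := Finset.mem_image.1 ho
      by_contra hgt
      obtain ⟨x, y, z, hx, hy, hz, hxy, hxz, hyz⟩ := Finset.two_lt_card_iff.1 (not_le.1 hgt)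
      simp only [hS1, Finset.mem_filter] at hx hy hz
      have a1 := hc hx.1.1 hy.1.1 hxy
      have a2 := hc hy.1.1 hz.1.1 hyz
      have a3 := hc hx.1.1 hz.1.1 hxz
      simp [redG, hx.2, hy.2, hz.2] at a1 a2 a3
      exact hF _ _ _ a1 a2 a3
  omega

theorem blueG_cliqueFree {ι α β : Type*} (e : α ≃ Option ι × β) {B : SimpleGraph ι}
    {H : SimpleGraph β} {p : ℕ} (hp : 0 < p) (hB : B.CliqueFree p) (hH : H.CliqueFree p) :
    (blueG e B H).CliqueFree p := by
  classical
  intro s hs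
  obtain ⟨hc, hcard⟩ := hs
  have hne : s.Nonempty := by rw [← Finset.card_pos]; omega
  obtain ⟨x0, hx0⟩ := hne
  cases h0 : (e x0).1 with
  | none =>
    have hall : ∀ x ∈ s, (e x).1 = none := by
      intro x hx
      by_cases hxx : x0 = x
      · rw [← hxx]; exact h0
      · have := hc hx0 hx hxx
        cases h : (e x).1 with
        | none => rfl
        | some i => simp [blueG, h0, h] at this
    have hadj : ∀ x ∈ s, ∀ y ∈ s, x ≠ y → H.Adj (e x).2 (e y).2 := by
      intro x hx y hy hxy
      simpa [blueG, hall x hx, hall y hy] using hc hx hy hxy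
    refine hH (s.image fun x => (e x).2) ⟨?_, ?_⟩
    · intro a ha b hb hab
      simp only [Finset.coe_image, Set.mem_image, Finset.mem_coe] at ha hb
      obtain ⟨x, hx, rfl⟩ := ha
      obtain ⟨y, hy, rfl⟩ := hb
      exact hadj x hx y hy (fun h : x = y => hab (by rw [h]))
    · rw [Finset.card_image_of_injOn, hcard]
      intro x hx y hy hxy
      by_contra hne
      have := hadj x hx y hy hne
      simp only at hxy
      rw [hxy] at this
      exact H.loopless.irrefl _ this
  | some i0 =>
    have hall : ∀ x ∈ s, ∃ i, (e x).1 = some i := by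
      intro x hx
      by_cases hxx : x0 = x
      · rw [← hxx]; exact ⟨_, h0⟩
      · have := hc hx0 hx hxx
        cases h : (e x).1 with
        | none => simp [blueG, h0, h] at this
        | some i => exact ⟨i, rfl⟩
    set c : α → ι := fun x => (e x).1.getD i0 with hcdef
    have hadj : ∀ x ∈ s, ∀ y ∈ s, x ≠ y → B.Adj (c x) (c y) := by
      intro x hx y hy hxy
      obtain ⟨i, hi⟩ := hall x hx
      obtain ⟨j, hj⟩ := hall y hy
      simpa [blueG, hi, hj, hcdef] using hc hx hy hxy
    refine hB (s.image c) ⟨?_, ?_⟩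
    · intro a ha b hb hab
      simp only [Finset.coe_image, Set.mem_image, Finset.mem_coe] at ha hb
      obtain ⟨x, hx, rfl⟩ := ha
      obtain ⟨y, hy, rfl⟩ := hb
      exact hadj x hx y hy (fun h : x = y => hab (by rw [h]))
    · rw [Finset.card_image_of_injOn, hcard]
      intro x hx y hy hxy
      by_contra hne
      have := hadj x hx y hy hne
      rw [hxy] at this
      exact B.loopless.irrefl _ this

/-- Finitary form of the lower-bound construction lemma: if K_{t-1} admits a 2-coloring with
no red K_q and no blue K_p, then for every δ > 0 and all large n divisible by t, any
K_p-free graph H on n/t vertices with independence number at most δ·n/t can be completed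
to an n-vertex graph with independence number at most δn whose edges partition into a red
part with no K_{2q} and a blue part with no K_p, with at least (1 − 1/t)n²/2 + e(H) edges. -/
theorem rt_lower_construction (p q t : ℕ) (hp : 3 ≤ p) (hq : 3 ≤ q) (ht : 2 ≤ t)
    (hRam : ∃ R B : SimpleGraph (Fin (t - 1)),
        R ⊔ B = ⊤ ∧ R ⊓ B = ⊥ ∧ R.CliqueFree q ∧ B.CliqueFree p) :
    ∀ δ : ℝ, 0 < δ → ∃ N : ℕ, 0 < N ∧ ∀ n : ℕ, N ≤ n → t ∣ n →
      ∀ H : SimpleGraph (Fin (n / t)), H.CliqueFree p →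
        (∀ s : Finset (Fin (n / t)),
            (∀ x ∈ s, ∀ y ∈ s, x ≠ y → ¬ H.Adj x y) → (s.card : ℝ) ≤ δ * n / t) →
        ∃ G : SimpleGraph (Fin n),
          (∀ s : Finset (Fin n),
              (∀ x ∈ s, ∀ y ∈ s, x ≠ y → ¬ G.Adj x y) → (s.card : ℝ) ≤ δ * n) ∧
          (∃ R B : SimpleGraph (Fin n), R ⊔ B = G ∧ R ⊓ B = ⊥ ∧
              R.CliqueFree (2 * q) ∧ B.CliqueFree p) ∧
          (1 - 1 / (t : ℝ)) * n ^ 2 / 2 + (H.edgeSet.ncard : ℝ) ≤ (G.edgeSet.ncard : ℝ) := by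
  classical
  intro δ hδ
  obtain ⟨R0, B0, hsup, hinf, hR, hB⟩ := hRam
  have hRB : ∀ i j, i ≠ j → R0.Adj i j ∨ B0.Adj i j := by
    intro i j hij
    have : (R0 ⊔ B0).Adj i j := by rw [hsup]; exact hij
    exact this
  have hRB' : ∀ i j, R0.Adj i j → B0.Adj i j → False := by
    intro i j h1 h2
    have : (R0 ⊓ B0).Adj i j := ⟨h1, h2⟩
    rw [hinf] at this
    exact this
  obtain ⟨M, hM⟩ := exists_triangleFree hδ
  refine ⟨t * M + 1, by omega, ?_⟩
  intro n hn htn H hHp hHind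
  obtain ⟨m, hnm⟩ := htn
  have hmt : n / t = m := by rw [hnm]; exact Nat.mul_div_cancel_left _ (by omega)
  rw [← hmt] at hnm
  have hMm : M ≤ n / t := by
    by_contra hlt
    have : t * (n / t) ≤ t * M := Nat.mul_le_mul_left _ (by omega)
    omega
  clear hmt m
  generalize n / t = m at *
  obtain ⟨F, hF, hFind⟩ := hM m hMm
  have ht0 : (0 : ℝ) < t := by exact_mod_cast (by omega : 0 < t)
  have ht1 : (1 : ℝ) ≤ t := by exact_mod_cast (by omega : 1 ≤ t)
  have hnR : (n : ℝ) = t * m := by exact_mod_cast hnm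
  have hδn : δ * n / t = δ * m := by rw [hnR]; field_simp
  have hδm : δ * m ≤ δ * n := by
    rw [hnR]
    have : (m : ℝ) ≤ t * m := le_mul_of_one_le_left (by positivity) ht1
    gcongr
  have hcard : Fintype.card (Fin n) = Fintype.card (Option (Fin (t - 1)) × Fin m) := by
    simp only [Fintype.card_fin, Fintype.card_prod, Fintype.card_option]
    rw [hnm, Nat.sub_add_cancel (by omega)]
  let e := Fintype.equivOfCardEq hcard
  have hadj : ∀ x y, (e x).1 ≠ (e y).1 → (redG e R0 F ⊔ blueG e B0 H).Adj x y := by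
    intro x y hxy
    simp only [SimpleGraph.sup_adj, redG, blueG]
    cases hx : (e x).1 <;> cases hy : (e y).1
    · simp [hx, hy] at hxy
    · simp
    · simp
    · rw [hx, hy] at hxy
      have := hRB _ _ (fun h => hxy (congrArg some h))
      simp only
      tauto
  have hadjH : ∀ x y, (e x).1 = none → (e y).1 = none → H.Adj (e x).2 (e y).2 →
      (redG e R0 F ⊔ blueG e B0 H).Adj x y := by
    intro x y hx hy h
    simpa [redG, blueG, hx, hy] using h
  have hadjF : ∀ x y i, (e x).1 = some i → (e y).1 = some i → F.Adj (e x).2 (e y).2 →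
      (redG e R0 F ⊔ blueG e B0 H).Adj x y := by
    intro x y i hx hy h
    simp [redG, blueG, hx, hy, h]
  refine ⟨redG e R0 F ⊔ blueG e B0 H, ?_, ⟨_, _, rfl, ?_, ?_, ?_⟩, ?_⟩
  · intro s hs
    rcases s.eq_empty_or_nonempty with rfl | ⟨x0, hx0⟩
    · simp only [Finset.card_empty, Nat.cast_zero]; positivity
    have hsame : ∀ x ∈ s, (e x).1 = (e x0).1 := by
      intro x hx
      by_contra hne
      exact hs x hx x0 hx0 (fun h : x = x0 => hne (by rw [h])) (hadj x x0 hne)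
    have hinj : Set.InjOn (fun x => (e x).2) s := by
      intro x hx y hy hxy
      exact e.injective (Prod.ext ((hsame x hx).trans (hsame y hy).symm) hxy)
    rw [← Finset.card_image_of_injOn hinj]
    refine le_trans ?_ hδm
    cases h0 : (e x0).1 with
    | none =>
      rw [← hδn]
      apply hHind
      intro a ha b hb hab h
      simp only [Finset.mem_image] at ha hb
      obtain ⟨x, hx, rfl⟩ := ha
      obtain ⟨y, hy, rfl⟩ := hb
      exact hs x hx y hy (fun h : x = y => hab (by rw [h]))
        (hadjH x y ((hsame x hx).trans h0) ((hsame y hy).trans h0) h)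
    | some i =>
      apply hFind
      intro a ha b hb h
      simp only [Finset.mem_image] at ha hb
      obtain ⟨x, hx, rfl⟩ := ha
      obtain ⟨y, hy, rfl⟩ := hb
      exact hs x hx y hy (fun hxy : x = y => F.ne_of_adj h (by rw [hxy]))
        (hadjF x y i ((hsame x hx).trans h0) ((hsame y hy).trans h0) h)
  · ext x y
    simp only [SimpleGraph.inf_adj, redG, blueG, SimpleGraph.bot_adj, iff_false]
    cases hx : (e x).1 <;> cases hy : (e y).1
    · simp
    · simp
    · simp
    · simp only
      rintro ⟨h1 | ⟨rfl, _⟩, h2⟩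
      · exact hRB' _ _ h1 h2
      · exact B0.loopless.irrefl _ h2
  · exact redG_cliqueFree e hR hF
  · exact blueG_cliqueFree e (by omega) hB hHp
  · have hG := two_mul_edges (redG e R0 F ⊔ blueG e B0 H)
    have hHe := two_mul_edges H
    have hle : ∑ x, ∑ y, ((1 : ℝ) - (if (e x).1 = (e y).1 then 1 else 0) +
        (if (e x).1 = none then (if (e y).1 = none then
          (if H.Adj (e x).2 (e y).2 then 1 else 0) else 0) else 0)) ≤
        ∑ x, ∑ y, if (redG e R0 F ⊔ blueG e B0 H).Adj x y then (1 : ℝ) else 0 := by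
      refine Finset.sum_le_sum fun x _ => Finset.sum_le_sum fun y _ => ?_
      by_cases hxy : (e x).1 = (e y).1
      · by_cases hx : (e x).1 = none
        · have hy : (e y).1 = none := hxy ▸ hx
          by_cases h : H.Adj (e x).2 (e y).2
          · rw [if_pos (hadjH x y hx hy h)]; simp [hx, hy, h]
          · simp only [hx, hy, h, if_true, if_false]
            split_ifs <;> norm_num
        · simp only [hxy, if_true]
          rw [if_neg (hxy ▸ hx)]
          split_ifs <;> norm_num
      · rw [if_pos (hadj x y hxy)]
        by_cases hx : (e x).1 = none
        · have hy : ¬ (e y).1 = none := fun hy => hxy (hx.trans hy.symm)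
          simp [hxy, hy]
        · simp [hxy, hx]
    have heq : ∑ x, ∑ y, ((1 : ℝ) - (if (e x).1 = (e y).1 then 1 else 0) +
        (if (e x).1 = none then (if (e y).1 = none then
          (if H.Adj (e x).2 (e y).2 then 1 else 0) else 0) else 0)) =
        (n : ℝ) ^ 2 - n * m + 2 * H.edgeSet.ncard := by
      let g : Option (Fin (t - 1)) × Fin m → Option (Fin (t - 1)) × Fin m → ℝ := fun x y =>
        ((1 : ℝ) - (if x.1 = y.1 then 1 else 0) +
        (if x.1 = none then (if y.1 = none then
          (if H.Adj x.2 y.2 then 1 else 0) else 0) else 0))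
      have h1 : ∑ x, ∑ y, g (e x) (e y) = ∑ x, ∑ y, g x y := by
        rw [← e.sum_comp]
        refine Finset.sum_congr rfl fun x _ => ?_
        rw [← e.sum_comp]
      refine h1.trans ?_
      simp only [g, Finset.sum_add_distrib, Finset.sum_sub_distrib]
      congr 1
      · have hc : (Fintype.card (Option (Fin (t - 1)) × Fin m) : ℝ) = n := by
          rw [← hcard]; simp
        congr 1
        · simp only [Finset.sum_const, Finset.card_univ, nsmul_eq_mul, hc]; ring
        · have : ∀ x : Option (Fin (t - 1)) × Fin m,
              ∑ y : Option (Fin (t - 1)) × Fin m, (if x.1 = y.1 then (1 : ℝ) else 0) = m := by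
            intro x
            rw [Fintype.sum_prod_type_right]
            simp only [Finset.sum_ite_eq, Finset.mem_univ, if_true]
            simp
          simp only [this, Finset.sum_const, Finset.card_univ, nsmul_eq_mul, hc]
      · rw [hHe]
        simp [Fintype.sum_prod_type]
    have hfin : (1 - 1 / (t : ℝ)) * n ^ 2 = n ^ 2 - n * m := by
      rw [hnR]; field_simp
    linarith
end
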